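/- arXiv:math/0701016 — 6 statements merged into one kernel-verified Lean document; each statement's English description precedes it below -/
import Mathlib

section
/- Let G be a finite 2-edge-connected simple graph of maximum degree at most 3 and girth at least 4. Then the line graph L(G) admits an (11,3)-coloring, i.e., the circular chromatic index of G is at most 11/3. -/
open SimpleGraph

/-- A `(p,q)`-coloring of a simple graph `H`: a function into `{0,...,p-1}` such that
adjacent vertices `x, y` satisfy `q ≤ |f x - f y| ≤ p - q`. -/
def IsPQColoring {V : Type*} (H : SimpleGraph V) (p q : ℕ) (f : V → ℕ) : Prop :=
  (∀ v, f v < p) ∧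
    ∀ x y, H.Adj x y → (q : ℤ) ≤ |(f x : ℤ) - (f y : ℤ)| ∧ |(f x : ℤ) - (f y : ℤ)| ≤ (p : ℤ) - q


/-- A graph is 2-edge-connected if it is connected, has at least two vertices,
and has no bridge (cut edge). -/
def TwoEdgeConnected {V : Type*} [Fintype V] (G : SimpleGraph V) : Prop :=
  G.Connected ∧ 2 ≤ Fintype.card V ∧ ∀ e, ¬ G.IsBridge e


set_option linter.unusedSectionVars false

/-- two colours of `ℤ/11` are at circular distance at least 3 -/
def Far (a b : ℕ) : Prop := (3 : ℤ) ≤ |(a : ℤ) - b| ∧ |(a : ℤ) - b| ≤ 8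

instance (a b : ℕ) : Decidable (Far a b) := by unfold Far; infer_instance

lemma Far.symm {a b : ℕ} (h : Far a b) : Far b a := by
  unfold Far at *
  rw [abs_sub_comm]; exact h

/-- embed `{-1,0,1}` into `{0,..,10}` -/
def emb (x : ℤ) : ℕ := if x = 1 then 1 else if x = 0 then 0 else 10

/-- consecutive colours `a`, `b` at a vertex whose matching edge has colour `emb x` -/
def Good (a b : ℕ) (x : ℤ) : Prop := Far a b ∧ Far (emb x) a ∧ Far (emb x) b

instance (a b : ℕ) (x : ℤ) : Decidable (Good a b x) := by unfold Good; infer_instance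

lemma good47 : ∀ x : ℤ, (x = -1 ∨ x = 0 ∨ x = 1) → Good 4 7 x ∧ Good 7 4 x := by
  rintro x (rfl | rfl | rfl) <;> decide

section cyc
variable {W : Type*} [Finite W] (σ : Equiv.Perm W)

lemma period_pos (i : W) : 0 < Function.minimalPeriod σ i := by
  apply Function.minimalPeriod_pos_of_mem_periodicPts
  exact σ.injective.mem_periodicPts i

lemma period_same {i v : W} (h : σ.SameCycle i v) :
    Function.minimalPeriod σ v = Function.minimalPeriod σ i := by
  obtain ⟨k, rfl⟩ := h.exists_nat_pow_eq
  rw [← Equiv.Perm.iterate_eq_pow]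
  exact Function.minimalPeriod_apply_iterate (σ.injective.mem_periodicPts i) k

lemma same_iterate (i : W) (k : ℕ) : σ.SameCycle i (σ^[k] i) := by
  rw [Equiv.Perm.iterate_eq_pow, Equiv.Perm.sameCycle_pow_right]

lemma exists_index {i v : W} (h : σ.SameCycle i v) :
    ∃ k < Function.minimalPeriod σ i, σ^[k] i = v := by
  obtain ⟨k, rfl⟩ := h.exists_nat_pow_eq
  rw [← Equiv.Perm.iterate_eq_pow]
  exact ⟨k % _, Nat.mod_lt _ (period_pos σ i), Function.iterate_mod_minimalPeriod_eq⟩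

lemma table_ext (i : W) (T : ℕ → ℕ) :
    ∃ e : W → ℕ, ∀ k < Function.minimalPeriod σ i, e (σ^[k] i) = T k := by
  classical
  refine ⟨fun v => if h : ∃ k < Function.minimalPeriod σ i, σ^[k] i = v then T h.choose else 0, ?_⟩
  intro k hk
  have h : ∃ k' < Function.minimalPeriod σ i, σ^[k'] i = σ^[k] i := ⟨k, hk, rfl⟩
  have h2 : h.choose = k :=
    (Function.iterate_eq_iterate_iff_of_lt_minimalPeriod h.choose_spec.1 hk).1 h.choose_spec.2
  simp only [dif_pos h, h2]

/-- the cycle of `i` can be coloured -/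
def CycOK (c : W → ℤ) (i : W) : Prop :=
  ∃ e : W → ℕ, ∀ v, σ.SameCycle i v → e v < 11 ∧ Good (e v) (e (σ v)) (c (σ v))

lemma cyc_of_table (c : W → ℤ) (i : W) (T : ℕ → ℕ) (hT : ∀ k, T k < 11)
    (h0 : Good (T (Function.minimalPeriod σ i - 1)) (T 0) (c i))
    (h1 : ∀ k, k + 1 < Function.minimalPeriod σ i → Good (T k) (T (k+1)) (c (σ^[k+1] i))) :
    CycOK σ c i := by
  obtain ⟨e, he⟩ := table_ext σ i T
  refine ⟨e, fun v hv => ?_⟩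
  obtain ⟨k, hk, rfl⟩ := exists_index σ hv
  rw [← Function.iterate_succ_apply' σ k i, he k hk, Nat.succ_eq_add_one]
  refine ⟨hT k, ?_⟩
  by_cases hk1 : k + 1 < Function.minimalPeriod σ i
  · rw [he _ hk1]; exact h1 k hk1
  · have : k + 1 = Function.minimalPeriod σ i := by omega
    rw [this, Function.iterate_minimalPeriod]
    have h00 := he 0 (period_pos σ i)
    simp only [Function.iterate_zero, id] at h00
    rw [h00]
    have : k = Function.minimalPeriod σ i - 1 := by omega
    rw [this]; exact h0

lemma cyc_even (c : W → ℤ) (hc : ∀ v, c v = -1 ∨ c v = 0 ∨ c v = 1) (i : W)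
    (hn : ¬ Odd (Function.minimalPeriod σ i)) : CycOK σ c i := by
  have hp := period_pos σ i
  rw [Nat.not_odd_iff_even] at hn
  refine cyc_of_table σ c i (fun k => if Even k then 4 else 7) ?_ ?_ ?_
  · intro k; split_ifs <;> norm_num
  · have : ¬ Even (Function.minimalPeriod σ i - 1) := by
      rw [Nat.even_sub' (by omega)]; simp [hn]
    simp only [this, if_false, Even.zero, if_true]
    exact (good47 _ (hc _)).2
  · intro k _
    by_cases hk : Even k
    · simp only [Nat.even_add_one, hk, not_true, if_true, if_false]
      exact (good47 _ (hc _)).1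
    · simp only [Nat.even_add_one, hk, not_false_eq_true, if_true, if_false]
      exact (good47 _ (hc _)).2

/-- the colour table of an odd cycle -/
def tab (a b d p q : ℕ) : ℕ → ℕ
  | 0 => a
  | 1 => b
  | 2 => d
  | (k+3) => if Even k then p else q

lemma cyc_odd_aux (c : W → ℤ) (hc : ∀ v, c v = -1 ∨ c v = 0 ∨ c v = 1) (i : W)
    (hn : Odd (Function.minimalPeriod σ i)) (h5 : 5 ≤ Function.minimalPeriod σ i)
    (a b d p q : ℕ) (hlt : a < 11 ∧ b < 11 ∧ d < 11)
    (hpq : (p = 4 ∧ q = 7) ∨ (p = 7 ∧ q = 4))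
    (g0 : Good q a (c i)) (g1 : Good a b (c (σ i))) (g2 : Good b d (c (σ (σ i))))
    (g3 : Good d p (c (σ (σ (σ i))))) : CycOK σ c i := by
  have hg : ∀ v, Good p q (c v) ∧ Good q p (c v) := by
    intro v
    rcases hpq with ⟨rfl, rfl⟩ | ⟨rfl, rfl⟩
    · exact good47 _ (hc v)
    · exact (good47 _ (hc v)).symm
  refine cyc_of_table σ c i (tab a b d p q) ?_ ?_ ?_
  · intro k
    match k with
    | 0 => exact hlt.1
    | 1 => exact hlt.2.1
    | 2 => exact hlt.2.2
    | (k+3) => simp only [tab]; split_ifs <;> omega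
  · obtain ⟨t, ht⟩ := hn
    have h3 : Function.minimalPeriod σ i - 1 = (2 * (t - 2) + 1) + 3 := by omega
    have h4 : ¬ Even (2 * (t - 2) + 1) := by simp
    rw [h3]
    simp only [tab, if_neg h4]
    exact g0
  · intro k _
    match k with
    | 0 => exact g1
    | 1 => exact g2
    | 2 => exact g3
    | (k+3) =>
      rw [show k + 3 + 1 = (k+1) + 3 by ring]
      by_cases hk : Even k
      · simp only [tab, Nat.even_add_one, hk, not_true, if_true, if_false]
        exact (hg _).1
      · simp only [tab, Nat.even_add_one, hk, not_false_eq_true, if_true, if_false]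
        exact (hg _).2

lemma cyc_odd (c : W → ℤ) (hc : ∀ v, c v = -1 ∨ c v = 0 ∨ c v = 1) (i : W)
    (hn : Odd (Function.minimalPeriod σ i)) (h5 : 5 ≤ Function.minimalPeriod σ i)
    (s : ℤ) (hs : s = 1 ∨ s = -1)
    (h : (c i = s ∧ c (σ i) = s ∧ c (σ (σ i)) ≠ s ∧ c (σ (σ (σ i))) ≠ s) ∨
      (c i ≠ s ∧ c (σ i) ≠ s ∧ c (σ (σ i)) = s ∧ c (σ (σ (σ i))) = s)) : CycOK σ c i := by
  have key : ∀ x0 x1 x2 x3 : ℤ, (x0 = -1 ∨ x0 = 0 ∨ x0 = 1) → (x1 = -1 ∨ x1 = 0 ∨ x1 = 1) →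
    (x2 = -1 ∨ x2 = 0 ∨ x2 = 1) → (x3 = -1 ∨ x3 = 0 ∨ x3 = 1) →
    ((x0 = s ∧ x1 = s ∧ x2 ≠ s ∧ x3 ≠ s) ∨ (x0 ≠ s ∧ x1 ≠ s ∧ x2 = s ∧ x3 = s)) →
    (Good 4 8 x0 ∧ Good 8 5 x1 ∧ Good 5 2 x2 ∧ Good 2 7 x3) ∨
    (Good 4 9 x0 ∧ Good 9 6 x1 ∧ Good 6 3 x2 ∧ Good 3 7 x3) ∨
    (Good 7 3 x0 ∧ Good 3 6 x1 ∧ Good 6 9 x2 ∧ Good 9 4 x3) ∨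
    (Good 7 2 x0 ∧ Good 2 5 x1 ∧ Good 5 8 x2 ∧ Good 8 4 x3) := by
    rcases hs with rfl | rfl <;>
    rintro _ _ _ _ (rfl | rfl | rfl) (rfl | rfl | rfl) (rfl | rfl | rfl) (rfl | rfl | rfl) <;> decide
  rcases key _ _ _ _ (hc i) (hc (σ i)) (hc (σ (σ i))) (hc (σ (σ (σ i)))) h with
    ⟨a, b, d, e⟩ | ⟨a, b, d, e⟩ | ⟨a, b, d, e⟩ | ⟨a, b, d, e⟩
  · exact cyc_odd_aux σ c hc i hn h5 8 5 2 7 4 (by norm_num) (by norm_num) a b d e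
  · exact cyc_odd_aux σ c hc i hn h5 9 6 3 7 4 (by norm_num) (by norm_num) a b d e
  · exact cyc_odd_aux σ c hc i hn h5 3 6 9 4 7 (by norm_num) (by norm_num) a b d e
  · exact cyc_odd_aux σ c hc i hn h5 2 5 8 4 7 (by norm_num) (by norm_num) a b d e

/-- glue the colourings of the individual cycles -/
lemma glue (c : W → ℤ) (h : ∀ v, ∃ i, σ.SameCycle i v ∧ CycOK σ c i) :
    ∃ e : W → ℕ, ∀ v, e v < 11 ∧ Good (e v) (e (σ v)) (c (σ v)) := by
  classical
  choose i hi using h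
  choose e he using fun v => (hi v).2
  let S : Setoid W := Equiv.Perm.SameCycle.setoid σ
  let r : W → W := fun v => (Quotient.mk S v).out
  have hr : ∀ v, σ.SameCycle (r v) v := fun v => Quotient.mk_out (s := S) v
  have hrσ : ∀ v, r (σ v) = r v := by
    intro v
    have : Quotient.mk S (σ v) = Quotient.mk S v := by
      apply Quotient.sound
      change σ.SameCycle (σ v) v
      rw [Equiv.Perm.sameCycle_apply_left]
    simp only [r, this]
  refine ⟨fun v => e (r v) v, fun v => ?_⟩
  dsimp only
  rw [hrσ]
  exact he (r v) v ((hi (r v)).1.trans (hr v))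
end cyc

section opt
variable {W : Type*} [Fintype W] [DecidableEq W] (σ : Equiv.Perm W) (m : W → W)

/-- the pattern `1,1,-1,-1` on the window starting at `i` -/
def pat (i v : W) : ℤ :=
  if v = i ∨ v = σ i then 1 else if v = σ (σ i) ∨ v = σ (σ (σ i)) then -1 else 0

/-- demand functions -/
def Valid (D : W → ℤ) : Prop :=
  (∀ v, ¬ Odd (Function.minimalPeriod σ v) → D v = 0) ∧
  ∀ v, Odd (Function.minimalPeriod σ v) → ∃ i, σ.SameCycle v i ∧ m i ≠ σ (σ (σ i)) ∧
    ∃ s : ℤ, (s = 1 ∨ s = -1) ∧ ∀ w, σ.SameCycle v w → D w = s * pat σ i w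

/-- the number of ends of mismatched edges -/
def cost (D : W → ℤ) : ℕ := (Finset.univ.filter fun v => D v * D (m v) = -1).card

lemma pat_vals (i v : W) : pat σ i v = -1 ∨ pat σ i v = 0 ∨ pat σ i v = 1 := by
  unfold pat; split_ifs <;> simp

lemma valid_vals {D : W → ℤ} (hD : Valid σ m D) (v : W) : D v = -1 ∨ D v = 0 ∨ D v = 1 := by
  by_cases h : Odd (Function.minimalPeriod σ v)
  · obtain ⟨i, -, -, s, hs, hw⟩ := hD.2 v h
    rw [hw v (Equiv.Perm.SameCycle.refl _ _)]
    rcases pat_vals σ i v with h | h | h <;> rcases hs with rfl | rfl <;> simp [h]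
  · simp [hD.1 v h]

lemma pat_ne_zero {i v : W} (h : pat σ i v ≠ 0) :
    v = i ∨ v = σ i ∨ v = σ (σ i) ∨ v = σ (σ (σ i)) := by
  unfold pat at h
  split_ifs at h with h1 h2
  · tauto
  · tauto
  · simp at h

/-- no chord inside an admissible window -/
lemma pat_chord (hm : ∀ v, m (m v) = v) (h1 : ∀ v, m v ≠ σ v) (h2 : ∀ v, m v ≠ σ (σ v))
    (hf : ∀ v, m v ≠ v)
    {i v : W} (hi : m i ≠ σ (σ (σ i))) (hv : pat σ i v ≠ 0) : pat σ i (m v) = 0 := by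
  by_contra h
  have hA := pat_ne_zero σ hv
  have hB := pat_ne_zero σ h
  have h1' : ∀ v, m (σ v) ≠ v := fun v hh => h1 v (by rw [← hh, hm, hh])
  have h2' : ∀ v, m (σ (σ v)) ≠ v := fun v hh => h2 v (by rw [← hh, hm, hh])
  have hi' : m (σ (σ (σ i))) ≠ i := fun hh => hi (by rw [← hh, hm, hh])
  rcases hA with rfl | rfl | rfl | rfl <;> rcases hB with hB | hB | hB | hB
  all_goals first
    | exact hf _ hB
    | exact h1 _ hB
    | exact h2 _ hB
    | exact h1' _ hB
    | exact h2' _ hB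
    | exact hi hB
    | exact hi' hB

lemma period_five (h3 : ∀ v, σ (σ (σ v)) ≠ v) {i : W}
    (hn : Odd (Function.minimalPeriod σ i)) : 5 ≤ Function.minimalPeriod σ i := by
  by_contra hlt
  have hp := period_pos σ i
  have : Function.minimalPeriod σ i = 1 ∨ Function.minimalPeriod σ i = 3 := by
    obtain ⟨k, hk⟩ := hn; omega
  have hit := Function.iterate_minimalPeriod (f := σ) (x := i)
  rcases this with h | h <;> rw [h] at hit
  · simp only [Function.iterate_one] at hit
    exact h3 i (by rw [hit, hit, hit])
  · exact h3 i hit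

lemma iter_ne {i : W} (k : ℕ) (hk : 0 < k) (hk' : ¬ Function.minimalPeriod σ i ∣ k) :
    σ^[k] i ≠ i := fun h => hk' (Function.IsPeriodicPt.minimalPeriod_dvd h)

lemma six_ne (h3 : ∀ v, σ (σ (σ v)) ≠ v) {i : W}
    (hn : Odd (Function.minimalPeriod σ i)) : σ (σ (σ (σ (σ (σ i))))) ≠ i := by
  refine iter_ne σ 6 (by norm_num) ?_
  have h5 := period_five σ h3 hn
  intro hd
  have := Nat.le_of_dvd (by norm_num) hd
  obtain ⟨k, hk⟩ := hn
  have : Function.minimalPeriod σ i = 5 := by omega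
  rw [this] at hd; omega

lemma valid_exists (hm : ∀ v, m (m v) = v) (h3 : ∀ v, σ (σ (σ v)) ≠ v) : ∃ D, Valid σ m D := by
  classical
  let S : Setoid W := Equiv.Perm.SameCycle.setoid σ
  let r : W → W := fun v => (Quotient.mk S v).out
  have hr : ∀ v, σ.SameCycle v (r v) := fun v =>
    Equiv.Perm.SameCycle.symm (Quotient.mk_out (s := S) v)
  have hrs : ∀ v w, σ.SameCycle v w → r v = r w := by
    intro v w h
    have : Quotient.mk S v = Quotient.mk S w := Quotient.sound h
    simp only [r, this]
  let q : W → W := fun v => if m (r v) = σ (σ (σ (r v))) then σ (σ (σ (r v))) else r v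
  refine ⟨fun v => if Odd (Function.minimalPeriod σ v) then pat σ (q v) v else 0, ?_, ?_⟩
  · intro v hv; simp [hv]
  · intro v hv
    refine ⟨q v, ?_, ?_, 1, Or.inl rfl, ?_⟩
    · simp only [q]; split_ifs
      · simpa only [Equiv.Perm.sameCycle_apply_right] using hr v
      · exact hr v
    · simp only [q]; split_ifs with h
      · intro h'
        rw [← h, hm, h] at h'
        refine six_ne σ h3 (i := r v) ?_ h'.symm
        rw [period_same σ (hr v)]; exact hv
      · exact h
    · intro w hw
      have hq : q w = q v := by simp only [q, hrs v w hw]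
      have : Odd (Function.minimalPeriod σ w) := by rw [period_same σ hw]; exact hv
      simp [this, hq]

lemma cost_split (hm : ∀ v, m (m v) = v) (C : W → Prop) [DecidablePred C] (D : W → ℤ)
    (hno : ∀ v, C v → C (m v) → D v * D (m v) ≠ -1) :
    cost m D = (Finset.univ.filter fun v => D v * D (m v) = -1 ∧ ¬ C v ∧ ¬ C (m v)).card +
      2 * (Finset.univ.filter fun v => D v * D (m v) = -1 ∧ C v).card := by
  have e1 : (Finset.univ.filter fun v => D v * D (m v) = -1 ∧ C (m v)).card =
      (Finset.univ.filter fun v => D v * D (m v) = -1 ∧ C v).card := by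
    refine Finset.card_bij (fun v _ => m v) ?_ ?_ ?_
    · intro v hv
      simp only [Finset.mem_filter, Finset.mem_univ, true_and] at hv ⊢
      rw [hm, mul_comm]; exact hv
    · intro a _ b _ h
      rw [← hm a, h, hm]
    · intro v hv
      refine ⟨m v, ?_, hm v⟩
      simp only [Finset.mem_filter, Finset.mem_univ, true_and] at hv ⊢
      rw [hm, mul_comm]; exact hv
  have e2 : (Finset.univ.filter fun v => D v * D (m v) = -1) =
      (Finset.univ.filter fun v => D v * D (m v) = -1 ∧ ¬ C v ∧ ¬ C (m v)) ∪
      ((Finset.univ.filter fun v => D v * D (m v) = -1 ∧ C v) ∪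
      (Finset.univ.filter fun v => D v * D (m v) = -1 ∧ C (m v))) := by
    ext v; simp only [Finset.mem_filter, Finset.mem_univ, true_and, Finset.mem_union]; tauto
  unfold cost
  rw [e2, Finset.card_union_of_disjoint, Finset.card_union_of_disjoint, e1]
  · ring
  · rw [Finset.disjoint_left]; intro v
    simp only [Finset.mem_filter, Finset.mem_univ, true_and]
    rintro ⟨h, hc⟩ ⟨_, hc'⟩
    exact hno v hc hc' h
  · rw [Finset.disjoint_left]; intro v
    simp only [Finset.mem_filter, Finset.mem_univ, true_and, Finset.mem_union]
    tauto

/-- minimality inequality -/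
lemma min_ineq (hm : ∀ v, m (m v) = v) (h1 : ∀ v, m v ≠ σ v) (h2 : ∀ v, m v ≠ σ (σ v))
    (hf : ∀ v, m v ≠ v) (D : W → ℤ) (hD : Valid σ m D)
    (hmin : ∀ D', Valid σ m D' → cost m D ≤ cost m D')
    (C : W → Prop) [DecidablePred C] (j : W) (hC : ∀ v, C v ↔ σ.SameCycle j v)
    (hn : Odd (Function.minimalPeriod σ j)) (hj : m j ≠ σ (σ (σ j)))
    (t : ℤ) (ht : t = 1 ∨ t = -1) (y : W → ℤ) (hy : ∀ v, y v = if C (m v) then 0 else D (m v)) :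
    (Finset.univ.filter fun v => D v * D (m v) = -1 ∧ C v).card ≤
      (if t * y j = -1 then 1 else 0) + (if t * y (σ j) = -1 then 1 else 0) +
      (if t * y (σ (σ j)) = 1 then 1 else 0) + (if t * y (σ (σ (σ j))) = 1 then 1 else 0) := by
  have hnoD : ∀ v, C v → C (m v) → D v * D (m v) ≠ -1 := by
    intro v hv hv' h
    have hv1 := (hC v).1 hv
    have : Odd (Function.minimalPeriod σ v) := by rw [period_same σ hv1]; exact hn
    obtain ⟨i, hi, hi2, s, hs, hw⟩ := hD.2 v this
    rw [hw v (Equiv.Perm.SameCycle.refl _ _), hw (m v) (hv1.symm.trans ((hC _).1 hv'))] at h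
    by_cases h0 : pat σ i v = 0
    · simp [h0] at h
    · simp [pat_chord σ m hm h1 h2 hf hi2 h0] at h
  let D' : W → ℤ := fun v => if C v then t * pat σ j v else D v
  have hD' : Valid σ m D' := by
    constructor
    · intro v hv
      have : ¬ C v := fun h => hv (by rw [period_same σ ((hC v).1 h)]; exact hn)
      simp only [D', if_neg this]
      exact hD.1 v hv
    · intro v hv
      by_cases hc : C v
      · refine ⟨j, ((hC v).1 hc).symm, hj, t, ht, ?_⟩
        intro w hw
        have : C w := (hC w).2 (((hC v).1 hc).trans hw)
        simp only [D', if_pos this]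
      · obtain ⟨i, hi, hi2, s, hs, hw⟩ := hD.2 v hv
        refine ⟨i, hi, hi2, s, hs, ?_⟩
        intro w hvw
        have : ¬ C w := fun h => hc ((hC v).2 (((hC w).1 h).trans hvw.symm))
        simp only [D', if_neg this]
        exact hw w hvw
  have hnoD' : ∀ v, C v → C (m v) → D' v * D' (m v) ≠ -1 := by
    intro v hv hv' h
    simp only [D', if_pos hv, if_pos hv'] at h
    by_cases h0 : pat σ j v = 0
    · simp [h0] at h
    · simp [pat_chord σ m hm h1 h2 hf hj h0] at h
  have hle := hmin D' hD'
  rw [cost_split m hm C D hnoD, cost_split m hm C D' hnoD'] at hle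
  have hR : (Finset.univ.filter fun v => D' v * D' (m v) = -1 ∧ ¬ C v ∧ ¬ C (m v)) =
      (Finset.univ.filter fun v => D v * D (m v) = -1 ∧ ¬ C v ∧ ¬ C (m v)) := by
    ext v
    simp only [Finset.mem_filter, Finset.mem_univ, true_and]
    constructor
    · rintro ⟨h, ha, hb⟩; simp only [D', if_neg ha, if_neg hb] at h; exact ⟨h, ha, hb⟩
    · rintro ⟨h, ha, hb⟩; simp only [D', if_neg ha, if_neg hb]; exact ⟨h, ha, hb⟩
  rw [hR] at hle
  have hle2 : (Finset.univ.filter fun v => D v * D (m v) = -1 ∧ C v).card ≤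
    (Finset.univ.filter fun v => D' v * D' (m v) = -1 ∧ C v).card := by omega
  refine hle2.trans ?_
  have hsub : (Finset.univ.filter fun v => D' v * D' (m v) = -1 ∧ C v) ⊆
      ((((if t * y j = -1 then {j} else ∅) ∪ (if t * y (σ j) = -1 then {σ j} else ∅)) ∪
      (if t * y (σ (σ j)) = 1 then {σ (σ j)} else ∅)) ∪
      (if t * y (σ (σ (σ j))) = 1 then {σ (σ (σ j))} else ∅) : Finset W) := by
    intro v hv
    simp only [Finset.mem_filter, Finset.mem_univ, true_and] at hv
    obtain ⟨hv, hc⟩ := hv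
    have hc' : ¬ C (m v) := fun h => hnoD' v hc h hv
    have hyv : y v = D (m v) := by rw [hy, if_neg hc']
    simp only [D', if_pos hc, if_neg hc', ← hyv] at hv
    have hp : pat σ j v ≠ 0 := by intro h; simp [h] at hv
    have hwin := pat_ne_zero σ hp
    unfold pat at hv hp
    simp only [Finset.mem_union]
    by_cases ha : v = j
    · left; left; left
      subst ha; rw [if_pos (by simp)] at hv
      rw [if_pos (by linarith)]; simp
    by_cases hb : v = σ j
    · left; left; right
      subst hb; rw [if_pos (by simp)] at hv
      rw [if_pos (by linarith)]; simp
    rw [if_neg (by tauto), if_pos (by tauto)] at hv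
    by_cases hcc : v = σ (σ j)
    · left; right
      subst hcc
      rw [if_pos (by linarith)]; simp
    · right
      have hd : v = σ (σ (σ j)) := by tauto
      subst hd
      rw [if_pos (by linarith)]; simp
  refine (Finset.card_le_card hsub).trans ?_
  refine (Finset.card_union_le _ _).trans (Nat.add_le_add ((Finset.card_union_le _ _).trans
    (Nat.add_le_add ((Finset.card_union_le _ _).trans (Nat.add_le_add ?_ ?_)) ?_)) ?_) <;>
  split_ifs <;> simp

end opt

section core
variable {W : Type*} [Fintype W] [DecidableEq W] (σ : Equiv.Perm W) (m : W → W)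

lemma pat_eval (h3 : ∀ v, σ (σ (σ v)) ≠ v) {i : W} (hn : Odd (Function.minimalPeriod σ i)) :
    pat σ i i = 1 ∧ pat σ i (σ i) = 1 ∧ pat σ i (σ (σ i)) = -1 ∧
      pat σ i (σ (σ (σ i))) = -1 := by
  have h5 := period_five σ h3 hn
  have n1 : σ i ≠ i := iter_ne σ 1 (by norm_num) (fun h => by have := Nat.le_of_dvd (by norm_num) h; omega)
  have n2 : σ (σ i) ≠ i := iter_ne σ 2 (by norm_num) (fun h => by have := Nat.le_of_dvd (by norm_num) h; omega)
  have n3 := h3 i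
  unfold pat
  simp [n1, n2, n3]

lemma half_ok (hm : ∀ v, m (m v) = v) (h1 : ∀ v, m v ≠ σ v) (h2 : ∀ v, m v ≠ σ (σ v))
    (hf : ∀ v, m v ≠ v) (h3 : ∀ v, σ (σ (σ v)) ≠ v) (D : W → ℤ) (hD : Valid σ m D)
    (hmin : ∀ D', Valid σ m D' → cost m D ≤ cost m D')
    (i : W) (hn : Odd (Function.minimalPeriod σ i))
    (s : ℤ) (hs : s = 1 ∨ s = -1) (hw : ∀ w, σ.SameCycle i w → D w = s * pat σ i w) :
    (D i * D (m i) ≠ -1 ∧ D (σ i) * D (m (σ i)) ≠ -1) ∨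
    (D (σ (σ i)) * D (m (σ (σ i))) ≠ -1 ∧ D (σ (σ (σ i))) * D (m (σ (σ (σ i)))) ≠ -1) := by
  classical
  by_contra hcon
  have h5 := period_five σ h3 hn
  obtain ⟨p0, p1, p2, p3⟩ := pat_eval σ h3 hn
  let C : W → Prop := fun v => σ.SameCycle i v
  have hCσ : ∀ v, C (σ v) ↔ C v := fun v => Equiv.Perm.sameCycle_apply_right
  have hCi : C i := Equiv.Perm.SameCycle.refl _ _
  let y : W → ℤ := fun v => if C (m v) then 0 else D (m v)
  have hyv : ∀ v, y v = -1 ∨ y v = 0 ∨ y v = 1 := by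
    intro v
    simp only [y]; split_ifs
    · simp
    · exact valid_vals σ m hD _
  have hodd : ∀ j, C j → Odd (Function.minimalPeriod σ j) := fun j hj => by
    rw [period_same σ hj]; exact hn
  -- two mismatched vertices
  have hcard : 2 ≤ (Finset.univ.filter fun v => D v * D (m v) = -1 ∧ C v).card := by
    have d1 : σ i ≠ i := iter_ne σ 1 (by norm_num)
      (fun h => by have := Nat.le_of_dvd (by norm_num) h; omega)
    have d2 : σ (σ i) ≠ i := iter_ne σ 2 (by norm_num)
      (fun h => by have := Nat.le_of_dvd (by norm_num) h; omega)
    have d3 := h3 i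
    have c1 : C (σ i) := (hCσ _).2 hCi
    have c2 : C (σ (σ i)) := (hCσ _).2 c1
    have c3 : C (σ (σ (σ i))) := (hCσ _).2 c2
    have : ∃ a b, a ≠ b ∧ (D a * D (m a) = -1 ∧ C a) ∧ (D b * D (m b) = -1 ∧ C b) := by
      by_cases a0 : D i * D (m i) = -1 <;>
      by_cases b0 : D (σ (σ i)) * D (m (σ (σ i))) = -1
      · exact ⟨i, σ (σ i), d2.symm, ⟨a0, hCi⟩, b0, c2⟩
      · exact ⟨i, σ (σ (σ i)), d3.symm, ⟨a0, hCi⟩, by tauto, c3⟩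
      · refine ⟨σ i, σ (σ i), ?_, ⟨by tauto, c1⟩, b0, c2⟩
        intro h; exact d1 (σ.injective h).symm
      · refine ⟨σ i, σ (σ (σ i)), ?_, ⟨by tauto, c1⟩, by tauto, c3⟩
        intro h; exact d2 (σ.injective h).symm
    obtain ⟨a, b, hab, ha, hb⟩ := this
    have : ({a, b} : Finset W) ⊆ Finset.univ.filter fun v => D v * D (m v) = -1 ∧ C v := by
      intro x hx
      simp only [Finset.mem_insert, Finset.mem_singleton] at hx
      simp only [Finset.mem_filter, Finset.mem_univ, true_and]
      rcases hx with rfl | rfl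
      · exact ha
      · exact hb
    have := Finset.card_le_card this
    rwa [Finset.card_pair hab] at this
  have key : ∀ j, C j → m j ≠ σ (σ (σ j)) → ∀ t : ℤ, (t = 1 ∨ t = -1) →
      2 ≤ (if t * y j = -1 then 1 else 0) + (if t * y (σ j) = -1 then 1 else 0) +
      (if t * y (σ (σ j)) = 1 then 1 else 0) + (if t * y (σ (σ (σ j))) = 1 then 1 else 0) := by
    intro j hj hjm t ht
    refine hcard.trans ?_
    refine min_ineq σ m hm h1 h2 hf D hD hmin C j ?_ (hodd j hj) hjm t ht y (fun v => rfl)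
    intro v
    exact ⟨fun h => hj.symm.trans h, fun h => hj.trans h⟩
  -- no vertex of the cycle is free
  have hnz : ∀ a, C a → y a ≠ 0 := by
    intro a ha h0
    by_cases hma : m a = σ (σ (σ a))
    · -- use the window ending at `a`
      let j := σ.symm (σ.symm (σ.symm a))
      have hja : σ (σ (σ j)) = a := by simp [j]
      have hjC : C j := by
        have : C (σ (σ (σ j))) := by rw [hja]; exact ha
        simpa only [hCσ] using this
      have hmj : m j ≠ σ (σ (σ j)) := by
        intro h
        rw [hja] at h
        have : m a = j := by rw [← h, hm]
        apply six_ne σ h3 (hodd j hjC)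
        rw [hja, ← hma, this]
      have k1 := key j hjC hmj 1 (Or.inl rfl)
      have k2 := key j hjC hmj (-1) (Or.inr rfl)
      rw [hja, h0] at k1 k2
      rcases hyv j with e0 | e0 | e0 <;> rcases hyv (σ j) with e1 | e1 | e1 <;>
        rcases hyv (σ (σ j)) with e2 | e2 | e2 <;> simp [e0, e1, e2] at k1 k2
    · have k1 := key a ha hma 1 (Or.inl rfl)
      have k2 := key a ha hma (-1) (Or.inr rfl)
      rw [h0] at k1 k2
      rcases hyv (σ (σ (σ a))) with e0 | e0 | e0 <;> rcases hyv (σ a) with e1 | e1 | e1 <;>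
        rcases hyv (σ (σ a)) with e2 | e2 | e2 <;> simp [e0, e1, e2] at k1 k2
  have hadm : ∀ a, C a → m a ≠ σ (σ (σ a)) := by
    intro a ha h
    apply hnz a ha
    have : C (m a) := by rw [h, hCσ, hCσ, hCσ]; exact ha
    simp only [y, if_pos this]
  have hpm : ∀ a, C a → y a = -1 ∨ y a = 1 := by
    intro a ha
    have := hyv a
    have := hnz a ha
    tauto
  have hstep : ∀ a, C a → y (σ a) = y a → y (σ (σ a)) = y (σ a) := by
    intro a ha hE
    by_contra hne
    have k := key a ha (hadm a ha) (y a) (hpm a ha).symm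
    have c1 : C (σ a) := (hCσ _).2 ha
    have c2 : C (σ (σ a)) := (hCσ _).2 c1
    rw [hE] at k hne
    rcases hpm a ha with e0 | e0 <;> rcases hpm _ c2 with e2 | e2 <;>
      rcases hyv (σ (σ (σ a))) with e3 | e3 | e3 <;> simp [e0, e2, e3] at k hne
  have hyD : ∀ v, C v → y v = D (m v) := by
    intro v hv
    have := hnz v hv
    simp only [y] at this ⊢
    split_ifs at this ⊢
    · simp at this
    · rfl
  by_cases hex : ∃ a, C a ∧ y (σ a) = y a
  · obtain ⟨a, ha, hE⟩ := hex
    have hall : ∀ k : ℕ, C (σ^[k] a) ∧ y (σ (σ^[k] a)) = y (σ^[k] a) ∧ y (σ^[k] a) = y a := by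
      intro k
      induction k with
      | zero => exact ⟨ha, hE, rfl⟩
      | succ k ih =>
        rw [Function.iterate_succ_apply']
        exact ⟨(hCσ _).2 ih.1, hstep _ ih.1 ih.2.1, ih.2.1.trans ih.2.2⟩
    have hconst : ∀ v, C v → y v = y a := by
      intro v hv
      obtain ⟨k, -, rfl⟩ := exists_index σ (ha.symm.trans hv)
      exact (hall k).2.2
    have c1 : C (σ i) := (hCσ _).2 hCi
    have c2 : C (σ (σ i)) := (hCσ _).2 c1
    have c3 : C (σ (σ (σ i))) := (hCσ _).2 c2
    apply hcon
    rw [← hyD _ hCi, ← hyD _ c1, ← hyD _ c2, ← hyD _ c3, hconst _ hCi, hconst _ c1, hconst _ c2,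
      hconst _ c3, hw _ hCi, hw _ c1, hw _ c2, hw _ c3, p0, p1, p2, p3]
    rcases hs with rfl | rfl <;> rcases hpm a ha with e | e <;> rw [e] <;> norm_num
  · push Not at hex
    have halt : ∀ k : ℕ, C (σ^[k] i) ∧ y (σ^[k] i) = (-1) ^ k * y i := by
      intro k
      induction k with
      | zero => exact ⟨hCi, by simp⟩
      | succ k ih =>
        rw [Function.iterate_succ_apply']
        have hc : C (σ (σ^[k] i)) := (hCσ _).2 ih.1
        refine ⟨hc, ?_⟩
        rw [pow_succ, mul_right_comm, ← ih.2]
        have q1 := hex _ ih.1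
        have q2 := hpm _ ih.1
        have q3 := hpm _ hc
        clear_value y
        omega
    have := (halt (Function.minimalPeriod σ i)).2
    rw [Function.iterate_minimalPeriod, hn.neg_one_pow] at this
    have := hnz i hCi
    omega

theorem core (hm : ∀ v, m (m v) = v) (h1 : ∀ v, m v ≠ σ v) (h2 : ∀ v, m v ≠ σ (σ v))
    (hf : ∀ v, m v ≠ v) (h3 : ∀ v, σ (σ (σ v)) ≠ v) :
    ∃ c e : W → ℕ, (∀ v, c v < 11 ∧ e v < 11) ∧ (∀ v, c (m v) = c v) ∧
      ∀ v, Far (e v) (e (σ v)) ∧ Far (c (σ v)) (e v) ∧ Far (c (σ v)) (e (σ v)) := by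
  classical
  obtain ⟨D0, hD0⟩ := valid_exists σ m hm h3
  obtain ⟨D, hD, hmin⟩ : ∃ D, Valid σ m D ∧ ∀ D', Valid σ m D' → cost m D ≤ cost m D' := by
    have hne : {D | Valid σ m D}.Nonempty := ⟨D0, hD0⟩
    refine ⟨Function.argminOn (cost m) _ hne, Function.argminOn_mem (cost m) _ hne, ?_⟩
    intro D' hD'
    exact Function.argminOn_le (cost m) _ hD'
  let c : W → ℤ := fun v => Int.sign (D v + D (m v))
  have hc : ∀ v, c v = -1 ∨ c v = 0 ∨ c v = 1 := by
    intro v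
    rcases Int.sign_trichotomy (D v + D (m v)) with h | h | h <;> simp only [c, h] <;> simp
  obtain ⟨e, he⟩ := glue σ c (by
    intro v
    by_cases hn : Odd (Function.minimalPeriod σ v)
    · obtain ⟨i, hi, hi2, s, hs, hw⟩ := hD.2 v hn
      have hni : Odd (Function.minimalPeriod σ i) := by rw [period_same σ hi]; exact hn
      refine ⟨i, hi.symm, ?_⟩
      have hw' : ∀ w, σ.SameCycle i w → D w = s * pat σ i w := fun w h => hw w (hi.trans h)
      obtain ⟨p0, p1, p2, p3⟩ := pat_eval σ h3 hni
      have e0 : D i = s := by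
        rw [hw' i (Equiv.Perm.SameCycle.refl _ _), p0, mul_one]
      have e1 : D (σ i) = s := by
        rw [hw' (σ i) (same_iterate σ i 1), p1, mul_one]
      have e2 : D (σ (σ i)) = -s := by
        rw [hw' (σ (σ i)) (same_iterate σ i 2), p2]; ring
      have e3 : D (σ (σ (σ i))) = -s := by
        rw [hw' (σ (σ (σ i))) (same_iterate σ i 3), p3]; ring
      have hsame : ∀ a b : ℤ, (b = -1 ∨ b = 0 ∨ b = 1) → (a = 1 ∨ a = -1) → a * b ≠ -1 →
          Int.sign (a + b) = a := by
        rintro a b (rfl | rfl | rfl) (rfl | rfl) <;> decide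
      have hdiff : ∀ a b : ℤ, (b = -1 ∨ b = 0 ∨ b = 1) → (a = 1 ∨ a = -1) →
          Int.sign (a + b) ≠ -a := by
        rintro a b (rfl | rfl | rfl) (rfl | rfl) <;> decide
      have hs' : -s = 1 ∨ -s = -1 := by omega
      have hv := fun x => valid_vals σ m hD x
      rcases half_ok σ m hm h1 h2 hf h3 D hD hmin i hni s hs hw' with ⟨a, b⟩ | ⟨a, b⟩
      · rw [e0] at a
        rw [e1] at b
        refine cyc_odd σ c hc i hni (period_five σ h3 hni) s hs (Or.inl ⟨?_, ?_, ?_, ?_⟩)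
        · simp only [c, e0]; exact hsame _ _ (hv _) hs a
        · simp only [c, e1]; exact hsame _ _ (hv _) hs b
        · simp only [c, e2]; simpa using hdiff _ _ (hv _) hs'
        · simp only [c, e3]; simpa using hdiff _ _ (hv _) hs'
      · rw [e2] at a
        rw [e3] at b
        refine cyc_odd σ c hc i hni (period_five σ h3 hni) (-s) hs' (Or.inr ⟨?_, ?_, ?_, ?_⟩)
        · simp only [c, e0]; exact hdiff _ _ (hv _) hs
        · simp only [c, e1]; exact hdiff _ _ (hv _) hs
        · simp only [c, e2]; exact hsame _ _ (hv _) hs' a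
        · simp only [c, e3]; exact hsame _ _ (hv _) hs' b
    · exact ⟨v, Equiv.Perm.SameCycle.refl _ _, cyc_even σ c hc v hn⟩)
  refine ⟨fun v => emb (c v), e, fun v => ⟨?_, (he v).1⟩, fun v => ?_, fun v => (he v).2⟩
  · simp only [emb]; split_ifs <;> norm_num
  · simp only [c, hm, add_comm]

end core

section orient
variable {W : Type*} [Finite W]

lemma orient (F : SimpleGraph W)
    (h2 : ∀ v, ∃ a b, a ≠ b ∧ ∀ w, F.Adj v w ↔ w = a ∨ w = b) :
    ∃ σ : Equiv.Perm W, ∀ v w, F.Adj v w ↔ (w = σ v ∨ v = σ w) := by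
  classical
  have hnb : ∀ d : F.Dart, ∃ w : F.Dart, w.fst = d.snd ∧ w.snd ≠ d.fst ∧
      ∀ x, F.Adj d.snd x → x = d.fst ∨ x = w.snd := by
    intro d
    obtain ⟨a, b, hab, h⟩ := h2 d.snd
    have := (h d.fst).1 d.adj.symm
    rcases this with e | e
    · refine ⟨⟨(d.snd, b), (h b).2 (Or.inr rfl)⟩, rfl, ?_, ?_⟩
      · simp only [e]; exact hab.symm
      · intro x hx; rw [e]; exact (h x).1 hx
    · refine ⟨⟨(d.snd, a), (h a).2 (Or.inl rfl)⟩, rfl, ?_, ?_⟩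
      · simp only [e]; exact hab
      · intro x hx; rw [e]; exact ((h x).1 hx).symm
  choose t ht1 ht2 ht3 using hnb
  have ext : ∀ x y : F.Dart, x.fst = y.fst → x.snd = y.snd → x = y := by
    intro x y h1 h2
    exact SimpleGraph.Dart.ext _ _ (Prod.ext h1 h2)
  have : Finite F.Dart := Finite.of_injective (fun d : F.Dart => (d.fst, d.snd)) (by
    intro x y h
    exact ext x y (congrArg Prod.fst h) (congrArg Prod.snd h))
  have hrev : ∀ d, (t (t d).symm).symm = d := by
    intro d
    apply ext
    · have h := ht3 (t d).symm d.fst (by simpa [ht1] using d.adj.symm)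
      rcases h with h | h
      · exact absurd h.symm (ht2 d)
      · exact h.symm
    · change (t (t d).symm).fst = d.snd
      rw [ht1]; exact ht1 d
  have hrev' : ∀ d, t (t d).symm = d.symm := by
    intro d
    have := congrArg SimpleGraph.Dart.symm (hrev d)
    simpa using this
  let τ : Equiv.Perm F.Dart :=
    { toFun := t
      invFun := fun d => (t d.symm).symm
      left_inv := hrev
      right_inv := by
        intro d
        have := hrev d.symm
        have h2 := congrArg SimpleGraph.Dart.symm this
        simpa using h2 }
  have hτ : ∀ d, τ d = t d := fun d => rfl
  have hs1 : ∀ d, (τ d).symm = τ⁻¹ d.symm := by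
    intro d
    rw [Equiv.Perm.eq_inv_iff_eq]
    exact hrev' d
  have hs1' : ∀ d, (τ⁻¹ d).symm = τ d.symm := by
    intro d
    have := hs1 (τ⁻¹ d)
    rw [Equiv.Perm.eq_inv_iff_eq] at this
    simpa using this.symm
  have hsn : ∀ (k : ℕ) d, ((τ ^ k) d).symm = (τ⁻¹ ^ k) d.symm := by
    intro k
    induction k with
    | zero => intro d; rfl
    | succ k ih =>
      intro d
      rw [pow_succ', Equiv.Perm.mul_apply, hs1, ih, pow_succ', Equiv.Perm.mul_apply]
  have hinv : ∀ (p : Equiv.Perm F.Dart) z, p⁻¹ (p z) = z := fun p z => p.symm_apply_apply z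
  have hno : ∀ d, ¬ τ.SameCycle d d.symm := by
    intro d hd
    obtain ⟨k, -, hk⟩ := hd.exists_pow_eq'
    rcases Nat.even_or_odd' k with ⟨j, rfl | rfl⟩
    · have h := hsn j d
      rw [← hk, two_mul, pow_add, inv_pow, Equiv.Perm.mul_apply, hinv] at h
      exact SimpleGraph.Dart.symm_ne _ h
    · have h := hsn j d
      rw [← hk, two_mul, add_assoc, pow_add, inv_pow, Equiv.Perm.mul_apply,
        hinv, pow_succ', Equiv.Perm.mul_apply] at h
      set x := (τ ^ j) d
      apply ht2 x
      rw [← hτ, ← h]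
      rfl
  let Q := Quotient (Equiv.Perm.SameCycle.setoid τ)
  have : Finite Q := inferInstance
  obtain ⟨n, ⟨f⟩⟩ := Finite.exists_equiv_fin Q
  let r : F.Dart → Fin n := fun d => f (Quotient.mk _ d)
  have hr : ∀ x y, r x = r y ↔ τ.SameCycle x y := by
    intro x y
    simp only [r, f.injective.eq_iff]
    exact Quotient.eq (r := Equiv.Perm.SameCycle.setoid τ)
  let P : F.Dart → Prop := fun d => r d < r d.symm
  have hP1 : ∀ d, P d.symm ↔ ¬ P d := by
    intro d
    have hne : r d ≠ r d.symm := fun h => hno d ((hr _ _).1 h)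
    simp only [P, SimpleGraph.Dart.symm_symm, not_lt]
    exact ⟨le_of_lt, fun h => lt_of_le_of_ne h hne.symm⟩
  have hP2 : ∀ d, P (τ d) ↔ P d := by
    intro d
    have e1 : r (τ d) = r d := (hr _ _).2 (by simp only [Equiv.Perm.sameCycle_apply_left]; exact .refl _ _)
    have e2 : r (τ d).symm = r d.symm := (hr _ _).2 (by rw [hs1]; exact ⟨1, by simp⟩)
    simp only [P, e1, e2]
  have hP3 : ∀ x y : F.Dart, x.fst = y.fst → x ≠ y → (P x ↔ ¬ P y) := by
    intro x y h hxy
    have : τ x.symm = y := by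
      apply ext
      · rw [hτ, ht1]; exact h
      · have := ht3 x.symm y.snd (by change F.Adj x.fst y.snd; rw [h]; exact y.adj)
        rcases this with e | e
        · exact absurd (ext x y h e.symm) hxy
        · exact e.symm
    rw [← this, hP2, hP1, not_not]
  have hex : ∀ v, ∃ d : F.Dart, d.fst = v ∧ P d := by
    intro v
    obtain ⟨a, b, hab, h⟩ := h2 v
    let x : F.Dart := ⟨(v, a), (h a).2 (Or.inl rfl)⟩
    let y : F.Dart := ⟨(v, b), (h b).2 (Or.inr rfl)⟩
    by_cases hx : P x
    · exact ⟨x, rfl, hx⟩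
    · refine ⟨y, rfl, ?_⟩
      have := hP3 y x rfl (by
        intro e; exact hab (congrArg (fun d : F.Dart => d.snd) e).symm)
      exact this.2 hx
  choose s hs hsP using hex
  have huniq : ∀ d, P d → s d.fst = d := by
    intro d hd
    by_contra hne
    exact (hP3 _ _ (hs d.fst) hne).1 (hsP _) hd
  have hinj : Function.Injective fun v => (s v).snd := by
    intro u v huv
    by_contra hne
    have := (hP3 (s u).symm (s v).symm huv (by
      intro e
      have := congrArg (fun d : F.Dart => d.snd) e
      change (s u).fst = (s v).fst at this
      rw [hs, hs] at this
      exact hne this))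
    rw [hP1, hP1] at this
    have a := hsP u
    have b := hsP v
    tauto
  refine ⟨Equiv.ofBijective _ (Finite.injective_iff_bijective.1 hinj), ?_⟩
  intro v w
  simp only [Equiv.ofBijective_apply]
  constructor
  · intro h
    let d : F.Dart := ⟨(v, w), h⟩
    by_cases hd : P d
    · left
      have := huniq d hd
      change s v = d at this
      rw [this]
    · right
      have := huniq d.symm ((hP1 d).2 hd)
      change s w = d.symm at this
      rw [this]
      rfl
  · rintro (h | h)
    · have := (s v).adj
      rw [h]
      nth_rewrite 1 [← hs v]
      exact this
    · have := (s w).adj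
      rw [h]
      nth_rewrite 2 [← hs w]
      exact this.symm

lemma orient' (F : SimpleGraph W)
    (h2 : ∀ v, ∃ a b, a ≠ b ∧ ∀ w, F.Adj v w ↔ w = a ∨ w = b) :
    ∃ σ : Equiv.Perm W, (∀ v w, F.Adj v w ↔ (w = σ v ∨ v = σ w)) ∧ ∀ v, σ (σ v) ≠ v := by
  obtain ⟨σ, hσ⟩ := orient F h2
  refine ⟨σ, hσ, fun v hv => ?_⟩
  have key : ∀ w, F.Adj v w → w = σ v := by
    intro w hw
    rcases (hσ v w).1 hw with h | h
    · exact h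
    · apply σ.injective
      rw [hv]; exact h.symm
  obtain ⟨a, b, hab, h⟩ := h2 v
  exact hab ((key a ((h a).2 (Or.inl rfl))).trans (key b ((h b).2 (Or.inr rfl))).symm)

end orient

section graph
variable {V : Type*} [Fintype V] [DecidableEq V] (G : SimpleGraph V) [DecidableRel G.Adj]

lemma cut_bridge (X : Set V) {u v : V} (hu : u ∈ X) (hv : v ∉ X)
    (h : ∀ a b, a ∈ X → b ∉ X → G.Adj a b → a = u ∧ b = v) : G.IsBridge s(u, v) := by
  rw [SimpleGraph.isBridge_iff]
  rintro ⟨p⟩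
  obtain ⟨d, -, h1, h2⟩ := p.exists_boundary_dart X hu hv
  have hd := d.adj
  rw [SimpleGraph.deleteEdges_adj] at hd
  obtain ⟨e1, e2⟩ := h _ _ h1 h2 hd.1
  apply hd.2
  rw [e1, e2]; rfl

lemma closed_univ (hc : G.Connected) (X : Set V) {u : V} (hu : u ∈ X)
    (h : ∀ a b, a ∈ X → G.Adj a b → b ∈ X) (v : V) : v ∈ X := by
  by_contra hv
  obtain ⟨p⟩ := hc.preconnected u v
  obtain ⟨d, -, h1, h2⟩ := p.exists_boundary_dart X hu hv
  exact h2 (h _ _ h1 d.adj)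

lemma two_le_degree (h : TwoEdgeConnected G) (v : V) : 2 ≤ G.degree v := by
  obtain ⟨hc, hcard, hb⟩ := h
  have : Nontrivial V := Fintype.one_lt_card_iff_nontrivial.1 hcard
  have h0 := hc.preconnected.degree_pos_of_nontrivial v
  by_contra hlt
  have h1 : G.degree v = 1 := by omega
  rw [← SimpleGraph.card_neighborFinset_eq_degree, Finset.card_eq_one] at h1
  obtain ⟨u, hu⟩ := h1
  have hu' : ∀ w, G.Adj v w ↔ w = u := by
    intro w
    rw [← SimpleGraph.mem_neighborFinset, hu, Finset.mem_singleton]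
  apply hb s(v, u)
  apply cut_bridge G {v} rfl
  · have := (hu' u).2 rfl
    exact this.ne'
  · rintro a b rfl - hab
    exact ⟨rfl, (hu' b).1 hab⟩

/-- two copies of `G`, the copies of vertices of degree two being joined -/
def dbl : SimpleGraph (V × Bool) where
  Adj x y := (x.2 = y.2 ∧ G.Adj x.1 y.1) ∨ (x.1 = y.1 ∧ x.2 ≠ y.2 ∧ G.degree x.1 = 2)
  symm := ⟨by
    rintro ⟨a, b⟩ ⟨a', b'⟩ (⟨h1, h2⟩ | ⟨h1, h2, h3⟩)
    · exact Or.inl ⟨h1.symm, h2.symm⟩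
    · refine Or.inr ⟨h1.symm, h2.symm, ?_⟩
      change a = a' at h1
      change G.degree a = 2 at h3
      rw [← h1]; exact h3⟩
  loopless := ⟨by
    rintro ⟨a, b⟩ (⟨h1, h2⟩ | ⟨h1, h2, h3⟩)
    · exact G.loopless.irrefl _ h2
    · exact h2 rfl⟩

lemma dbl_triangle (hG : ∀ x y z, G.Adj x y → G.Adj y z → ¬ G.Adj x z) (x y z : V × Bool)
    (h1 : (dbl G).Adj x y) (h2 : (dbl G).Adj y z) : ¬ (dbl G).Adj x z := by
  intro h3
  obtain ⟨a, b⟩ := x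
  obtain ⟨c, d⟩ := y
  obtain ⟨e, f⟩ := z
  simp only [dbl] at h1 h2 h3
  rcases h1 with ⟨p, q⟩ | ⟨p, q, -⟩ <;> rcases h2 with ⟨p', q'⟩ | ⟨p', q', -⟩ <;>
    rcases h3 with ⟨p'', q''⟩ | ⟨p'', q'', -⟩
  · exact hG _ _ _ q q' q''
  all_goals subst p; subst p'
  all_goals first
    | exact q'' rfl
    | (subst p''; first | exact q rfl | exact q' rfl | exact G.loopless.irrefl _ q |
        exact G.loopless.irrefl _ q' | exact q p' | skip)
    | exact q'' p'
    | skip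
  all_goals first
    | (simp_all; done)
    | (cases b <;> cases d <;> cases f <;> simp_all)

lemma dbl_nbrs (hd2 : ∀ v, 2 ≤ G.degree v) (hd3 : ∀ v, G.degree v ≤ 3) (x : V × Bool) :
    ∃ N : Finset (V × Bool), N.card = 3 ∧ ∀ y, y ∈ N ↔ (dbl G).Adj x y := by
  obtain ⟨v, b⟩ := x
  let N0 : Finset (V × Bool) := (G.neighborFinset v).map ⟨fun u => (u, b), fun u w h => by simpa using h⟩
  have hN0 : ∀ y, y ∈ N0 ↔ b = y.2 ∧ G.Adj v y.1 := by
    rintro ⟨u, c⟩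
    simp only [N0, Finset.mem_map, SimpleGraph.mem_neighborFinset]
    constructor
    · rintro ⟨a, h, e⟩; cases e; exact ⟨rfl, h⟩
    · rintro ⟨rfl, h⟩; exact ⟨u, h, rfl⟩
  have hc0 : N0.card = G.degree v := by simp [N0]
  by_cases h : G.degree v = 2
  · refine ⟨insert (v, !b) N0, ?_, ?_⟩
    · rw [Finset.card_insert_of_notMem, hc0, h]
      rw [hN0]; simp
    · rintro ⟨u, c⟩
      rw [Finset.mem_insert, hN0]
      simp only [dbl, h, Prod.mk.injEq, and_true]
      rw [or_comm, @eq_comm _ u v]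
      cases b <;> cases c <;> simp
  · refine ⟨N0, ?_, ?_⟩
    · have := hd2 v; have := hd3 v; omega
    · rintro ⟨u, c⟩
      rw [hN0]
      simp [dbl, h]

end graph

section count
open Classical in
/-- ordered pairs of adjacent vertices leaving `K` -/
noncomputable def outp {W : Type*} [Fintype W] (H : SimpleGraph W) (K : Finset W) :
    Finset (W × W) :=
  Finset.univ.filter fun p => p.1 ∈ K ∧ p.2 ∉ K ∧ H.Adj p.1 p.2

variable {W : Type*} [Fintype W] (H : SimpleGraph W)

lemma mem_outp (K : Finset W) (p : W × W) :
    p ∈ outp H K ↔ p.1 ∈ K ∧ p.2 ∉ K ∧ H.Adj p.1 p.2 := by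
  classical
  simp [outp]

open Classical in
lemma card_pairs (h3 : ∀ x, ∃ N : Finset W, N.card = 3 ∧ ∀ y, y ∈ N ↔ H.Adj x y)
    (K : Finset W) :
    (Finset.univ.filter fun p : W × W => p.1 ∈ K ∧ H.Adj p.1 p.2).card = 3 * K.card := by
  choose N hN hN' using h3
  have : (Finset.univ.filter fun p : W × W => p.1 ∈ K ∧ H.Adj p.1 p.2) =
      (K.sigma N).map ⟨fun p => (p.1, p.2), by
        rintro ⟨a, b⟩ ⟨c, d⟩ h; simp at h; obtain ⟨rfl, rfl⟩ := h; rfl⟩ := by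
    ext ⟨a, b⟩
    simp only [Finset.mem_filter, Finset.mem_univ, true_and, Finset.mem_map, Finset.mem_sigma]
    constructor
    · rintro ⟨h1, h2⟩; exact ⟨⟨a, b⟩, ⟨h1, (hN' _ _).2 h2⟩, rfl⟩
    · rintro ⟨⟨c, d⟩, ⟨h1, h2⟩, e⟩
      cases e
      exact ⟨h1, (hN' _ _).1 h2⟩
  rw [this, Finset.card_map, Finset.card_sigma, Finset.sum_congr rfl (fun x _ => hN x)]
  simp [mul_comm]

lemma out_odd (h3 : ∀ x, ∃ N : Finset W, N.card = 3 ∧ ∀ y, y ∈ N ↔ H.Adj x y)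
    (K : Finset W) (hK : Odd K.card) : Odd (outp H K).card := by
  classical
  have h := card_pairs H h3 K
  let I := Finset.univ.filter fun p : W × W => p.1 ∈ K ∧ p.2 ∈ K ∧ H.Adj p.1 p.2
  have hI : Even I.card := by
    have : ∑ p ∈ I, (1 : ZMod 2) = 0 := by
      refine Finset.sum_involution (fun p _ => p.swap) ?_ ?_ ?_ ?_
      · intros; decide
      · rintro ⟨a, b⟩ hab - e
        simp only [I, Finset.mem_filter] at hab
        have : b = a := congrArg Prod.fst e
        exact hab.2.2.2.ne this.symm
      · rintro ⟨a, b⟩ hab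
        simp only [I, Finset.mem_filter, Finset.mem_univ, true_and] at hab ⊢
        exact ⟨hab.2.1, hab.1, hab.2.2.symm⟩
      · intros; simp
    rw [Finset.sum_const, nsmul_eq_mul, mul_one] at this
    exact (ZMod.natCast_eq_zero_iff_even).1 this
  have hsum : (outp H K).card + I.card = 3 * K.card := by
    rw [← h, ← Finset.card_union_of_disjoint]
    · congr 1
      ext ⟨a, b⟩
      simp only [Finset.mem_union, mem_outp, I, Finset.mem_filter, Finset.mem_univ, true_and]
      tauto
    · rw [Finset.disjoint_left]
      rintro ⟨a, b⟩ h1 h2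
      rw [mem_outp] at h1
      simp only [I, Finset.mem_filter, Finset.mem_univ, true_and] at h2
      exact h1.2.1 h2.2.1
  rcases hI with ⟨a, ha⟩
  rcases hK with ⟨b, hb⟩
  rw [Nat.odd_iff]
  omega

/-- the counting part of the verification of the Tutte condition -/
lemma comp_count (h3 : ∀ x, ∃ N : Finset W, N.card = 3 ∧ ∀ y, y ∈ N ↔ H.Adj x y)
    {ι : Type*} (I : Finset ι) (K : ι → Finset W) (S : Finset W)
    (hdis : ∀ i ∈ I, ∀ j ∈ I, i ≠ j → Disjoint (K i) (K j))
    (hKS : ∀ i ∈ I, ∀ x ∈ K i, ∀ y, H.Adj x y → y ∈ K i ∨ y ∈ S)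
    (hodd : ∀ i ∈ I, Odd (K i).card)
    (hone : ∀ i ∈ I, ∀ j ∈ I, (outp H (K i)).card = 1 → (outp H (K j)).card = 1 → i = j) :
    I.card ≤ S.card := by
  classical
  have h1 : ∑ i ∈ I, (outp H (K i)).card ≤ 3 * S.card := by
    rw [← card_pairs H h3 S, ← Finset.card_biUnion]
    · refine Finset.card_le_card_of_injOn Prod.swap ?_ (Prod.swap_injective.injOn)
      rintro ⟨a, b⟩ hab
      simp only [Finset.coe_biUnion, Set.mem_iUnion, Finset.mem_coe, mem_outp] at hab
      obtain ⟨i, hi, ha, hb, hadj⟩ := hab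
      simp only [Finset.coe_filter, Finset.mem_univ, true_and, Set.mem_ofPred_eq, Prod.swap]
      refine ⟨?_, hadj.symm⟩
      rcases hKS i hi a ha b hadj with h | h
      · exact absurd h hb
      · exact h
    · intro i hi j hj hij
      change Disjoint (outp H (K i)) (outp H (K j))
      rw [Finset.disjoint_left]
      rintro ⟨a, b⟩ h1 h2
      rw [mem_outp] at h1 h2
      exact Finset.disjoint_left.1 (hdis i hi j hj hij) h1.1 h2.1
  have h2 : (I.filter fun i => (outp H (K i)).card = 1).card ≤ 1 := by
    rw [Finset.card_le_one]
    intro i hi j hj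
    rw [Finset.mem_filter] at hi hj
    exact hone i hi.1 j hj.1 hi.2 hj.2
  have h4 : ∑ i ∈ I, 3 ≤ ∑ i ∈ I, ((outp H (K i)).card +
      if (outp H (K i)).card = 1 then 2 else 0) := by
    apply Finset.sum_le_sum
    intro i hi
    obtain ⟨k, hk⟩ := out_odd H h3 _ (hodd i hi)
    split_ifs <;> omega
  rw [Finset.sum_add_distrib, ← Finset.sum_filter, Finset.sum_const, Finset.sum_const,
    smul_eq_mul, smul_eq_mul] at h4
  omega

end count

section matching
variable {V : Type*} [Fintype V] [DecidableEq V] (G : SimpleGraph V) [DecidableRel G.Adj]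

lemma dbl_cut (h : TwoEdgeConnected G) (K : Finset (V × Bool))
    (hK : (outp (dbl G) K).card = 1) : ∃ b, ∀ v c, (v, c) ∈ K ↔ c = b := by
  obtain ⟨hc, -, hbr⟩ := h
  rw [Finset.card_eq_one] at hK
  obtain ⟨⟨⟨u, b⟩, ⟨w, b'⟩⟩, hp⟩ := hK
  have hmem : ∀ x y, x ∈ K → y ∉ K → (dbl G).Adj x y → x = (u, b) ∧ y = (w, b') := by
    intro x y h1 h2 h3
    have : (x, y) ∈ outp (dbl G) K := (mem_outp _ _ _).2 ⟨h1, h2, h3⟩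
    rw [hp, Finset.mem_singleton, Prod.mk.injEq] at this
    exact this
  have h0 : ((u, b), (w, b')) ∈ outp (dbl G) K := by rw [hp]; exact Finset.mem_singleton_self _
  obtain ⟨m1, m2, hadj⟩ := (mem_outp _ _ _).1 h0
  rcases hadj with ⟨e, hadj⟩ | ⟨e, hne, -⟩
  · exfalso
    change b = b' at e
    subst e
    apply hbr s(u, w)
    apply cut_bridge G {z | (z, b) ∈ K} m1 m2
    intro x y hx hy hxy
    have := hmem (x, b) (y, b) hx hy (Or.inl ⟨rfl, hxy⟩)
    simpa using this
  · change u = w at e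
    change b ≠ b' at hne
    subst e
    have hclosed : ∀ c x y, (x, c) ∈ K → G.Adj x y → (y, c) ∈ K := by
      intro c x y hx hxy
      by_contra hy
      obtain ⟨e1, e2⟩ := hmem (x, c) (y, c) hx hy (Or.inl ⟨rfl, hxy⟩)
      rw [Prod.mk.injEq] at e1 e2
      exact hne (e1.2.symm.trans e2.2)
    refine ⟨b, fun v c => ⟨fun hv => ?_, ?_⟩⟩
    · by_contra hcb
      have hcb' : c = b' := by
        revert hcb hne; cases b <;> cases b' <;> cases c <;> simp
      subst hcb'
      exact m2 (closed_univ G hc {z | (z, c) ∈ K} hv (hclosed c) u)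
    · rintro rfl
      exact closed_univ G hc {z | (z, c) ∈ K} m1 (hclosed c) v

lemma dbl_matching (h : TwoEdgeConnected G) (hd3 : ∀ v, G.degree v ≤ 3) :
    ∃ m : V × Bool → V × Bool, (∀ v, m (m v) = v) ∧ ∀ v, (dbl G).Adj v (m v) := by
  classical
  have h3 := dbl_nbrs G (two_le_degree G h) hd3
  have hM : ∃ M : (dbl G).Subgraph, M.IsPerfectMatching := by
    rw [SimpleGraph.tutte]
    intro S hS
    unfold SimpleGraph.IsTutteViolator at hS
    let L := ((⊤ : (dbl G).Subgraph).deleteVerts S).coe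
    change S.ncard < L.oddComponents.ncard at hS
    let K : L.ConnectedComponent → Finset (V × Bool) := fun c =>
      (Set.image Subtype.val c.supp).toFinset
    have hK : ∀ c x, x ∈ K c ↔ ∃ hx : x ∈ ((⊤ : (dbl G).Subgraph).deleteVerts S).verts,
        L.connectedComponentMk ⟨x, hx⟩ = c := by
      intro c x
      simp only [K, Set.mem_toFinset, Set.mem_image, Subtype.exists, exists_and_right,
        exists_eq_right, SimpleGraph.ConnectedComponent.mem_supp_iff]
    have hKS : ∀ c x, x ∈ K c → x ∉ S := by
      intro c x hx
      obtain ⟨hx, -⟩ := (hK c x).1 hx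
      exact hx.2
    have hdis : ∀ c d x, x ∈ K c → x ∈ K d → c = d := by
      intro c d x h1 h2
      obtain ⟨_, rfl⟩ := (hK c x).1 h1
      obtain ⟨_, rfl⟩ := (hK d x).1 h2
      rfl
    have hcl : ∀ c x y, x ∈ K c → (dbl G).Adj x y → y ∈ K c ∨ y ∈ S := by
      intro c x y h1 h2
      by_cases hy : y ∈ S
      · exact Or.inr hy
      · left
        obtain ⟨hx, hxc⟩ := (hK c x).1 h1
        have hy' : y ∈ ((⊤ : (dbl G).Subgraph).deleteVerts S).verts := ⟨Set.mem_univ _, hy⟩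
        refine (hK c y).2 ⟨hy', ?_⟩
        rw [← hxc, SimpleGraph.ConnectedComponent.eq]
        apply SimpleGraph.Adj.reachable
        change ((⊤ : (dbl G).Subgraph).deleteVerts S).Adj y x
        rw [SimpleGraph.Subgraph.deleteVerts_adj]
        exact ⟨Set.mem_univ _, hy, Set.mem_univ _, hx.2, h2.symm⟩
    have hodd : ∀ c ∈ L.oddComponents, Odd (K c).card := by
      intro c hc
      have : (K c).card = c.supp.ncard := by
        rw [← Set.ncard_eq_toFinset_card']
        exact Set.ncard_image_of_injective _ Subtype.val_injective
      rw [this]; exact hc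
    have := comp_count (dbl G) h3 L.oddComponents.toFinset K S.toFinset
      (by
        intro i _ j _ hij
        rw [Finset.disjoint_left]
        intro x h1 h2
        exact hij (hdis i j x h1 h2))
      (by
        intro i _ x hx y hxy
        exact (hcl i x y hx hxy).imp_right Set.mem_toFinset.2)
      (by
        intro i hi
        exact hodd i (Set.mem_toFinset.1 hi))
      (by
        intro i _ j _ hi hj
        obtain ⟨b, hb⟩ := dbl_cut G h _ hi
        obtain ⟨b', hb'⟩ := dbl_cut G h _ hj
        obtain ⟨⟨⟨u, c⟩, ⟨w, c'⟩⟩, hp⟩ := Finset.card_pos.1 (by rw [hi]; norm_num)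
        obtain ⟨m1, m2, hadj⟩ := (mem_outp _ _ _).1 hp
        have hS' : (w, c') ∈ S := (hcl i _ _ m1 hadj).resolve_left m2
        by_cases hbb : b = b'
        · subst hbb
          exact hdis i j (u, b) ((hb _ _).2 rfl) ((hb' _ _).2 rfl)
        · exfalso
          apply hKS j (w, c') _ hS'
          rw [hb']
          have : c' ≠ b := fun e => m2 ((hb _ _).2 e)
          revert hbb this
          cases b <;> cases b' <;> cases c' <;> simp)
    rw [Set.ncard_eq_toFinset_card', Set.ncard_eq_toFinset_card'] at hS
    omega
  obtain ⟨M, hM, hsp⟩ := hM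
  have hu : ∀ v, ∃! w, M.Adj v w := fun v => hM (hsp v)
  choose m hm hm' using hu
  refine ⟨m, fun v => ?_, fun v => (hm v).adj_sub⟩
  exact (hm' (m v) v (hm v).symm).symm

end matching

lemma triangle_free {V : Type*} (G : SimpleGraph V) (hgirth : 4 ≤ G.egirth) (x y z : V)
    (h1 : G.Adj x y) (h2 : G.Adj y z) : ¬ G.Adj x z := by
  intro h3
  let w : G.Walk x x := .cons h1 (.cons h2 (.cons h3.symm .nil))
  have hw : w.IsCycle := by
    simp only [w, SimpleGraph.Walk.cons_isCycle_iff]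
    have a := h1.ne
    have b := h2.ne
    have c := h3.ne
    simp [a, b, c, a.symm, c.symm]
  have := hgirth.trans (SimpleGraph.egirth_le_length hw)
  simp only [w, SimpleGraph.Walk.length_cons, SimpleGraph.Walk.length_nil] at this
  norm_num at this

/-- If `G` is a finite 2-edge-connected simple graph of maximum degree at most 3 and girth at
least 4, then the line graph of `G` admits an `(11,3)`-coloring, i.e. the circular chromatic
index of `G` is at most `11/3`. -/
theorem circular_chromatic_index_le_eleven_thirds_of_girth_four
    {V : Type*} [Fintype V] [DecidableEq V] (G : SimpleGraph V) [DecidableRel G.Adj]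
    (h2ec : TwoEdgeConnected G)
    (hdeg : ∀ v, G.degree v ≤ 3)
    (hgirth : 4 ≤ G.egirth) :
    ∃ f, IsPQColoring G.lineGraph 11 3 f := by
  classical
  have htri := dbl_triangle G (triangle_free G hgirth)
  have h3 := dbl_nbrs G (two_le_degree G h2ec) hdeg
  obtain ⟨m, hm, hmA⟩ := dbl_matching G h2ec hdeg
  let F : SimpleGraph (V × Bool) :=
    { Adj := fun v w => (dbl G).Adj v w ∧ w ≠ m v
      symm := ⟨by
        rintro v w ⟨h, hne⟩
        refine ⟨h.symm, ?_⟩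
        rintro rfl
        exact hne (hm w).symm⟩
      loopless := ⟨fun v h => (dbl G).loopless.irrefl _ h.1⟩ }
  have hF : ∀ v w, F.Adj v w ↔ (dbl G).Adj v w ∧ w ≠ m v := fun v w => Iff.rfl
  obtain ⟨σ, hσ, hσ2⟩ := orient' F (by
    intro v
    obtain ⟨N, hN, hN'⟩ := h3 v
    have : (N.erase (m v)).card = 2 := by
      rw [Finset.card_erase_of_mem ((hN' _).2 (hmA v)), hN]
    obtain ⟨a, b, hab, e⟩ := Finset.card_eq_two.1 this
    refine ⟨a, b, hab, fun w => ?_⟩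
    have : w ∈ N.erase (m v) ↔ w = a ∨ w = b := by rw [e]; simp
    rw [← this, Finset.mem_erase, hN', hF, and_comm])
  have hσA : ∀ v, F.Adj v (σ v) := fun v => (hσ _ _).2 (Or.inl rfl)
  obtain ⟨c, e, hlt, hcm, hfar⟩ := core σ m hm
    (fun v h => ((hσA v).2 h.symm))
    (fun v h => htri v (σ v) (σ (σ v)) (hσA v).1 (hσA _).1 (h ▸ hmA v))
    (fun v h => (hmA v).ne h.symm)
    (fun v h => htri v (σ v) (σ (σ v)) (hσA v).1 (hσA _).1 (by
      have := (hσA (σ (σ v))).1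
      rw [h] at this
      exact this.symm))
  let g : V × Bool → V × Bool → ℕ := fun u v =>
    if m u = v then c u else if σ u = v then e u else e v
  have hg1 : ∀ u, g u (m u) = c u := fun u => by simp [g]
  have hg2 : ∀ u, g u (σ u) = e u := fun u => by
    have : m u ≠ σ u := fun h => (hσA u).2 h.symm
    simp [g, this]
  have hg3 : ∀ u, g (σ u) u = e u := fun u => by
    have : m (σ u) ≠ u := fun h => (hσA u).2 ((hm (σ u)).symm.trans (congrArg m h))
    simp [g, this, hσ2]
  have hcases : ∀ u v, (dbl G).Adj u v → v = m u ∨ v = σ u ∨ u = σ v := by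
    intro u v h
    by_cases hv : v = m u
    · exact Or.inl hv
    · exact Or.inr ((hσ u v).1 ⟨h, hv⟩)
  have hgs : ∀ u v, (dbl G).Adj u v → g u v = g v u := by
    intro u v h
    rcases hcases u v h with rfl | rfl | rfl
    · rw [hg1]
      have := hg1 (m u)
      rw [hm] at this
      rw [this, hcm]
    · rw [hg2, hg3]
    · rw [hg2, hg3]
  have hgfar : ∀ u v w, (dbl G).Adj u v → (dbl G).Adj u w → v ≠ w → Far (g u v) (g u w) := by
    have hce : ∀ u, Far (c u) (e u) := fun u => by
      have := (hfar (σ.symm u)).2.2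
      simpa using this
    intro u v w h1 h2 hne
    rcases hcases u v h1 with hv | hv | hv <;> rcases hcases u w h2 with hw | hw | hw
    · exact absurd (hv.trans hw.symm) hne
    · rw [hv, hw, hg1, hg2]; exact hce u
    · rw [hv, hg1, hw, hg3]; exact (hfar w).2.1
    · rw [hv, hw, hg1, hg2]; exact (hce u).symm
    · exact absurd (hv.trans hw.symm) hne
    · rw [hv, hg2, hw, hg3]; exact (hfar w).1.symm
    · rw [hw, hg1, hv, hg3]; exact (hfar v).2.1.symm
    · rw [hw, hg2, hv, hg3]; exact (hfar v).1
    · exact absurd (σ.injective (hv.symm.trans hw)) hne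
  have hdA : ∀ u v, G.Adj u v → (dbl G).Adj (u, false) (v, false) :=
    fun u v h => Or.inl ⟨rfl, h⟩
  let f : G.edgeSet → ℕ := fun x => g ((Quot.out x.1).1, false) ((Quot.out x.1).2, false)
  have hf : ∀ (x : G.edgeSet) u v, x.1 = s(u, v) → f x = g (u, false) (v, false) := by
    intro x u v hx
    have hadj : G.Adj u v := by
      have := x.2
      rw [hx] at this
      exact this
    have h1 : s((Quot.out x.1).1, (Quot.out x.1).2) = s(u, v) := by
      rw [← hx]
      exact Quot.out_eq x.1
    rw [Sym2.eq_iff] at h1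
    simp only [f]
    rcases h1 with ⟨p, q⟩ | ⟨p, q⟩
    · rw [p, q]
    · rw [p, q]; exact (hgs _ _ (hdA _ _ hadj)).symm
  refine ⟨f, ?_, ?_⟩
  · intro x
    simp only [f, g]
    split_ifs
    · exact (hlt _).1
    · exact (hlt _).2
    · exact (hlt _).2
  · intro x y hxy
    rw [SimpleGraph.lineGraph_adj_iff_exists] at hxy
    obtain ⟨hne, v, hx, hy⟩ := hxy
    obtain ⟨a, ha⟩ := Sym2.mem_iff_exists.1 hx
    obtain ⟨b, hb⟩ := Sym2.mem_iff_exists.1 hy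
    have hva : G.Adj v a := by have := x.2; rw [ha] at this; exact this
    have hvb : G.Adj v b := by have := y.2; rw [hb] at this; exact this
    rw [hf x v a ha, hf y v b hb]
    have hab : ((a, false) : V × Bool) ≠ (b, false) := by
      intro h
      have : a = b := congrArg Prod.fst h
      apply hne
      apply Subtype.ext
      rw [ha, hb, this]
    have := hgfar _ _ _ (hdA _ _ hva) (hdA _ _ hvb) hab
    unfold Far at this
    refine ⟨by exact_mod_cast this.1, ?_⟩
    have h8 := this.2
    push_cast
    linarith
end

section
/- The circular chromatic index of H2 (the graph obtained from K4 by subdividing one edge) equals 4. That is: the line graph L(H2) admits a (4,1)-coloring (a proper 4-coloring), and for all positive integers p, q with p < 4q, L(H2) admits no (p,q)-coloring. -/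
open SimpleGraph

/-- The graph `H₂` obtained from `K₄` by subdividing one edge:
vertices `a = 0, b = 1, c = 2, d = 3, s = 4`, edges `ac, ad, bc, bd, cd, as, sb`. -/
def H2 : SimpleGraph (Fin 5) :=
  SimpleGraph.fromRel (fun x y =>
    (x, y) ∈ ({(0, 2), (0, 3), (1, 2), (1, 3), (2, 3), (0, 4), (1, 4)} : Set (Fin 5 × Fin 5)))

/-- A proper 4-coloring of the edges of `H2`. -/
def edgeColor (e : Sym2 (Fin 5)) : ℕ :=
  if e = s(0, 2) ∨ e = s(1, 3) then 0 else
  if e = s(0, 3) ∨ e = s(1, 2) then 1 else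
  if e = s(2, 3) ∨ e = s(0, 4) then 2 else 3

/-- The edges of `H2`. -/
theorem H2_edge_cases (e : Sym2 (Fin 5)) (he : e ∈ H2.edgeSet) :
    e = s(0, 2) ∨ e = s(0, 3) ∨ e = s(1, 2) ∨ e = s(1, 3) ∨ e = s(2, 3) ∨ e = s(0, 4) ∨
      e = s(1, 4) := by
  induction e with
  | _ x y =>
    simp only [SimpleGraph.mem_edgeSet, H2, SimpleGraph.fromRel_adj, Set.mem_insert_iff,
      Set.mem_singleton_iff] at he
    revert he
    revert x y
    decide

/-- Splitting of the distance condition according to the order of the two colors. -/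
theorem dist_split {x y p q : ℤ} (h : q ≤ |x - y| ∧ |x - y| ≤ p - q) :
    (q ≤ x - y ∧ x - y ≤ p - q) ∨ (q ≤ y - x ∧ y - x ≤ p - q) := by
  rcases abs_cases (x - y) with h1 | h1
  · left; omega
  · right; omega

/-- The arithmetic core: seven colors subject to the thirteen adjacency constraints. -/
theorem no_coloring (p q ac ad bc bd cd sa sb : ℤ) (hq : 0 < q) (hp : p < 4 * q)
    (hac : 0 ≤ ac ∧ ac < p) (had : 0 ≤ ad ∧ ad < p) (hbc : 0 ≤ bc ∧ bc < p)
    (hbd : 0 ≤ bd ∧ bd < p) (hcd : 0 ≤ cd ∧ cd < p) (hsa : 0 ≤ sa ∧ sa < p)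
    (hsb : 0 ≤ sb ∧ sb < p)
    (h0 : q ≤ |ac - bc| ∧ |ac - bc| ≤ p - q)
    (h1 : q ≤ |ac - cd| ∧ |ac - cd| ≤ p - q)
    (h2 : q ≤ |bc - cd| ∧ |bc - cd| ≤ p - q)
    (h3 : q ≤ |ad - cd| ∧ |ad - cd| ≤ p - q)
    (h4 : q ≤ |bd - cd| ∧ |bd - cd| ≤ p - q)
    (h5 : q ≤ |ad - bd| ∧ |ad - bd| ≤ p - q)
    (h6 : q ≤ |ac - ad| ∧ |ac - ad| ≤ p - q)
    (h7 : q ≤ |bc - bd| ∧ |bc - bd| ≤ p - q)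
    (h8 : q ≤ |ac - sa| ∧ |ac - sa| ≤ p - q)
    (h9 : q ≤ |ad - sa| ∧ |ad - sa| ≤ p - q)
    (h10 : q ≤ |bc - sb| ∧ |bc - sb| ≤ p - q)
    (h11 : q ≤ |bd - sb| ∧ |bd - sb| ≤ p - q)
    (h12 : q ≤ |sa - sb| ∧ |sa - sb| ≤ p - q) : False := by
  replace h0 := dist_split h0
  replace h1 := dist_split h1
  replace h2 := dist_split h2
  replace h3 := dist_split h3
  replace h4 := dist_split h4
  replace h5 := dist_split h5
  replace h6 := dist_split h6
  replace h7 := dist_split h7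
  replace h8 := dist_split h8
  replace h9 := dist_split h9
  replace h10 := dist_split h10
  replace h11 := dist_split h11
  replace h12 := dist_split h12
  rcases h0 with h0 | h0 <;> rcases h1 with h1 | h1 <;> rcases h2 with h2 | h2 <;>
    (try (clear h3 h4 h5 h6 h7 h8 h9 h10 h11 h12; omega)) <;>
  rcases h3 with h3 | h3 <;> (try (exfalso; clear h4 h5 h6 h7 h8 h9 h10 h11 h12; omega)) <;>
  rcases h4 with h4 | h4 <;> (try (exfalso; clear h5 h6 h7 h8 h9 h10 h11 h12; omega)) <;>
  rcases h5 with h5 | h5 <;> (try (exfalso; clear h6 h7 h8 h9 h10 h11 h12; omega)) <;>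
  rcases h6 with h6 | h6 <;> (try (exfalso; clear h7 h8 h9 h10 h11 h12; omega)) <;>
  rcases h7 with h7 | h7 <;> (try (exfalso; clear h8 h9 h10 h11 h12; omega)) <;>
  rcases h8 with h8 | h8 <;> (try (exfalso; clear h9 h10 h11 h12; omega)) <;>
  rcases h9 with h9 | h9 <;> (try (exfalso; clear h10 h11 h12; omega)) <;>
  rcases h10 with h10 | h10 <;> (try (exfalso; clear h11 h12; omega)) <;>
  rcases h11 with h11 | h11 <;> (try (exfalso; clear h12; omega)) <;>
  rcases h12 with h12 | h12 <;> (try omega)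

/-- The circular chromatic index of `H₂` (the graph obtained from `K₄` by subdividing one
edge) equals 4: its line graph admits a `(4,1)`-coloring, but admits no `(p,q)`-coloring with
`p < 4q`. -/
theorem circular_chromatic_index_H2_eq_four :
    (∃ f, IsPQColoring H2.lineGraph 4 1 f) ∧
      ∀ p q : ℕ, 0 < p → 0 < q → p < 4 * q → ¬ ∃ f, IsPQColoring H2.lineGraph p q f := by
  constructor
  · refine ⟨fun e => edgeColor e.1, ?_, ?_⟩
    · intro v
      dsimp only [edgeColor]
      split_ifs <;> omega
    · rintro ⟨x, hx⟩ ⟨y, hy⟩ hxy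
      rw [SimpleGraph.lineGraph_adj_iff_exists] at hxy
      obtain ⟨hne, v, hvx, hvy⟩ := hxy
      have hne' : x ≠ y := fun h => hne (Subtype.ext h)
      dsimp only at hvx hvy ⊢
      clear hne
      rcases H2_edge_cases x hx with rfl | rfl | rfl | rfl | rfl | rfl | rfl <;>
      rcases H2_edge_cases y hy with rfl | rfl | rfl | rfl | rfl | rfl | rfl <;>
      clear hx hy <;> revert v <;> revert hne' <;> decide
  · rintro p q _ hq hpq ⟨f, hf, hadj⟩
    have m_ac : s(0, 2) ∈ H2.edgeSet := by simp [H2]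
    have m_ad : s(0, 3) ∈ H2.edgeSet := by simp [H2]
    have m_bc : s(1, 2) ∈ H2.edgeSet := by simp [H2]
    have m_bd : s(1, 3) ∈ H2.edgeSet := by simp [H2]
    have m_cd : s(2, 3) ∈ H2.edgeSet := by simp [H2]
    have m_sa : s(0, 4) ∈ H2.edgeSet := by simp [H2]
    have m_sb : s(1, 4) ∈ H2.edgeSet := by simp [H2]
    have key : ∀ (x y : Sym2 (Fin 5)) (hx : x ∈ H2.edgeSet) (hy : y ∈ H2.edgeSet),
        x ≠ y → (∃ v, v ∈ x ∧ v ∈ y) → (q : ℤ) ≤ |(f ⟨x, hx⟩ : ℤ) - (f ⟨y, hy⟩ : ℤ)| ∧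
          |(f ⟨x, hx⟩ : ℤ) - (f ⟨y, hy⟩ : ℤ)| ≤ (p : ℤ) - q := by
      intro x y hx hy hne hv
      apply hadj
      rw [SimpleGraph.lineGraph_adj_iff_exists]
      exact ⟨fun h => hne (congrArg Subtype.val h), hv⟩
    have bound : ∀ e, 0 ≤ (f e : ℤ) ∧ (f e : ℤ) < p := by
      intro e
      have := hf e
      omega
    exact no_coloring p q (f ⟨_, m_ac⟩) (f ⟨_, m_ad⟩) (f ⟨_, m_bc⟩) (f ⟨_, m_bd⟩) (f ⟨_, m_cd⟩) (f ⟨_, m_sa⟩) (f ⟨_, m_sb⟩)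
      (by omega) (by omega)
      (bound _) (bound _) (bound _) (bound _) (bound _) (bound _) (bound _)
      (key _ _ m_ac m_bc (by decide) (by decide))
      (key _ _ m_ac m_cd (by decide) (by decide))
      (key _ _ m_bc m_cd (by decide) (by decide))
      (key _ _ m_ad m_cd (by decide) (by decide))
      (key _ _ m_bd m_cd (by decide) (by decide))
      (key _ _ m_ad m_bd (by decide) (by decide))
      (key _ _ m_ac m_ad (by decide) (by decide))
      (key _ _ m_bc m_bd (by decide) (by decide))
      (key _ _ m_ac m_sa (by decide) (by decide))
      (key _ _ m_ad m_sa (by decide) (by decide))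
      (key _ _ m_bc m_sb (by decide) (by decide))
      (key _ _ m_bd m_sb (by decide) (by decide))
      (key _ _ m_sa m_sb (by decide) (by decide))
end

section
/- Let G be a finite cubic simple graph of girth at least 4 with a perfect matching M, and let c be a valid 4-edge-coloring of G with respect to M. If some cycle C of G−M has both an input and an output with respect to c, then there exists a valid 4-edge-coloring c* of G with respect to M such that φ(c*) + ψ(c*) < φ(c) + ψ(c). -/
open SimpleGraph

/-- A proper 4-edge-coloring of `G` (a proper coloring of the line graph of `G` with colors
`0, 1, 2, 3`), given as a function on `Sym2 V` whose values only matter on edges of `G`. -/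
def IsProper4EdgeColoring {V : Type*} (G : SimpleGraph V) (c : Sym2 V → ℕ) : Prop :=
  (∀ e ∈ G.edgeSet, c e < 4) ∧
    ∀ e f, e ∈ G.edgeSet → f ∈ G.edgeSet → e ≠ f → (∃ v, v ∈ e ∧ v ∈ f) → c e ≠ c f

/-- `(e, f)` is a tight arc of the digraph `D_c(L(G))`: `e` and `f` are distinct edges of `G`
sharing an endpoint, and `c f ≡ c e + 1 (mod 4)`. -/
def EdgeTightArc {V : Type*} (G : SimpleGraph V) (c : Sym2 V → ℕ) (e f : Sym2 V) : Prop :=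
  e ∈ G.edgeSet ∧ f ∈ G.edgeSet ∧ e ≠ f ∧ (∃ v, v ∈ e ∧ v ∈ f) ∧ c f = (c e + 1) % 4

/-- The graph `G - M` obtained from `G` by deleting the edges of the subgraph `M`. -/
def MinusM {V : Type*} (G : SimpleGraph V) (M : G.Subgraph) : SimpleGraph V :=
  G \ M.spanningCoe

/-- The edge `e` lies on the cycle (connected component) `K` of `G - M`, i.e. `e` is an edge of
`G - M` with both endpoints in `K`. -/
def EdgeOnComp {V : Type*} (G : SimpleGraph V) (M : G.Subgraph)
    (K : (MinusM G M).ConnectedComponent) (e : Sym2 V) : Prop :=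
  e ∈ (MinusM G M).edgeSet ∧ ∀ v ∈ e, v ∈ K.supp

/-- `c` is a valid 4-edge-coloring of `G` with respect to the perfect matching `M`: it is a
proper 4-edge-coloring, every `M`-edge is colored `0`, the edges of each even cycle of `G - M`
are colored with colors `1` and `2` (hence, by properness, alternately), and the edges of each
odd cycle of `G - M` are colored with `1` and `2` except exactly one edge colored `3`. -/
def IsValidColoring {V : Type*} (G : SimpleGraph V) (M : G.Subgraph) (c : Sym2 V → ℕ) : Prop :=
  IsProper4EdgeColoring G c ∧
  (∀ e ∈ M.edgeSet, c e = 0) ∧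
  ∀ K : (MinusM G M).ConnectedComponent,
    (Even K.supp.ncard → ∀ e, EdgeOnComp G M K e → c e = 1 ∨ c e = 2) ∧
    (¬ Even K.supp.ncard →
      (∀ e, EdgeOnComp G M K e → c e = 1 ∨ c e = 2 ∨ c e = 3) ∧
      (∃! e, EdgeOnComp G M K e ∧ c e = 3))

/-- The arc `(x, y)` of the edge `s(x,y)` is unblocked with respect to `c`: there is a directed
walk `(e₁, ..., eₙ, s(x,y), e₁', ..., eₘ')` in `D_c(L(G))` with `c e₁ = c eₘ' = 3`, `eₙ`
incident to `x` and `e₁'` incident to `y`. -/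
def Unblocked {V : Type*} (G : SimpleGraph V) (c : Sym2 V → ℕ) (x y : V) : Prop :=
  ∃ (l₁ l₂ : List (Sym2 V)) (h₁ : l₁ ≠ []) (h₂ : l₂ ≠ []),
    List.Chain' (EdgeTightArc G c) (l₁ ++ s(x, y) :: l₂) ∧
    c (l₁.head h₁) = 3 ∧ c (l₂.getLast h₂) = 3 ∧
    x ∈ l₁.getLast h₁ ∧ y ∈ l₂.head h₂

/-- The edge `e` is completely blocked with respect to `c`: both of its arcs are blocked. -/
def CompletelyBlocked {V : Type*} (G : SimpleGraph V) (c : Sym2 V → ℕ) (e : Sym2 V) : Prop :=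
  ∀ x y, e = s(x, y) → ¬ Unblocked G c x y

/-- `φ(c)`: the number of `M`-edges that are not completely blocked with respect to `c`. -/
noncomputable def phi {V : Type*} (G : SimpleGraph V) (M : G.Subgraph)
    (c : Sym2 V → ℕ) : ℕ :=
  {e | e ∈ M.edgeSet ∧ ¬ CompletelyBlocked G c e}.ncard

/-- `ψ(c)`: the number of `M`-edges that are not completely blocked with respect to `c` and are
chords of a cycle of `G - M` (both endpoints on the same cycle of `G - M`). -/
noncomputable def psi {V : Type*} (G : SimpleGraph V) (M : G.Subgraph)
    (c : Sym2 V → ℕ) : ℕ :=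
  {e | e ∈ M.edgeSet ∧ ¬ CompletelyBlocked G c e ∧
    ∀ x y, e = s(x, y) → (MinusM G M).Reachable x y}.ncard

/-- An input of the cycle (connected component) `K` of `G - M` with respect to `c`: an
unblocked arc `(x, y)` of some `M`-edge `s(x,y)` whose head `y` lies on `K`. -/
def HasInput {V : Type*} (G : SimpleGraph V) (M : G.Subgraph) (c : Sym2 V → ℕ)
    (K : (MinusM G M).ConnectedComponent) : Prop :=
  ∃ x y, s(x, y) ∈ M.edgeSet ∧ Unblocked G c x y ∧ y ∈ K.supp

/-- An output of the cycle (connected component) `K` of `G - M` with respect to `c`: an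
unblocked arc `(x, y)` of some `M`-edge `s(x,y)` whose tail `x` lies on `K`. -/
def HasOutput {V : Type*} (G : SimpleGraph V) (M : G.Subgraph) (c : Sym2 V → ℕ)
    (K : (MinusM G M).ConnectedComponent) : Prop :=
  ∃ x y, s(x, y) ∈ M.edgeSet ∧ Unblocked G c x y ∧ x ∈ K.supp


/-- Combinatorial core. -/
lemma comb_core (n : ℕ) (hn : Odd n) (o i x : ℕ → ℕ)
    (ho : ∀ s, o (s + n) = o s) (hi : ∀ s, i (s + n) = i s) (hx : ∀ s, x (s + n) = x s)
    (hle : ∀ s, o s + i s + x s ≤ 1)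
    (hxx : ∀ s, x s = 1 → o (s + 3) + i (s + 3) + x (s + 3) = 0)
    (h1 : 1 ≤ o 0 + o 1 ∨ x 0 = 1) (h2 : 1 ≤ i 2 + i 3 ∨ x 0 = 1) :
    ∃ s, o s + o (s + 1) + i (s + 2) + i (s + 3) + 2 * x s <
      o 0 + o 1 + i 2 + i 3 + 2 * x 0 := by
  by_contra hcon
  push Not at hcon
  have hper : ∀ f : ℕ → ℕ, (∀ s, f (s + n) = f s) →
      ∑ s ∈ Finset.range n, f (s + 1) = ∑ s ∈ Finset.range n, f s := by
    intro f hf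
    have a := Finset.sum_range_succ f n
    have b := Finset.sum_range_succ' f n
    have := hf 0
    rw [zero_add] at this
    omega
  have hW : ∀ s, 2 ≤ o s + o (s + 1) + i (s + 2) + i (s + 3) + 2 * x s := by
    intro s
    have := hcon s
    omega
  have hsum : ∑ s ∈ Finset.range n, (o s + o (s + 1) + i (s + 2) + i (s + 3) + 2 * x s) =
      ∑ s ∈ Finset.range n, 2 * (o s + i s + x s) := by
    have a1 := hper o ho
    have a2 := hper i hi
    have a3 := hper (fun s => i (s + 1)) (fun s => by
      have := hi (s + 1); simpa [add_right_comm] using this)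
    have a4 := hper (fun s => i (s + 2)) (fun s => by
      have := hi (s + 2); simpa [add_right_comm] using this)
    simp only [add_assoc] at a3 a4
    norm_num at a3 a4
    simp only [Finset.sum_add_distrib, ← Finset.mul_sum]
    omega
  have hn0 : 0 < n := hn.pos
  have hmod : ∀ f : ℕ → ℕ, (∀ s, f (s + n) = f s) → ∀ s, f s = f (s % n) := by
    intro f hf s
    have : ∀ k r, f (r + k * n) = f r := by
      intro k
      induction k with
      | zero => simp
      | succ k ih => intro r; rw [Nat.succ_mul, ← add_assoc, hf, ih]
    conv_lhs => rw [← Nat.mod_add_div' s n]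
    exact this _ _
  have hle' : ∑ s ∈ Finset.range n, 2 * (o s + i s + x s) ≤ ∑ s ∈ Finset.range n, 2 :=
    Finset.sum_le_sum (fun s _ => by have := hle s; omega)
  have hge' : ∑ s ∈ Finset.range n, 2 ≤
      ∑ s ∈ Finset.range n, (o s + o (s + 1) + i (s + 2) + i (s + 3) + 2 * x s) :=
    Finset.sum_le_sum (fun s _ => hW s)
  have e1 := (Finset.sum_eq_sum_iff_of_le (s := Finset.range n)
    (f := fun s => 2 * (o s + i s + x s)) (g := fun _ => 2)
    (fun s _ => by have := hle s; omega)).1 (by omega)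
  have e2 := (Finset.sum_eq_sum_iff_of_le (s := Finset.range n)
    (g := fun s => (o s + o (s + 1) + i (s + 2) + i (s + 3) + 2 * x s)) (f := fun _ => 2)
    (fun s _ => hW s)).1 (by omega)
  have one : ∀ s, o s + i s + x s = 1 := by
    intro s
    rw [hmod o ho s, hmod i hi s, hmod x hx s]
    have := e1 (s % n) (Finset.mem_range.2 (Nat.mod_lt _ hn0))
    omega
  have hx0 : ∀ s, x s = 0 := by
    intro s
    have a := hxx s
    have b := one s
    have d := one (s + 3)
    omega
  have two : ∀ s, o s + o (s + 1) + i (s + 2) + i (s + 3) + 2 * x s = 2 := by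
    intro s
    have := hmod (fun s => o s + o (s + 1) + i (s + 2) + i (s + 3) + 2 * x s) (by
      intro s
      have h1 := ho s
      have h2 := ho (s + 1)
      have h3 := hi (s + 2)
      have h4 := hi (s + 3)
      have h5 := hx s
      rw [add_right_comm] at h2 h3 h4
      simp only [*]) s
    have h := e2 (s % n) (Finset.mem_range.2 (Nat.mod_lt _ hn0))
    omega
  have g2 : ∀ s, o (s + 2) + o (s + 3) = o s + o (s + 1) := by
    intro s
    have := two s
    have := one (s + 2)
    have := one (s + 3)
    have := hx0 s
    have := hx0 (s + 2)
    have := hx0 (s + 3)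
    omega
  have g2k : ∀ k s, o (s + 2 * k) + o (s + 2 * k + 1) = o s + o (s + 1) := by
    intro k
    induction k with
    | zero => simp
    | succ k ih =>
      intro s
      have := g2 (s + 2 * k)
      have := ih s
      have e : s + 2 * (k + 1) = s + 2 * k + 2 := by ring
      rw [e]
      have e : s + 2 * k + 2 + 1 = s + 2 * k + 3 := by ring
      rw [e]
      omega
  obtain ⟨k, hk⟩ := hn
  have g1 : ∀ s, o (s + 1) + o (s + 2) = o s + o (s + 1) := by
    intro s
    have a := g2k k (s + 1)
    have b := ho s
    have d := ho (s + 1)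
    have e : s + 1 + 2 * k = s + n := by omega
    rw [e] at a
    have e : s + n + 1 = s + 1 + n := by omega
    rw [e] at a
    have e : s + 1 + 1 = s + 2 := by omega
    rw [e] at a
    omega
  have p2 : ∀ s, o (s + 2) = o s := fun s => by have := g1 s; omega
  have p2k : ∀ k s, o (s + 2 * k) = o s := by
    intro k
    induction k with
    | zero => simp
    | succ k ih =>
      intro s
      rw [show s + 2 * (k + 1) = (s + 2 * k) + 2 by ring, p2, ih]
  have p1 : ∀ s, o (s + 1) = o s := by
    intro s
    rw [← p2k k (s + 1), ← ho s]
    congr 1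
    omega
  have := p1 0
  have := p1 1
  have := p1 2
  have := one 0
  have := one 1
  have := one 2
  have := one 3
  have := hx0 0
  norm_num at *
  omega

/-- Vertices on an edge of color 3. -/
def OutS {V : Type*} (G : SimpleGraph V) (d : Sym2 V → ℕ) (x : V) : Prop :=
  ∃ e ∈ G.edgeSet, d e = 3 ∧ x ∈ e

/-- Vertices from which a color sequence 1,2,3 starts. -/
def InS {V : Type*} (G : SimpleGraph V) (d : Sym2 V → ℕ) (y : V) : Prop :=
  ∃ e₁ ∈ G.edgeSet, ∃ e₂ ∈ G.edgeSet, ∃ e₃ ∈ G.edgeSet, d e₁ = 1 ∧ d e₂ = 2 ∧ d e₃ = 3 ∧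
    y ∈ e₁ ∧ (∃ v, v ∈ e₁ ∧ v ∈ e₂) ∧ (∃ v, v ∈ e₂ ∧ v ∈ e₃)

lemma unblocked_iff {V : Type*} (G : SimpleGraph V) (d : Sym2 V → ℕ)
    (hd : ∀ e ∈ G.edgeSet, d e < 4) (x y : V) (hxy : G.Adj x y) (h0 : d s(x, y) = 0) :
    Unblocked G d x y ↔ OutS G d x ∧ InS G d y := by
  constructor
  · rintro ⟨l₁, l₂, h₁, h₂, hch, c1, c2, hx, hy⟩
    replace hch : List.IsChain (EdgeTightArc G d) (l₁ ++ s(x, y) :: l₂) := hch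
    rw [← List.dropLast_append_getLast h₁, List.append_assoc, List.singleton_append] at hch
    have hch2 := (List.isChain_append.1 hch).2.1
    rw [List.isChain_cons_cons] at hch2
    obtain ⟨t0, hch3⟩ := hch2
    constructor
    · obtain ⟨a, b, _, _, e⟩ := t0
      refine ⟨_, a, ?_, hx⟩
      have := hd _ a
      omega
    · match l₂, h₂, c2, hy, hch3 with
      | [f1], _, c2, hy, hch3 =>
        rw [List.isChain_cons_cons] at hch3
        obtain ⟨⟨_, _, _, _, e⟩, _⟩ := hch3
        simp at c2
        omega
      | [f1, f2], _, c2, hy, hch3 =>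
        simp only [List.isChain_cons_cons] at hch3
        obtain ⟨⟨_, _, _, _, e⟩, ⟨_, _, _, _, e'⟩, _⟩ := hch3
        simp at c2
        omega
      | f1 :: f2 :: f3 :: r, _, c2, hy, hch3 =>
        simp only [List.isChain_cons_cons] at hch3
        obtain ⟨⟨_, a1, _, _, e⟩, ⟨_, a2, _, b, e'⟩, ⟨_, a3, _, b', e''⟩, _⟩ := hch3
        refine ⟨f1, a1, f2, a2, f3, a3, by omega, by omega, by omega, by simpa using hy, b, b'⟩
  · rintro ⟨⟨e, he, he3, hx⟩, e₁, m1, e₂, m2, e₃, m3, c1, c2, c3, hy, s1, s2⟩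
    refine ⟨[e], [e₁, e₂, e₃], by simp, by simp, ?_, by simpa, by simpa, by simpa, by simpa⟩
    change List.IsChain _ _
    simp only [List.singleton_append, List.isChain_cons_cons]
    refine ⟨⟨he, hxy, ?_, ⟨x, hx, by simp⟩, by omega⟩, ⟨hxy, m1, ?_, ⟨y, by simp, hy⟩, by omega⟩,
      ⟨m1, m2, ?_, s1, by omega⟩, ⟨m2, m3, ?_, s2, by omega⟩, by simp⟩ <;>
      · rintro rfl; omega

/-- Cyclic parametrization of the component `K`. -/
structure Cyc {V : Type*} (H : SimpleGraph V) (K : H.ConnectedComponent) (n : ℕ) (F : ℕ → V) :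
    Prop where
  three : 3 ≤ n
  per : ∀ i, F (i + n) = F i
  inj : ∀ i < n, ∀ j < n, F i = F j → i = j
  adj : ∀ i, H.Adj (F i) (F (i + 1))
  nb : ∀ i v, H.Adj (F (i + 1)) v → v = F i ∨ v = F (i + 2)
  surj : ∀ v ∈ K.supp, ∃ i < n, F i = v
  mem : ∀ i, F i ∈ K.supp

lemma Cyc.shift1 {V : Type*} {H : SimpleGraph V} {K : H.ConnectedComponent} {n : ℕ} {F : ℕ → V}
    (h : Cyc H K n F) : Cyc H K n (fun i => F (i + 1)) where
  three := h.three
  per i := by have := h.per (i + 1); rwa [add_right_comm] at this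
  adj i := h.adj _
  nb i := h.nb _
  mem i := h.mem _
  surj v hv := by
    obtain ⟨i, hi, rfl⟩ := h.surj v hv
    have := h.three
    rcases i with _ | i
    · refine ⟨n - 1, by omega, ?_⟩
      have := h.per 0
      rw [← this]; congr 1; omega
    · exact ⟨i, by omega, rfl⟩
  inj i hi j hj hij := by
    have h3 := h.three
    have p0 := h.per 0
    by_cases a : i + 1 < n <;> by_cases b : j + 1 < n
    · have := h.inj _ a _ b hij; omega
    · have e : j + 1 = 0 + n := by omega
      rw [e, p0] at hij
      have := h.inj _ a 0 (by omega) hij; omega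
    · have e : i + 1 = 0 + n := by omega
      rw [e, p0] at hij
      have := h.inj 0 (by omega) _ b hij; omega
    · omega

lemma Cyc.shift {V : Type*} {H : SimpleGraph V} {K : H.ConnectedComponent} {n : ℕ} {F : ℕ → V}
    (h : Cyc H K n F) (s : ℕ) : Cyc H K n (fun i => F (i + s)) := by
  induction s with
  | zero => simpa using h
  | succ s ih =>
    have := ih.shift1
    convert this using 3
    omega

lemma Cyc.ncard {V : Type*} {H : SimpleGraph V} {K : H.ConnectedComponent} {n : ℕ} {F : ℕ → V}
    (h : Cyc H K n F) : K.supp.ncard = n := by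
  have : K.supp = F '' (Finset.range n : Finset ℕ) := by
    ext v
    constructor
    · intro hv
      obtain ⟨i, hi, e⟩ := h.surj v hv
      exact ⟨i, by simpa using hi, e⟩
    · rintro ⟨i, _, rfl⟩; exact h.mem i
  rw [this, Set.InjOn.ncard_image, Set.ncard_coe_finset, Finset.card_range]
  intro i hi j hj hij
  exact h.inj i (by simpa using hi) j (by simpa using hj) hij

lemma exists_cyc {V : Type*} [Finite V] (H : SimpleGraph V)
    (h2 : ∀ v, (H.neighborSet v).ncard = 2) (K : H.ConnectedComponent) (a b : V)
    (ha : a ∈ K.supp) (hab : H.Adj a b) :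
    ∃ n F, Cyc H K n F ∧ F 0 = a ∧ F 1 = b := by
  have hcyc : H.IsCycles := fun v _ => h2 v
  have key : ∃ (p : H.Walk a a), p.IsCycle ∧ p.toSubgraph.verts = K.supp ∧ p.getVert 1 = b := by
    obtain ⟨p, hp, hv⟩ := hcyc.exists_cycle_toSubgraph_verts_eq_connectedComponentSupp ha ⟨b, hab⟩
    have h3 := hp.three_le_length
    have hsub : ({p.snd, p.penultimate} : Set V) ⊆ H.neighborSet a := by
      rintro v (rfl | rfl)
      · exact p.adj_snd hp.not_nil
      · exact (p.adj_penultimate hp.not_nil).symm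
    have : ({p.snd, p.penultimate} : Set V) = H.neighborSet a := by
      apply Set.eq_of_subset_of_ncard_le hsub
      rw [h2, Set.ncard_pair hp.snd_ne_penultimate]
    have hb : b ∈ ({p.snd, p.penultimate} : Set V) := by rw [this]; exact hab
    rcases hb with rfl | hb
    · exact ⟨p, hp, hv, rfl⟩
    · refine ⟨p.reverse, hp.reverse, by simpa using hv, ?_⟩
      rw [SimpleGraph.Walk.getVert_reverse, hb]
  obtain ⟨p, hp, hv, hb⟩ := key
  have h3 := hp.three_le_length
  set n := p.length with hn
  have hpn : p.getVert n = a := by simp [hn]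
  have hinj : ∀ i < n, ∀ j < n, p.getVert i = p.getVert j → i = j := by
    intro i hi j hj hij
    apply hp.getVert_injOn' _ _ hij
    · simp; omega
    · simp; omega
  have hadj : ∀ i, H.Adj (p.getVert (i % n)) (p.getVert ((i + 1) % n)) := by
    intro i
    have hi : i % n < n := Nat.mod_lt _ (by omega)
    have := p.adj_getVert_succ hi
    rw [Nat.add_mod, Nat.mod_eq_of_lt (show 1 < n by omega)]
    by_cases h : i % n + 1 < n
    · rwa [Nat.mod_eq_of_lt h]
    · have hh : i % n + 1 = n := by omega
      rw [hh, Nat.mod_self, SimpleGraph.Walk.getVert_zero]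
      rw [hh, hpn] at this
      exact this
  refine ⟨n, fun i => p.getVert (i % n), ⟨h3, ?_, ?_, hadj, ?_, ?_, ?_⟩, by simp, ?_⟩
  · intro i; simp
  · intro i hi j hj hij
    simp only [Nat.mod_eq_of_lt hi, Nat.mod_eq_of_lt hj] at hij
    exact hinj i hi j hj hij
  · intro i v hiv
    have hne : p.getVert (i % n) ≠ p.getVert ((i + 2) % n) := by
      intro h
      have := hinj _ (Nat.mod_lt _ (by omega)) _ (Nat.mod_lt _ (by omega)) h
      rw [Nat.add_mod, Nat.mod_eq_of_lt (show 2 < n by omega)] at this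
      have hi : i % n < n := Nat.mod_lt _ (by omega)
      generalize i % n = r at *
      by_cases h : r + 2 < n
      · rw [Nat.mod_eq_of_lt h] at this; omega
      · rw [Nat.mod_eq_sub_mod (by omega), Nat.mod_eq_of_lt (by omega)] at this; omega
    have hsub : ({p.getVert (i % n), p.getVert ((i + 2) % n)} : Set V) ⊆
        H.neighborSet (p.getVert ((i + 1) % n)) := by
      rintro v (rfl | rfl)
      · exact (hadj i).symm
      · exact hadj (i + 1)
    have := Set.eq_of_subset_of_ncard_le hsub (by rw [h2, Set.ncard_pair hne])
    have hb : v ∈ ({p.getVert (i % n), p.getVert ((i + 2) % n)} : Set V) := by rw [this]; exact hiv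
    exact hb
  · intro v hvK
    rw [← hv, SimpleGraph.Walk.mem_verts_toSubgraph,
      SimpleGraph.Walk.mem_support_iff_exists_getVert] at hvK
    obtain ⟨i, rfl, hi⟩ := hvK
    by_cases h : i < n
    · exact ⟨i, h, by simp [Nat.mod_eq_of_lt h]⟩
    · have : i = n := by omega
      exact ⟨0, by omega, by simp [this, hpn]⟩
  · intro i
    rw [← hv, SimpleGraph.Walk.mem_verts_toSubgraph]
    exact SimpleGraph.Walk.getVert_mem_support _ _
  · simp only [Nat.mod_eq_of_lt (show 1 < n by omega), hb]

section aux
variable {V : Type*} {G : SimpleGraph V} {M : G.Subgraph}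

lemma minus_adj {v w : V} : (MinusM G M).Adj v w ↔ G.Adj v w ∧ ¬ M.Adj v w := by
  simp [MinusM]

lemma minus_edge {e : Sym2 V} :
    e ∈ (MinusM G M).edgeSet ↔ e ∈ G.edgeSet ∧ e ∉ M.edgeSet := by
  induction e with
  | _ a b => exact minus_adj

lemma valid_mem {d : Sym2 V → ℕ} (hd : IsValidColoring G M d) {e : Sym2 V} (he : e ∈ G.edgeSet)
    (h : d e ≠ 0) : e ∈ (MinusM G M).edgeSet :=
  minus_edge.2 ⟨he, fun h' => h (hd.2.1 e h')⟩

lemma onComp_of_mem {K : (MinusM G M).ConnectedComponent} {e : Sym2 V} {v : V}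
    (he : e ∈ (MinusM G M).edgeSet) (hv : v ∈ e) (hK : v ∈ K.supp) : EdgeOnComp G M K e := by
  refine ⟨he, fun w hw => ?_⟩
  by_cases hvw : v = w
  · exact hvw ▸ hK
  have : e = s(v, w) := (Sym2.mem_and_mem_iff hvw).1 ⟨hv, hw⟩
  rw [this] at he
  have he : (MinusM G M).Adj v w := he
  rw [SimpleGraph.ConnectedComponent.mem_supp_iff] at hK ⊢
  rw [← hK]
  exact SimpleGraph.ConnectedComponent.sound he.reachable.symm

lemma valid_col {d : Sym2 V → ℕ} (hd : IsValidColoring G M d)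
    {K : (MinusM G M).ConnectedComponent} {e : Sym2 V} (he : EdgeOnComp G M K e) :
    d e = 1 ∨ d e = 2 ∨ d e = 3 := by
  by_cases h : Even K.supp.ncard
  · have := (hd.2.2 K).1 h e he; omega
  · exact ((hd.2.2 K).2 h).1 e he

lemma valid_odd {d : Sym2 V → ℕ} (hd : IsValidColoring G M d)
    {K : (MinusM G M).ConnectedComponent} {e : Sym2 V} (he : EdgeOnComp G M K e) (h3 : d e = 3) :
    ¬ Even K.supp.ncard := by
  intro h
  have := (hd.2.2 K).1 h e he; omega

lemma valid_unique {d : Sym2 V → ℕ} (hd : IsValidColoring G M d)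
    {K : (MinusM G M).ConnectedComponent} {e f : Sym2 V} (he : EdgeOnComp G M K e) (h3 : d e = 3)
    (hf : EdgeOnComp G M K f) (h3' : d f = 3) : e = f :=
  ((hd.2.2 K).2 (valid_odd hd he h3)).2.unique ⟨he, h3⟩ ⟨hf, h3'⟩

variable {K : (MinusM G M).ConnectedComponent} {n : ℕ} {F : ℕ → V}

lemma Cyc.onComp (h : Cyc (MinusM G M) K n F) (j : ℕ) : EdgeOnComp G M K s(F j, F (j + 1)) :=
  onComp_of_mem (v := F j) (h.adj j) (by simp) (h.mem j)

lemma Cyc.edge_eq (h : Cyc (MinusM G M) K n F) {e : Sym2 V} (he : EdgeOnComp G M K e) :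
    ∃ j < n, e = s(F j, F (j + 1)) := by
  obtain ⟨he, hv⟩ := he
  have h3 := h.three
  induction e with
  | _ a b =>
    have key : ∀ i, ∃ j < n, s(F i, F (i + 1)) = s(F j, F (j + 1)) := by
      intro i
      induction i with
      | zero => exact ⟨0, by omega, rfl⟩
      | succ i ih =>
        obtain ⟨j, hj, e⟩ := h.surj (F (i + 1)) (h.mem _)
        refine ⟨j, hj, ?_⟩
        obtain ⟨k, hk, e'⟩ := h.surj (F (i + 2)) (h.mem _)
        have hji : F (i + 1) = F j := e.symm
        -- rewrite by periodicity
        have : ∀ a b, F a = F b → F (a + 1) = F (b + 1) := by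
          have main : ∀ a, ∃ r < n, F a = F r ∧ F (a + 1) = F (r + 1) := by
            intro a
            induction a with
            | zero => exact ⟨0, by omega, rfl, rfl⟩
            | succ a iha =>
              obtain ⟨r, hr, h1, h2⟩ := iha
              have q : ∀ r, F (a + 1) = F (r + 1) → F a = F r → F (a + 2) = F (r + 2) := by
                intro r h2 h1
                have ad := h.adj (a + 1)
                rw [h2] at ad
                rcases h.nb r _ ad with h' | h'
                · exfalso
                  rw [← h1] at h'
                  have i1 := (h.shift a).inj 0 (by omega) 2 (by omega)
                  simp only [zero_add] at i1
                  rw [add_comm 2 a] at i1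
                  have := i1 h'.symm
                  omega
                · exact h'
              have q' := q r h2 h1
              by_cases hrn : r + 1 < n
              · exact ⟨r + 1, hrn, h2, q'⟩
              · have hr' : r + 1 = 0 + n := by omega
                refine ⟨0, by omega, ?_, ?_⟩
                · rw [h2, hr', h.per]
                · rw [q']
                  have := h.per 1
                  rw [← this]; congr 1; omega
          intro a b hab
          obtain ⟨r, hr, h1, h2⟩ := main a
          obtain ⟨r', hr', h1', h2'⟩ := main b
          have := h.inj r hr r' hr' (by rw [← h1, ← h1', hab])
          rw [h2, h2', this]
        rw [hji, this _ _ hji]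
    obtain ⟨i, hi, rfl⟩ := h.surj a (hv a (by simp))
    have he : (MinusM G M).Adj (F i) b := he
    have e : F i = F (i + n - 1 + 1) := by
      rw [← h.per i]; congr 1; omega
    rw [e] at he ⊢
    rcases h.nb _ _ he with rfl | rfl
    · rw [Sym2.eq_swap]; exact key _
    · exact key _

lemma Cyc.mem_edge (h : Cyc (MinusM G M) K n F) {j : ℕ} (hj : j < n) {v : V}
    (hv : v ∈ s(F j, F (j + 1))) :
    ∃ a < n, v = F a ∧ (a = j ∨ a = j + 1 ∨ (j + 1 = n ∧ a = 0)) := by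
  rw [Sym2.mem_iff] at hv
  rcases hv with rfl | rfl
  · exact ⟨j, hj, rfl, by simp⟩
  · by_cases h' : j + 1 < n
    · exact ⟨j + 1, h', rfl, by simp⟩
    · refine ⟨0, by omega, ?_, by omega⟩
      rw [← h.per 0]; congr 1; omega

lemma Cyc.share (h : Cyc (MinusM G M) K n F) {j k : ℕ} (hj : j < n) (hk : k < n) {v : V}
    (hv : v ∈ s(F j, F (j + 1))) (hv' : v ∈ s(F k, F (k + 1))) :
    j = k ∨ j + 1 = k ∨ k + 1 = j ∨ (j = 0 ∧ k + 1 = n) ∨ (k = 0 ∧ j + 1 = n) := by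
  obtain ⟨a, ha, e, h1⟩ := h.mem_edge hj hv
  obtain ⟨b, hb, e', h2⟩ := h.mem_edge hk hv'
  have := h.inj a ha b hb (by rw [← e, ← e'])
  omega

lemma Cyc.edge_inj (h : Cyc (MinusM G M) K n F) {j k : ℕ} (hj : j < n) (hk : k < n)
    (he : s(F j, F (j + 1)) = s(F k, F (k + 1))) : j = k := by
  have h3 := h.three
  obtain ⟨a, ha, e, h1⟩ := h.mem_edge hk (v := F j) (by rw [← he]; simp)
  obtain ⟨b, hb, e', h2⟩ := h.mem_edge hj (v := F k) (by rw [he]; simp)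
  have := h.inj _ hj a ha e
  have := h.inj _ hk b hb e'
  omega

lemma Cyc.odd (h : Cyc (MinusM G M) K n F) {d : Sym2 V → ℕ} (hd : IsValidColoring G M d)
    (h0 : d s(F 0, F 1) = 3) : Odd n := by
  rw [← h.ncard, ← Nat.not_even_iff_odd]
  exact valid_odd hd (h.onComp 0) h0

lemma Cyc.colors (h : Cyc (MinusM G M) K n F) {d : Sym2 V → ℕ} (hd : IsValidColoring G M d)
    (h0 : d s(F 0, F 1) = 3) (h1 : d s(F 1, F 2) = 2) (j : ℕ) (hj : j + 1 < n) :
    d s(F (j + 1), F (j + 2)) = if j % 2 = 0 then 2 else 1 := by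
  have h3 := h.three
  induction j with
  | zero => simpa using h1
  | succ j ih =>
    have ih := ih (by omega)
    have c1 := valid_col hd (h.onComp (j + 2))
    have ne3 : d s(F (j + 2), F (j + 3)) ≠ 3 := by
      intro h'
      have := h.edge_inj (j := j + 2) (k := 0) hj (by omega)
        (valid_unique hd (h.onComp (j + 2)) h' (h.onComp 0) h0)
      omega
    have ne := hd.1.2 s(F (j + 1), F (j + 2)) s(F (j + 2), F (j + 3))
      (minus_edge.1 (h.onComp (j + 1)).1).1 (minus_edge.1 (h.onComp (j + 2)).1).1
      (fun h' => by
        have := h.edge_inj (j := j + 1) (k := j + 2) (by omega) hj h'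
        omega) ⟨F (j + 2), by simp, by simp⟩
    rw [ih] at ne
    change d s(F (j + 2), F (j + 3)) = _
    change d s(F (j + 2), F (j + 3)) = _ ∨ d s(F (j + 2), F (j + 3)) = _ ∨
      d s(F (j + 2), F (j + 3)) = _ at c1
    split_ifs at * <;> omega

lemma Cyc.out_iff (h : Cyc (MinusM G M) K n F) {d : Sym2 V → ℕ} (hd : IsValidColoring G M d)
    (h0 : d s(F 0, F 1) = 3) {x : V} (hx : x ∈ K.supp) :
    OutS G d x ↔ x = F 0 ∨ x = F 1 := by
  constructor
  · rintro ⟨e, he, e3, hxe⟩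
    have he := onComp_of_mem (valid_mem hd he (by omega)) hxe hx
    have := valid_unique hd he e3 (h.onComp 0) h0
    rw [this] at hxe
    simpa using hxe
  · intro hx
    exact ⟨s(F 0, F 1), (minus_edge.1 (h.onComp 0).1).1, h0, by simpa using hx⟩

lemma Cyc.in_iff (h : Cyc (MinusM G M) K n F) (h4 : 4 ≤ n) {d : Sym2 V → ℕ}
    (hd : IsValidColoring G M d)
    (h0 : d s(F 0, F 1) = 3) (h1 : d s(F 1, F 2) = 2) {y : V} (hy : y ∈ K.supp) :
    InS G d y ↔ y = F 2 ∨ y = F 3 := by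
  constructor
  · rintro ⟨e₁, m1, e₂, m2, e₃, m3, c1, c2, c3, hy1, ⟨v, v1, v2⟩, ⟨w, w2, w3⟩⟩
    have k1 := onComp_of_mem (valid_mem hd m1 (by omega)) hy1 hy
    have k2 := onComp_of_mem (valid_mem hd m2 (by omega)) v2 (k1.2 _ v1)
    have k3 := onComp_of_mem (valid_mem hd m3 (by omega)) w3 (k2.2 _ w2)
    have := valid_unique hd k3 c3 (h.onComp 0) h0
    subst this
    obtain ⟨j1, hj1, rfl⟩ := h.edge_eq k1
    obtain ⟨j2, hj2, rfl⟩ := h.edge_eq k2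
    have s1 := h.share hj1 hj2 v1 v2
    have s2 := h.share hj2 (show 0 < n by omega) w2 w3
    obtain ⟨k, hk⟩ := h.odd hd h0
    have hj1' : j1 ≠ 0 := by rintro rfl; simp only [zero_add] at c1; omega
    have hj2' : j2 ≠ 0 := by rintro rfl; simp only [zero_add] at c2; omega
    obtain ⟨i1, rfl⟩ := Nat.exists_eq_succ_of_ne_zero hj1'
    obtain ⟨i2, rfl⟩ := Nat.exists_eq_succ_of_ne_zero hj2'
    have q1 := h.colors hd h0 h1 i1 hj1
    have q2 := h.colors hd h0 h1 i2 hj2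
    have q1' : d s(F (i1 + 1), F (i1 + 2)) = 1 := c1
    have q2' : d s(F (i2 + 1), F (i2 + 2)) = 2 := c2
    rw [q1'] at q1
    rw [q2'] at q2
    have : i1 = 1 := by
      split_ifs at q1 q2 <;> omega
    subst this
    simpa using hy1
  · intro hy
    have c2 := h.colors hd h0 h1 1 (by omega)
    refine ⟨s(F 2, F 3), (minus_edge.1 (h.onComp 2).1).1, s(F 1, F 2),
      (minus_edge.1 (h.onComp 1).1).1, s(F 0, F 1), (minus_edge.1 (h.onComp 0).1).1,
      by simpa using c2, h1, h0, by simpa using hy, ⟨F 2, by simp, by simp⟩, ⟨F 1, by simp, by simp⟩⟩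

lemma Cyc.recolor (h : Cyc (MinusM G M) K n F) (hn : Odd n) {c : Sym2 V → ℕ}
    (hc : IsValidColoring G M c) :
    ∃ d, IsValidColoring G M d ∧ d s(F 0, F 1) = 3 ∧ d s(F 1, F 2) = 2 ∧
      ∀ e, ¬ EdgeOnComp G M K e → d e = c e := by
  classical
  have h3 := h.three
  let col : ℕ → ℕ := fun j => if j = 0 then 3 else if j % 2 = 1 then 2 else 1
  let d : Sym2 V → ℕ := fun e =>
    if he : ∃ j < n, e = s(F j, F (j + 1)) then col he.choose else c e
  have hdE : ∀ j < n, d s(F j, F (j + 1)) = col j := by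
    intro j hj
    have he : ∃ j' < n, s(F j, F (j + 1)) = s(F j', F (j' + 1)) := ⟨j, hj, rfl⟩
    have := h.edge_inj hj he.choose_spec.1 he.choose_spec.2
    simp only [d, dif_pos he]
    rw [← this]
  have hdc : ∀ e, ¬ EdgeOnComp G M K e → d e = c e := by
    intro e he
    have : ¬ ∃ j < n, e = s(F j, F (j + 1)) := by
      rintro ⟨j, _, rfl⟩
      exact he (h.onComp j)
    simp only [d, dif_neg this]
  have colr : ∀ j, col j = 1 ∨ col j = 2 ∨ col j = 3 := by
    intro j
    simp only [col]
    split_ifs <;> simp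
  have hMn : ∀ e ∈ M.edgeSet, ¬ EdgeOnComp G M K e := fun e he he' => (minus_edge.1 he'.1).2 he
  have hM0 : ∀ e ∈ M.edgeSet, d e = 0 := fun e he => by
    rw [hdc e (hMn e he)]; exact hc.2.1 e he
  have hmix : ∀ e f, f ∈ G.edgeSet → EdgeOnComp G M K e → ¬ EdgeOnComp G M K f →
      (∃ v, v ∈ e ∧ v ∈ f) → d e ≠ d f := by
    rintro e f hf he hnf ⟨v, ve, vf⟩
    have hfM : f ∈ M.edgeSet := by
      by_contra hfM
      exact hnf (onComp_of_mem (minus_edge.2 ⟨hf, hfM⟩) vf (he.2 v ve))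
    rw [hM0 f hfM]
    obtain ⟨j, hj, rfl⟩ := h.edge_eq he
    rw [hdE j hj]
    have := colr j
    omega
  refine ⟨d, ⟨⟨?_, ?_⟩, hM0, ?_⟩, ?_, ?_, hdc⟩
  · intro e he
    by_cases hK : EdgeOnComp G M K e
    · obtain ⟨j, hj, rfl⟩ := h.edge_eq hK
      rw [hdE j hj]
      have := colr j
      omega
    · rw [hdc e hK]; exact hc.1.1 e he
  · rintro e f he hf hef hs
    by_cases hK : EdgeOnComp G M K e <;> by_cases hK' : EdgeOnComp G M K f
    · obtain ⟨j, hj, rfl⟩ := h.edge_eq hK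
      obtain ⟨k, hk, rfl⟩ := h.edge_eq hK'
      obtain ⟨v, v1, v2⟩ := hs
      have := h.share hj hk v1 v2
      rw [hdE j hj, hdE k hk]
      have hjk : j ≠ k := by rintro rfl; exact hef rfl
      obtain ⟨q, hq⟩ := hn
      simp only [col]
      split_ifs <;> omega
    · exact hmix e f hf hK hK' hs
    · obtain ⟨v, v1, v2⟩ := hs
      exact (hmix f e he hK' hK ⟨v, v2, v1⟩).symm
    · rw [hdc e hK, hdc f hK']
      exact hc.1.2 e f he hf hef hs
  · intro K'
    by_cases hKK : K' = K
    · subst hKK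
      rw [h.ncard]
      refine ⟨fun h' => absurd h' (Nat.not_even_iff_odd.2 hn), fun _ => ⟨?_, ?_⟩⟩
      · intro e he
        obtain ⟨j, hj, rfl⟩ := h.edge_eq he
        rw [hdE j hj]; exact colr j
      · refine ⟨s(F 0, F 1), ⟨h.onComp 0, ?_⟩, ?_⟩
        · have := hdE 0 (by omega)
          simpa [col] using this
        · rintro e ⟨he, he3⟩
          obtain ⟨j, hj, rfl⟩ := h.edge_eq he
          rw [hdE j hj] at he3
          have : j = 0 := by
            by_contra hj0
            simp only [col] at he3
            split_ifs at he3 <;> omega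
          subst this
          rfl
    · have hno : ∀ e, EdgeOnComp G M K' e → d e = c e := by
        intro e he
        apply hdc
        intro he'
        apply hKK
        induction e with
        | _ a b =>
          have h1 := he.2 a (by simp)
          have h2 := he'.2 a (by simp)
          rw [SimpleGraph.ConnectedComponent.mem_supp_iff] at h1 h2
          rw [← h1, h2]
      obtain ⟨p1, p2⟩ := hc.2.2 K'
      refine ⟨fun ev e he => by rw [hno e he]; exact p1 ev e he, fun od => ⟨fun e he => by
        rw [hno e he]; exact (p2 od).1 e he, ?_⟩⟩
      obtain ⟨e, ⟨he, he3⟩, hu⟩ := (p2 od).2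
      refine ⟨e, ⟨he, by rw [hno e he]; exact he3⟩, ?_⟩
      rintro f ⟨hf, hf3⟩
      exact hu f ⟨hf, by rw [← hno f hf]; exact hf3⟩
  · have := hdE 0 (by omega)
    simpa [col] using this
  · have := hdE 1 (by omega)
    simpa [col] using this

lemma out_off {c d : Sym2 V → ℕ} (hdc : ∀ e, ¬ EdgeOnComp G M K e → d e = c e) {x : V}
    (hx : x ∉ K.supp) : OutS G d x ↔ OutS G c x := by
  constructor
  · rintro ⟨e, he, h3, hxe⟩
    exact ⟨e, he, by rw [← hdc e (fun h => hx (h.2 x hxe))]; exact h3, hxe⟩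
  · rintro ⟨e, he, h3, hxe⟩
    exact ⟨e, he, by rw [hdc e (fun h => hx (h.2 x hxe))]; exact h3, hxe⟩

lemma in_off' {c d : Sym2 V → ℕ} (hd : IsValidColoring G M d)
    (hdc : ∀ e, ¬ EdgeOnComp G M K e → d e = c e) {y : V}
    (hx : y ∉ K.supp) : InS G d y → InS G c y := by
  rintro ⟨e₁, m1, e₂, m2, e₃, m3, c1, c2, c3, hy1, ⟨v, v1, v2⟩, ⟨w, w2, w3⟩⟩
  have hy : y ∈ ((MinusM G M).connectedComponentMk y).supp := by simp
  have k1 := onComp_of_mem (valid_mem hd m1 (by omega)) hy1 hy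
  have k2 := onComp_of_mem (valid_mem hd m2 (by omega)) v2 (k1.2 _ v1)
  have k3 := onComp_of_mem (valid_mem hd m3 (by omega)) w3 (k2.2 _ w2)
  have ne : ∀ v e, EdgeOnComp G M ((MinusM G M).connectedComponentMk y) e → v ∈ e →
      ¬ EdgeOnComp G M K e := by
    intro v e he hv he'
    apply hx
    have h1 := he.2 v hv
    have h2 := he'.2 v hv
    rw [SimpleGraph.ConnectedComponent.mem_supp_iff] at h1 h2 ⊢
    rw [← h1, h2]
  exact ⟨e₁, m1, e₂, m2, e₃, m3, by rw [← hdc _ (ne _ _ k1 v1), c1],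
    by rw [← hdc _ (ne _ _ k2 v2), c2], by rw [← hdc _ (ne _ _ k3 w3), c3], hy1,
    ⟨v, v1, v2⟩, ⟨w, w2, w3⟩⟩

lemma in_off {c d : Sym2 V → ℕ} (hd : IsValidColoring G M d) (hc : IsValidColoring G M c)
    (hdc : ∀ e, ¬ EdgeOnComp G M K e → d e = c e) {y : V}
    (hx : y ∉ K.supp) : InS G d y ↔ InS G c y :=
  ⟨in_off' hd hdc hx, in_off' hc (fun e he => (hdc e he).symm) hx⟩

lemma exists_std [Finite V] (h2 : ∀ v, ((MinusM G M).neighborSet v).ncard = 2)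
    {d : Sym2 V → ℕ} (hd : IsValidColoring G M d) {y : V} (hy : InS G d y) (hK : y ∈ K.supp) :
    ∃ n F, Cyc (MinusM G M) K n F ∧ d s(F 0, F 1) = 3 ∧ d s(F 1, F 2) = 2 := by
  obtain ⟨e₁, m1, e₂, m2, e₃, m3, c1, c2, c3, hy1, ⟨v, v1, v2⟩, ⟨w, w2, w3⟩⟩ := hy
  have k1 := onComp_of_mem (valid_mem hd m1 (by omega)) hy1 hK
  have k2 := onComp_of_mem (valid_mem hd m2 (by omega)) v2 (k1.2 _ v1)
  have k3 := onComp_of_mem (valid_mem hd m3 (by omega)) w3 (k2.2 _ w2)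
  obtain ⟨a, rfl⟩ := Sym2.mem_iff_exists.1 w3
  obtain ⟨b, rfl⟩ := Sym2.mem_iff_exists.1 w2
  have ha : (MinusM G M).Adj w a := k3.1
  have hb : (MinusM G M).Adj w b := k2.1
  obtain ⟨n, F, hF, f0, f1⟩ := exists_cyc _ h2 K a w (k3.2 a (by simp)) ha.symm
  subst f0 f1
  refine ⟨n, F, hF, by rw [Sym2.eq_swap]; exact c3, ?_⟩
  rcases hF.nb 0 b hb with rfl | rfl
  · omega
  · exact c2

end aux

section count
variable {V : Type*} {G : SimpleGraph V} {M : G.Subgraph}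

lemma no_triangle (hgirth : 4 ≤ G.egirth) {a b c : V} (h1 : G.Adj a b) (h2 : G.Adj b c)
    (h3 : G.Adj c a) : False := by
  rw [SimpleGraph.le_egirth] at hgirth
  have := hgirth a (.cons h1 (.cons h2 (.cons h3 .nil))) (by
    rw [SimpleGraph.Walk.cons_isCycle_iff]
    simp [h1.ne, h2.ne, h3.ne, h1.ne', h2.ne', h3.ne'])
  norm_num at this

lemma Cyc.four {K : (MinusM G M).ConnectedComponent} {n : ℕ} {F : ℕ → V}
    (hgirth : 4 ≤ G.egirth) (h : Cyc (MinusM G M) K n F) : 4 ≤ n := by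
  have h3 := h.three
  by_contra hn
  have : n = 3 := by omega
  subst this
  have a := h.adj 2
  rw [show 2 + 1 = 0 + 3 by rfl, h.per] at a
  exact no_triangle hgirth (minus_adj.1 (h.adj 0)).1 (minus_adj.1 (h.adj 1)).1 (minus_adj.1 a).1

lemma in_out_disj [Finite V] (hgirth : 4 ≤ G.egirth)
    (h2 : ∀ v, ((MinusM G M).neighborSet v).ncard = 2)
    {d : Sym2 V → ℕ} (hd : IsValidColoring G M d) {y : V} (hy : InS G d y) (ho : OutS G d y) :
    False := by
  have hK : y ∈ ((MinusM G M).connectedComponentMk y).supp := by simp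
  obtain ⟨n, F, hF, h0, h1⟩ := exists_std h2 hd hy hK
  have h4 := hF.four hgirth
  rw [hF.in_iff h4 hd h0 h1 hK] at hy
  rw [hF.out_iff hd h0 hK] at ho
  have i02 := hF.inj 0 (by omega) 2 (by omega)
  have i03 := hF.inj 0 (by omega) 3 (by omega)
  have i12 := hF.inj 1 (by omega) 2 (by omega)
  have i13 := hF.inj 1 (by omega) 3 (by omega)
  rcases hy with rfl | rfl <;> rcases ho with ho | ho <;> simp_all

lemma count_gen [Finite V] (hgirth : 4 ≤ G.egirth)
    (h2 : ∀ v, ((MinusM G M).neighborSet v).ncard = 2) {m : V → V}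
    (hm : ∀ v w, M.Adj v w ↔ m v = w)
    {d : Sym2 V → ℕ} (hd : IsValidColoring G M d) (R : Sym2 V → Prop) :
    {e | e ∈ M.edgeSet ∧ ¬ CompletelyBlocked G d e ∧ R e}.ncard =
      {x | (OutS G d x ∧ InS G d (m x)) ∧ R s(x, m x)}.ncard := by
  have hub : ∀ x y, M.Adj x y → (Unblocked G d x y ↔ OutS G d x ∧ InS G d y) := fun x y hxy =>
    unblocked_iff G d hd.1.1 x y hxy.adj_sub (hd.2.1 _ hxy)
  have : {e | e ∈ M.edgeSet ∧ ¬ CompletelyBlocked G d e ∧ R e} =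
      (fun x => s(x, m x)) '' {x | (OutS G d x ∧ InS G d (m x)) ∧ R s(x, m x)} := by
    ext e
    simp only [Set.mem_setOf_eq, Set.mem_image, CompletelyBlocked]
    push Not
    constructor
    · rintro ⟨he, ⟨x, y, rfl, hu⟩, hR⟩
      have he : M.Adj x y := he
      have := (hub x y he).1 hu
      have e := (hm x y).1 he
      subst e
      exact ⟨x, ⟨this, hR⟩, rfl⟩
    · rintro ⟨x, ⟨hx, hR⟩, rfl⟩
      have ha : M.Adj x (m x) := (hm _ _).2 rfl
      exact ⟨ha, ⟨x, m x, rfl, (hub _ _ ha).2 hx⟩, hR⟩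
  rw [this, Set.InjOn.ncard_image]
  rintro x ⟨⟨hx, hx'⟩, _⟩ y ⟨⟨hy, hy'⟩, _⟩ hxy
  simp only [Sym2.eq_iff] at hxy
  rcases hxy with hxy | hxy
  · exact hxy.1
  · exfalso
    rw [← hxy.1] at hy'
    exact in_out_disj hgirth h2 hd hy' hx

open Classical in
lemma phi_psi [Fintype V] (hgirth : 4 ≤ G.egirth)
    (h2 : ∀ v, ((MinusM G M).neighborSet v).ncard = 2) {m : V → V}
    (hm : ∀ v w, M.Adj v w ↔ m v = w)
    {d : Sym2 V → ℕ} (hd : IsValidColoring G M d) :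
    phi G M d + psi G M d = ∑ x, if OutS G d x ∧ InS G d (m x) then
      (if (MinusM G M).Reachable x (m x) then 2 else 1) else 0 := by
  have e1 := count_gen hgirth h2 hm hd (fun _ => True)
  have e2 := count_gen hgirth h2 hm hd
    (fun e => ∀ x y, e = s(x, y) → (MinusM G M).Reachable x y)
  have hR : ∀ x, (∀ x' y', s(x, m x) = s(x', y') → (MinusM G M).Reachable x' y') ↔
      (MinusM G M).Reachable x (m x) := by
    intro x
    constructor
    · intro h; exact h _ _ rfl
    · intro h x' y' e
      rw [Sym2.eq_iff] at e
      rcases e with ⟨rfl, rfl⟩ | ⟨rfl, rfl⟩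
      · exact h
      · exact h.symm
  simp only [and_true] at e1
  simp only [hR] at e2
  rw [phi, psi, e1, e2, Set.ncard_eq_toFinset_card', Set.ncard_eq_toFinset_card']
  simp only [Set.toFinset_setOf, Finset.card_filter]
  rw [← Finset.sum_add_distrib]
  apply Finset.sum_congr rfl
  intro x _
  split_ifs <;> simp_all

open Classical in
lemma weight [Fintype V] (hgirth : 4 ≤ G.egirth) {m : V → V}
    (hm : ∀ v w, M.Adj v w ↔ m v = w) {K : (MinusM G M).ConnectedComponent} {n : ℕ} {F : ℕ → V}
    (h : Cyc (MinusM G M) K n F) {c d : Sym2 V → ℕ}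
    (hd : IsValidColoring G M d) (hc : IsValidColoring G M c)
    (hdc : ∀ e, ¬ EdgeOnComp G M K e → d e = c e)
    (h0 : d s(F 0, F 1) = 3) (h1 : d s(F 1, F 2) = 2) :
    (∑ x, if OutS G d x ∧ InS G d (m x) then
      (if (MinusM G M).Reachable x (m x) then 2 else 1) else 0) =
    (∑ x, if x ∉ K.supp ∧ m x ∉ K.supp then (if OutS G c x ∧ InS G c (m x) then
      (if (MinusM G M).Reachable x (m x) then 2 else 1) else 0) else 0) +
    ((if m (F 0) ∉ K.supp ∧ InS G c (m (F 0)) then 1 else 0) +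
     (if m (F 1) ∉ K.supp ∧ InS G c (m (F 1)) then 1 else 0) +
     (if m (F 2) ∉ K.supp ∧ OutS G c (m (F 2)) then 1 else 0) +
     (if m (F 3) ∉ K.supp ∧ OutS G c (m (F 3)) then 1 else 0) +
     2 * (if m (F 0) = F 3 then 1 else 0)) := by
  have h4 := h.four hgirth
  have hmm : ∀ v, m (m v) = v := fun v => (hm _ _).1 ((hm v _).2 rfl).symm
  have adjm : ∀ v, G.Adj v (m v) := fun v => ((hm v _).2 rfl).adj_sub
  have g := fun j => (minus_adj.1 (h.adj j)).1
  have t02 : m (F 0) ≠ F 2 := by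
    intro e
    have := adjm (F 0)
    rw [e] at this
    exact no_triangle hgirth (g 0) (g 1) this.symm
  have t13 : m (F 1) ≠ F 3 := by
    intro e
    have := adjm (F 1)
    rw [e] at this
    exact no_triangle hgirth (g 1) (g 2) this.symm
  have t12 : m (F 1) ≠ F 2 := by
    intro e
    exact (minus_adj.1 (h.adj 1)).2 ((hm _ _).2 e)
  have i01 : F 0 ≠ F 1 := (g 0).ne
  have i23 : F 2 ≠ F 3 := (g 2).ne
  have reach : ∀ x ∈ K.supp, ((MinusM G M).Reachable x (m x) ↔ m x ∈ K.supp) := by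
    intro x hx
    rw [SimpleGraph.ConnectedComponent.mem_supp_iff] at hx ⊢
    rw [← hx, SimpleGraph.ConnectedComponent.eq]
    exact ⟨fun h => h.symm, fun h => h.symm⟩
  have reach' : ∀ x, m x ∈ K.supp → ((MinusM G M).Reachable x (m x) ↔ x ∈ K.supp) := by
    intro x hx
    rw [SimpleGraph.ConnectedComponent.mem_supp_iff] at hx ⊢
    rw [← hx, SimpleGraph.ConnectedComponent.eq]
  have pt : ∀ x, (if OutS G d x ∧ InS G d (m x) then
      (if (MinusM G M).Reachable x (m x) then 2 else 1) else 0) =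
      (if x ∉ K.supp ∧ m x ∉ K.supp then (if OutS G c x ∧ InS G c (m x) then
      (if (MinusM G M).Reachable x (m x) then 2 else 1) else 0) else 0) +
      ((if x = F 0 then (if m (F 0) ∉ K.supp ∧ InS G c (m (F 0)) then 1 else 0) else 0) +
     (if x = F 1 then (if m (F 1) ∉ K.supp ∧ InS G c (m (F 1)) then 1 else 0) else 0) +
     (if x = m (F 2) then (if m (F 2) ∉ K.supp ∧ OutS G c (m (F 2)) then 1 else 0) else 0) +
     (if x = m (F 3) then (if m (F 3) ∉ K.supp ∧ OutS G c (m (F 3)) then 1 else 0) else 0) +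
     (if x = F 0 then 2 * (if m (F 0) = F 3 then 1 else 0) else 0)) := by
    intro x
    have m0 := h.mem 0
    have m1 := h.mem 1
    have m2 := h.mem 2
    have m3 := h.mem 3
    have hx2 : x = m (F 2) ↔ m x = F 2 := ⟨fun e => by rw [e, hmm], fun e => by rw [← e, hmm]⟩
    have hx3 : x = m (F 3) ↔ m x = F 3 := ⟨fun e => by rw [e, hmm], fun e => by rw [← e, hmm]⟩
    by_cases hx : x ∈ K.supp <;> by_cases hmx : m x ∈ K.supp
    · rw [h.out_iff hd h0 hx, h.in_iff h4 hd h0 h1 hmx]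
      have hr := reach x hx
      clear reach reach' hdc hc hd
      grind
    · rw [h.out_iff hd h0 hx, in_off hd hc hdc hmx]
      have hr := reach x hx
      clear reach reach' hdc hc hd
      grind
    · rw [out_off hdc hx, h.in_iff h4 hd h0 h1 hmx]
      have hr := reach' x hmx
      clear reach reach' hdc hc hd
      grind
    · rw [out_off hdc hx, in_off hd hc hdc hmx]
      clear reach reach' hdc hc hd
      grind
  rw [Finset.sum_congr rfl (fun x _ => pt x)]
  simp only [Finset.sum_add_distrib, Finset.sum_ite_eq', Finset.mem_univ, if_true]

end count

/-- Let `G` be a finite cubic simple graph of girth at least 4 with perfect matching `M`, and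
let `c` be a valid 4-edge-coloring of `G` with respect to `M`.  If some cycle of `G - M` has
both an input and an output with respect to `c`, then there is a valid 4-edge-coloring `c*`
with `φ(c*) + ψ(c*) < φ(c) + ψ(c)`. -/
theorem exists_validColoring_phi_add_psi_lt
    {V : Type*} [Fintype V] [DecidableEq V] (G : SimpleGraph V) [DecidableRel G.Adj]
    (hcubic : ∀ v, G.degree v = 3) (hgirth : 4 ≤ G.egirth)
    (M : G.Subgraph) (hM : M.IsPerfectMatching)
    (c : Sym2 V → ℕ) (hc : IsValidColoring G M c)
    (K : (MinusM G M).ConnectedComponent)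
    (hin : HasInput G M c K) (hout : HasOutput G M c K) :
    ∃ c' : Sym2 V → ℕ, IsValidColoring G M c' ∧
      phi G M c' + psi G M c' < phi G M c + psi G M c := by

  classical
  -- the matching involution
  have hex : ∀ v, ∃ w, M.Adj v w ∧ ∀ w', M.Adj v w' → w' = w := fun v => by
    obtain ⟨w, hw, hu⟩ := hM.1 (hM.2 v)
    exact ⟨w, hw, hu⟩
  choose m hm1 hm2 using hex
  have hm : ∀ v w, M.Adj v w ↔ m v = w := fun v w =>
    ⟨fun h => (hm2 v w h).symm, fun h => h ▸ hm1 v⟩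
  have hmm : ∀ v, m (m v) = v := fun v => (hm _ _).1 ((hm v _).2 rfl).symm
  have h2 : ∀ v, ((MinusM G M).neighborSet v).ncard = 2 := by
    intro v
    have e : (MinusM G M).neighborSet v = (G.neighborSet v) \ {m v} := by
      ext w
      simp only [SimpleGraph.mem_neighborSet, minus_adj, Set.mem_sdiff, Set.mem_singleton_iff, hm]
      exact and_congr_right fun _ => not_congr eq_comm
    rw [e, Set.ncard_sdiff_singleton_of_mem (show m v ∈ G.neighborSet v from (hm1 v).adj_sub), Set.ncard_eq_toFinset_card']
    have := hcubic v
    rw [← SimpleGraph.card_neighborFinset_eq_degree] at this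
    have e2 : (G.neighborSet v).toFinset = G.neighborFinset v := rfl
    rw [e2, this]
  obtain ⟨x, y, hxy, hu, hyK⟩ := hin
  obtain ⟨x', y', hxy', hu', hxK'⟩ := hout
  have hxy : M.Adj x y := hxy
  have hxy' : M.Adj x' y' := hxy'
  rw [unblocked_iff G c hc.1.1 x y hxy.adj_sub (hc.2.1 _ hxy)] at hu
  rw [unblocked_iff G c hc.1.1 x' y' hxy'.adj_sub (hc.2.1 _ hxy')] at hu'
  obtain ⟨n, F, hF, f0, f1⟩ := exists_std h2 hc hu.2 hyK
  have h4 := hF.four hgirth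
  have hodd := hF.odd hc f0
  have hper := hF.per
  have adjm : ∀ v, G.Adj v (m v) := fun v => ((hm v _).2 rfl).adj_sub
  have g := fun j => (minus_adj.1 (hF.adj j)).1
  have t02 : m (F 0) ≠ F 2 := by
    intro e
    have := adjm (F 0)
    rw [e] at this
    exact no_triangle hgirth (g 0) (g 1) this.symm
  have t13 : m (F 1) ≠ F 3 := by
    intro e
    have := adjm (F 1)
    rw [e] at this
    exact no_triangle hgirth (g 1) (g 2) this.symm
  have t12 : m (F 1) ≠ F 2 := by
    intro e
    exact (minus_adj.1 (hF.adj 1)).2 ((hm _ _).2 e)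
  have hdis : ∀ v, ¬ (InS G c v ∧ OutS G c v) := fun v hv => in_out_disj hgirth h2 hc hv.1 hv.2
  let o : ℕ → ℕ := fun s => if m (F s) ∉ K.supp ∧ InS G c (m (F s)) then 1 else 0
  let i : ℕ → ℕ := fun s => if m (F s) ∉ K.supp ∧ OutS G c (m (F s)) then 1 else 0
  let χ : ℕ → ℕ := fun s => if m (F s) = F (s + 3) then 1 else 0
  have hch1 : 1 ≤ o 0 + o 1 ∨ χ 0 = 1 := by
    have e := (hm _ _).1 hxy'
    subst e
    have hx0 := (hF.out_iff hc f0 hxK').1 hu'.1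
    by_cases hK : m x' ∈ K.supp
    · right
      have hy := (hF.in_iff h4 hc f0 f1 hK).1 hu'.2
      have : m (F 0) = F 3 := by
        rcases hx0 with rfl | rfl <;> rcases hy with hy | hy
        · exact absurd hy t02
        · exact hy
        · exact absurd hy t12
        · exact absurd hy t13
      simp [χ, this]
    · left
      rcases hx0 with rfl | rfl
      · simp only [o]; rw [if_pos ⟨hK, hu'.2⟩]; omega
      · have e1 : o 1 = 1 := if_pos ⟨hK, hu'.2⟩
        omega
  have hch2 : 1 ≤ i 2 + i 3 ∨ χ 0 = 1 := by
    have e := (hm _ _).1 hxy.symm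
    subst e
    have hy0 := (hF.in_iff h4 hc f0 f1 hyK).1 hu.2
    by_cases hK : m y ∈ K.supp
    · right
      have hx := (hF.out_iff hc f0 hK).1 hu.1
      have : m (F 0) = F 3 := by
        rcases hx with hx | hx <;> rcases hy0 with rfl | rfl
        · exact absurd (by rw [← hx, hmm]) t02
        · rw [← hx, hmm]
        · exact absurd (by rw [← hx, hmm]) t12
        · exact absurd (by rw [← hx, hmm]) t13
      simp [χ, this]
    · left
      rcases hy0 with rfl | rfl
      · have e1 : i 2 = 1 := if_pos ⟨hK, hu.1⟩
        omega
      · have e1 : i 3 = 1 := if_pos ⟨hK, hu.1⟩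
        omega
  obtain ⟨s, hs⟩ := comb_core n hodd o i χ
    (fun s => by simp only [o, hper]) (fun s => by simp only [i, hper])
    (fun s => by simp only [χ, hper, add_right_comm s n 3])
    (by
      intro s
      have a := hdis (m (F s))
      have b : m (F s) = F (s + 3) → m (F s) ∈ K.supp := fun e => e ▸ hF.mem _
      simp only [o, i, χ]
      split_ifs <;> first | omega | (exfalso; tauto))
    (by
      intro s h
      have h : m (F s) = F (s + 3) := by
        by_contra hne
        simp [χ, hne] at h
      have h' : m (F (s + 3)) = F s := by rw [← h, hmm]
      have hne : F s ≠ F (s + 3 + 3) := by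
        intro he
        have hSh := hF.shift s
        have q := hSh.inj 0 (by omega)
        simp only [zero_add] at q
        obtain ⟨k, hk⟩ := hodd
        by_cases h6 : 6 < n
        · have := q 6 h6 (by rw [he]; congr 1; omega)
          omega
        · have : n = 5 := by omega
          subst this
          have p := hper (s + 1)
          have := q 1 (by omega) (by
            rw [he, add_comm 1 s, ← p])
          omega
      simp [o, i, χ, h', hne, hF.mem s, -SimpleGraph.ConnectedComponent.mem_supp_iff])
    hch1 hch2
  have hFs := hF.shift s
  obtain ⟨d, hd, d0, d1, hdc⟩ := hFs.recolor hodd hc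
  refine ⟨d, hd, ?_⟩
  rw [phi_psi hgirth h2 hm hd, phi_psi hgirth h2 hm hc,
    weight hgirth hm hFs hd hc hdc d0 d1, weight hgirth hm hF hc hc (fun _ _ => rfl) f0 f1]
  refine Nat.add_lt_add_left ?_ _
  simp only [o, i, χ, zero_add, add_comm s] at hs ⊢
  convert hs
end

section
/- Let G be a finite cubic simple graph of girth at least 4 with a perfect matching. Then there exists a proper 4-coloring c of the line graph L(G) (with colors 0,1,2,3) such that the tight-arc digraph D_c(L(G)) is acyclic and every directed path of D_c(L(G)) contains at most two vertices (edges of G) of color 3. -/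
open SimpleGraph

lemma min_config {ι S : Type*} [Fintype ι] [DecidableEq ι] [Nonempty S] (A : ι → S → ι → S → ℕ) :
    ∃ P : ι → S, ∀ K q,
      (∑ j ∈ Finset.univ.erase K, (A K (P K) j (P j) + A j (P j) K (P K))) + 2 * A K (P K) K (P K)
      ≤ (∑ j ∈ Finset.univ.erase K, (A K q j (P j) + A j (P j) K q)) + 2 * A K q K q := by
  classical
  let Φ : (ι → S) → ℕ := fun P => (∑ i, ∑ j, A i (P i) j (P j)) + ∑ i, A i (P i) i (P i)
  have key : ∀ (P : ι → S) (K : ι), Φ P =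
      ((∑ i ∈ Finset.univ.erase K, ∑ j ∈ Finset.univ.erase K, A i (P i) j (P j))
        + ∑ i ∈ Finset.univ.erase K, A i (P i) i (P i)) +
      ((∑ j ∈ Finset.univ.erase K, (A K (P K) j (P j) + A j (P j) K (P K)))
        + 2 * A K (P K) K (P K)) := by
    intro P K
    have e : ∀ g : ι → ℕ, ∑ i, g i = g K + ∑ i ∈ Finset.univ.erase K, g i := fun g =>
      (Finset.add_sum_erase _ _ (Finset.mem_univ K)).symm
    simp only [Φ]
    rw [e (fun i => ∑ j, A i (P i) j (P j)), e (fun i => A i (P i) i (P i)),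
      e (fun j => A K (P K) j (P j))]
    have : ∀ i, ∑ j, A i (P i) j (P j) = A i (P i) K (P K) +
      ∑ j ∈ Finset.univ.erase K, A i (P i) j (P j) := fun i => e _
    simp only [this, Finset.sum_add_distrib]
    ring
  have hne : Nonempty (ι → S) := inferInstance
  refine ⟨Function.argmin Φ, fun K q => ?_⟩
  set P := Function.argmin Φ
  have h1 : Φ P ≤ Φ (Function.update P K q) := Function.argmin_le Φ _
  rw [key P K, key (Function.update P K q) K] at h1
  have h2 : ∀ j ∈ Finset.univ.erase K, Function.update P K q j = P j := fun j hj =>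
    Function.update_of_ne (Finset.ne_of_mem_erase hj) _ _
  have e1 : (∑ i ∈ Finset.univ.erase K, ∑ j ∈ Finset.univ.erase K,
      A i (Function.update P K q i) j (Function.update P K q j)) =
      ∑ i ∈ Finset.univ.erase K, ∑ j ∈ Finset.univ.erase K, A i (P i) j (P j) :=
    Finset.sum_congr rfl fun i hi => Finset.sum_congr rfl fun j hj => by rw [h2 i hi, h2 j hj]
  have e2 : (∑ i ∈ Finset.univ.erase K, A i (Function.update P K q i) i (Function.update P K q i)) =
      ∑ i ∈ Finset.univ.erase K, A i (P i) i (P i) :=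
    Finset.sum_congr rfl fun i hi => by rw [h2 i hi]
  have e3 : (∑ j ∈ Finset.univ.erase K, (A K q j (Function.update P K q j)
      + A j (Function.update P K q j) K q)) =
      ∑ j ∈ Finset.univ.erase K, (A K q j (P j) + A j (P j) K q) :=
    Finset.sum_congr rfl fun i hi => by rw [h2 i hi]
  rw [e1, e2, Function.update_self, e3] at h1
  omega

lemma comb (n : ℕ) (hn : Odd n) (a o d : ℕ → ℕ) (pa : ∀ i, a (i + n) = a i)
    (hao : ∀ i, a i + o i ≤ 1) (hd1 : ∀ i, d i ≤ 1)
    (hd : ∀ i, d i = 1 → a (i+3) + o (i+3) = 0)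
    (hdd : ∀ i, d i = 1 → d (i+3) = 1 → False)
    (hf : ∀ i, a 0 + a 1 + o 2 + o 3 + 2 * d 0 ≤ a i + a (i+1) + o (i+2) + o (i+3) + 2 * d i)
    (hb : ∀ i, a 0 + a 1 + o 2 + o 3 + 2 * d 0 ≤ a (i+3) + a (i+2) + o (i+1) + o i + 2 * d i)
    (hout : 1 ≤ a 0 + a 1 + d 0) (hin : 1 ≤ o 2 + o 3 + d 0) : False := by
  have step : ∀ i, d i = 1 → d (i+1) = 1 := by
    intro i hi
    have := hd i hi
    have := hf (i+1); have := hb (i+1); have := hd1 (i+1)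
    have := hao (i+1); have := hao (i+2); have := hao (i+4)
    simp only [add_assoc, Nat.reduceAdd] at *
    omega
  have nod : ∀ i, d i = 0 := by
    intro i
    by_contra h
    have h1 : d i = 1 := by have := hd1 i; omega
    exact hdd i h1 (step _ (step _ (step _ h1)))
  have s2 : ∀ i, a i + a (i+1) = a (i+2) + a (i+3) := by
    intro i
    have := nod i; have := nod 0; have := hf i; have := hb i
    have := hao i; have := hao (i+1); have := hao (i+2); have := hao (i+3)
    omega
  have s0 : a 0 + a 1 = 1 := by
    have := nod 0; have := hf 0; have := hb 0; 
    have := hao 0; have := hao 1; have := hao 2; have := hao 3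
    simp only [zero_add] at *
    omega
  have se : ∀ k i, a i + a (i+1) = a (i+2*k) + a (i+2*k+1) := by
    intro k
    induction k with
    | zero => intro i; simp
    | succ k ih => intro i; rw [ih i, s2]; congr 1
  obtain ⟨k, rfl⟩ := hn
  have s1 : ∀ i, a i + a (i+1) = 1 := by
    intro i
    obtain ⟨j, rfl | rfl⟩ := Nat.even_or_odd' i
    · have := se j 0; simp at this; omega
    · have h1 := se (j+k+1) 0
      have h2 := pa (2*j+1); have h3 := pa (2*j+1+1)
      have e1 : 0 + 2*(j+k+1) = 2*j+1+(2*k+1) := by ring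
      have e2 : 0 + 2*(j+k+1) + 1= 2*j+1+1+(2*k+1) := by ring
      rw [e2, e1, h2, h3] at h1
      simp only [zero_add] at h1
      omega
  have t : ∀ k, a (2*k) = a 0 := by
    intro k
    induction k with
    | zero => rfl
    | succ k ih =>
      have := s1 (2*k); have := s1 (2*k+1)
      rw [show 2*(k+1) = 2*k+1+1 by ring]; omega
  have := pa 0
  have := s1 (2*k); have := t k
  simp only [zero_add] at *
  omega

lemma sum_ind_le_one {T W : Type*} [DecidableEq W] (s : Finset T) (g : T → W) (y : W)
    (hg : ∀ t ∈ s, ∀ t' ∈ s, g t = g t' → t = t') :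
    ∑ t ∈ s, (if y = g t then 1 else 0) ≤ 1 := by
  rw [← Finset.card_filter]
  rw [Finset.card_le_one]
  intro t ht t' ht'
  simp only [Finset.mem_filter] at ht ht'
  exact hg t ht.1 t' ht'.1 (ht.2.symm.trans ht'.2)

lemma stage1 {V ι : Type*} [Fintype ι] (n : ι → ℕ) (f : ι → ℤ → V) (m : V → V)
    (hodd : ∀ K, Odd (n K)) (h4 : ∀ K, 4 ≤ n K)
    (hf : ∀ K K' i j, f K i = f K' j ↔ K = K' ∧ (n K : ℤ) ∣ i - j)
    (minv : ∀ x, m (m x) = x) (h1 : ∀ K i, m (f K i) ≠ f K (i + 1))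
    (h2 : ∀ K i, m (f K i) ≠ f K (i + 2)) :
    ∃ P : ι → ℤ × ℤˣ, ∀ K K' K'' : ι, ∀ a b a' b' : ℤ,
      (a = 0 ∨ a = 1) → (b = 2 ∨ b = 3) → (a' = 0 ∨ a' = 1) → (b' = 2 ∨ b' = 3) →
      m (f K ((P K).1 + (P K).2 * a)) = f K' ((P K').1 + (P K').2 * b) →
      m (f K'' ((P K'').1 + (P K'').2 * a')) = f K ((P K).1 + (P K).2 * b') → False := by
  classical
  let pt : ι → ℤ × ℤˣ → ℤ → V := fun K p a => f K (p.1 + p.2 * a)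
  let I : V → V → ℕ := fun x y => if x = y then 1 else 0
  let A : ι → ℤ × ℤˣ → ι → ℤ × ℤˣ → ℕ := fun K p K' q =>
    I (m (pt K p 0)) (pt K' q 2) + I (m (pt K p 0)) (pt K' q 3) +
    I (m (pt K p 1)) (pt K' q 2) + I (m (pt K p 1)) (pt K' q 3)
  obtain ⟨P, hP⟩ := min_config A
  refine ⟨P, ?_⟩
  intro K K' K'' a b a' b' ha hb ha' hb' hKK hKK'
  have Isymm : ∀ x y, I (m x) y = I (m y) x := by
    intro x y
    simp only [I]
    congr 1
    apply propext
    constructor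
    · rintro rfl; exact minv x
    · rintro rfl; exact minv y
  let F : ℕ → V := fun j => f K ((P K).1 + (P K).2 * (j : ℤ))
  let al : V → ℕ := fun x => ∑ j ∈ Finset.univ.erase K,
    (I (m x) (pt j (P j) 2) + I (m x) (pt j (P j) 3))
  let om : V → ℕ := fun x => ∑ j ∈ Finset.univ.erase K,
    (I (m x) (pt j (P j) 0) + I (m x) (pt j (P j) 1))
  have usq : ∀ u : ℤˣ, u = 1 ∨ u = -1 := Int.units_eq_one_or
  have ptinj : ∀ j j' (p : ι → ℤ × ℤˣ) (b b' : ℤ), 0 ≤ b → b < 4 → 0 ≤ b' → b' < 4 →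
      pt j (p j) b = pt j' (p j') b' → j = j' ∧ b = b' := by
    intro j j' p b b' h0 h3 h0' h3' h
    obtain ⟨rfl, hd⟩ := (hf _ _ _ _).1 h
    refine ⟨rfl, ?_⟩
    have h4' : (4 : ℤ) ≤ n j := by exact_mod_cast h4 j
    have hd' : (n j : ℤ) ∣ b - b' := by
      rcases usq (p j).2 with e | e
      · rw [e] at hd; simpa using hd
      · rw [e] at hd
        obtain ⟨k, hk⟩ := hd
        refine ⟨-k, ?_⟩
        simp only [Units.val_neg, Units.val_one] at hk
        linarith
    have := Int.eq_zero_of_abs_lt_dvd hd' (by rw [abs_lt]; constructor <;> omega)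
    omega
  have hao : ∀ x, al x + om x ≤ 1 := by
    intro x
    have : al x + om x = ∑ t ∈ (Finset.univ.erase K) ×ˢ (Finset.range 4),
        (if m x = pt t.1 (P t.1) (t.2 : ℤ) then 1 else 0) := by
      rw [Finset.sum_product, ← Finset.sum_add_distrib]
      apply Finset.sum_congr rfl
      intro j _
      simp only [Finset.sum_range_succ, Finset.sum_range_zero, I]
      push_cast
      ring
    rw [this]
    apply sum_ind_le_one
    rintro ⟨j, b⟩ ht ⟨j', b'⟩ ht' h
    simp only [Finset.mem_product, Finset.mem_range] at ht ht'
    have := ptinj j j' P b b' (by omega) (by omega) (by omega) (by omega) h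
    ext
    · exact this.1
    · exact_mod_cast this.2
  have hin : ∀ x i, m x = f K i → al x + om x = 0 := by
    intro x i hx
    simp only [al, om]
    rw [← Finset.sum_add_distrib]
    apply Finset.sum_eq_zero
    intro j hj
    have hne : ∀ i', f K i ≠ f j i' := fun i' h => Finset.ne_of_mem_erase hj ((hf _ _ _ _).1 h).1.symm
    simp [I, hx, pt, hne]
  have g1 : ∀ i i', (i' = i + 1 ∨ i' = i + 2 ∨ i = i' + 1 ∨ i = i' + 2) →
      m (f K i) ≠ f K i' := by
    rintro i i' (rfl | rfl | rfl | rfl) h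
    · exact h1 _ _ h
    · exact h2 _ _ h
    · apply h1 K i'; rw [← h, minv]
    · apply h2 K i'; rw [← h, minv]
  have eA : ∀ q, A K q K q = I (m (pt K q 0)) (pt K q 3) := by
    intro q
    have z1 : m (pt K q 0) ≠ pt K q 2 := by
      apply g1; rcases usq q.2 with e | e <;> rw [e] <;> push_cast <;> omega
    have z2 : m (pt K q 1) ≠ pt K q 2 := by
      apply g1; rcases usq q.2 with e | e <;> rw [e] <;> push_cast <;> omega
    have z3 : m (pt K q 1) ≠ pt K q 3 := by
      apply g1; rcases usq q.2 with e | e <;> rw [e] <;> push_cast <;> omega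
    simp [A, I, z1, z2, z3]
  have cost : ∀ q, (∑ j ∈ Finset.univ.erase K, (A K q j (P j) + A j (P j) K q)) + 2 * A K q K q
      = al (pt K q 0) + al (pt K q 1) + om (pt K q 2) + om (pt K q 3)
        + 2 * I (m (pt K q 0)) (pt K q 3) := by
    intro q
    have e1 : (∑ j ∈ Finset.univ.erase K, (A K q j (P j) + A j (P j) K q))
      = al (pt K q 0) + al (pt K q 1) + om (pt K q 2) + om (pt K q 3) := by
      simp only [al, om, ← Finset.sum_add_distrib]
      apply Finset.sum_congr rfl
      intro j _
      simp only [A]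
      rw [Isymm (pt j (P j) 0) (pt K q 2), Isymm (pt j (P j) 0) (pt K q 3),
        Isymm (pt j (P j) 1) (pt K q 2), Isymm (pt j (P j) 1) (pt K q 3)]
      ring
    rw [e1]
    rw [eA]
  have hFn : ∀ i, F (i + n K) = F i := by
    intro i
    refine (hf _ _ _ _).2 ⟨rfl, ⟨(P K).2, ?_⟩⟩
    push_cast; ring
  have c0 : al (pt K (P K) 0) + al (pt K (P K) 1) + om (pt K (P K) 2) + om (pt K (P K) 3)
        + 2 * I (m (pt K (P K) 0)) (pt K (P K) 3) =
      al (F 0) + al (F 1) + om (F 2) + om (F 3) + 2 * I (m (F 0)) (F 3) := by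
    simp [F, pt]
  have alpos : ∀ x K' b, K' ≠ K → (b = 2 ∨ b = 3) → m x = pt K' (P K') b → 1 ≤ al x := by
    intro x K' b hK hb h
    refine le_trans ?_ (Finset.single_le_sum (fun _ _ => Nat.zero_le _)
      (Finset.mem_erase.2 ⟨hK, Finset.mem_univ K'⟩))
    rcases hb with rfl | rfl <;> simp [I, h]
  have ompos : ∀ x K' b, K' ≠ K → (b = 0 ∨ b = 1) → m x = pt K' (P K') b → 1 ≤ om x := by
    intro x K' b hK hb h
    refine le_trans ?_ (Finset.single_le_sum (fun _ _ => Nat.zero_le _)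
      (Finset.mem_erase.2 ⟨hK, Finset.mem_univ K'⟩))
    rcases hb with rfl | rfl <;> simp [I, h]
  have loop : ∀ a b, (a = 0 ∨ a = 1) → (b = 2 ∨ b = 3) →
      m (pt K (P K) a) = pt K (P K) b → 1 ≤ I (m (F 0)) (F 3) := by
    intro a b ha hb h
    have e : I (m (F 0)) (F 3) = A K (P K) K (P K) := by rw [eA]; simp [F, pt]
    rw [e]
    simp only [A]
    rcases ha with rfl | rfl <;> rcases hb with rfl | rfl <;> simp only [I, if_pos h] <;> omega
  refine comb (n K) (hodd K) (fun i => al (F i)) (fun i => om (F i))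
    (fun i => I (m (F i)) (F (i+3))) (fun i => by rw [hFn]) (fun i => hao _)
    (fun i => by simp only [I]; split_ifs <;> omega) ?_ ?_ ?_ ?_ ?_ ?_
  · intro i hi
    have hi : m (F i) = F (i+3) := by by_contra h; simp [I, h] at hi
    exact hin _ ((P K).1 + (P K).2 * (i : ℤ)) (by rw [← hi, minv])
  · intro i hi hi'
    have hi : m (F i) = F (i+3) := by by_contra h; simp [I, h] at hi
    have hi' : m (F (i+3)) = F (i+3+3) := by by_contra h; simp [I, h] at hi'
    rw [← hi, minv] at hi'
    obtain ⟨-, hd⟩ := (hf _ _ _ _).1 hi'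
    have h6 : (n K : ℤ) ∣ 6 := by
      rcases usq (P K).2 with e | e
      · rw [e] at hd
        obtain ⟨k, hk⟩ := hd
        refine ⟨-k, ?_⟩
        simp only [Units.val_one] at hk
        push_cast at hk
        linarith
      · rw [e] at hd
        obtain ⟨k, hk⟩ := hd
        refine ⟨k, ?_⟩
        simp only [Units.val_neg, Units.val_one] at hk
        push_cast at hk
        linarith
    have h6' : n K ∣ 6 := by exact_mod_cast h6
    have := Nat.le_of_dvd (by norm_num) h6'
    have h4' := h4 K
    have ho := hodd K
    interval_cases (n K) <;> revert h6' ho <;> decide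
  · intro i
    have := hP K ((P K).1 + (P K).2 * (i:ℤ), (P K).2)
    rw [cost, cost, c0] at this
    refine this.trans (le_of_eq ?_)
    have e : ∀ k : ℕ, pt K ((P K).1 + (P K).2 * (i:ℤ), (P K).2) (k : ℤ) = F (i + k) := by
      intro k; simp only [pt, F]; congr 1; push_cast; ring
    have e0 := e 0; have e1 := e 1; have e2 := e 2; have e3 := e 3
    push_cast at e0 e1 e2 e3
    rw [e0, e1, e2, e3]
    rfl
  · intro i
    have := hP K ((P K).1 + (P K).2 * (i+3:ℤ), -(P K).2)
    rw [cost, cost, c0] at this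
    refine this.trans (le_of_eq ?_)
    have e : ∀ k l : ℕ, k + l = 3 → pt K ((P K).1 + (P K).2 * (i+3:ℤ), -(P K).2) (k : ℤ) = F (i + l) := by
      intro k l h
      have : (3 : ℤ) = k + l := by exact_mod_cast h.symm
      simp only [pt, F]; rw [this]; congr 1; push_cast; ring
    have e0 := e 0 3 rfl; have e1 := e 1 2 rfl; have e2 := e 2 1 rfl; have e3 := e 3 0 rfl
    push_cast at e0 e1 e2 e3
    rw [e0, e1, e2, e3, Isymm]
    rfl
  · by_cases hK : K' = K
    · subst hK
      have := loop a b ha hb hKK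
      simp only [zero_add]
      omega
    · rcases ha with rfl | rfl
      · have : 1 ≤ al (F 0) := alpos _ K' b hK hb (by simpa [F, pt] using hKK)
        omega
      · have : 1 ≤ al (F 1) := alpos _ K' b hK hb (by simpa [F, pt] using hKK)
        omega
  · by_cases hK : K'' = K
    · subst hK
      have := loop a' b' ha' hb' hKK'
      simp only [zero_add]
      omega
    · have hh : m (f K ((P K).1 + (P K).2 * b')) = pt K'' (P K'') a' := by rw [← hKK', minv]
      rcases hb' with rfl | rfl
      · have : 1 ≤ om (F 2) := ompos _ K'' a' hK ha' (by simpa [F, pt] using hh)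
        omega
      · have : 1 ≤ om (F 3) := ompos _ K'' a' hK ha' (by simpa [F, pt] using hh)
        omega

/-- colour of the `j`-th edge of a cycle of length `N` -/
def gam (N : ℕ) (j : ℤ) : ℕ := if Odd N ∧ (N : ℤ) ∣ j then 3 else if (j % N) % 2 = 1 then 2 else 1

lemma gam_congr {N : ℕ} {i j : ℤ} (h : (N : ℤ) ∣ i - j) : gam N i = gam N j := by
  have h1 : i % N = j % N := Int.emod_eq_emod_iff_emod_sub_eq_zero.2 (Int.emod_eq_zero_of_dvd h)
  have h2 : (N : ℤ) ∣ i ↔ (N : ℤ) ∣ j := by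
    rw [Int.dvd_iff_emod_eq_zero, Int.dvd_iff_emod_eq_zero, h1]
  simp only [gam, h1, h2]

lemma gam_pos (N : ℕ) (j : ℤ) : 1 ≤ gam N j ∧ gam N j < 4 := by
  unfold gam; split_ifs <;> omega

lemma gam_three {N : ℕ} {j : ℤ} (h : gam N j = 3) : Odd N ∧ (N : ℤ) ∣ j := by
  by_contra h1
  rw [gam, if_neg h1] at h
  split_ifs at h <;> omega

lemma emod_succ (N j : ℤ) (hN : 0 < N) :
    ((j+1) % N = j % N + 1 ∧ j % N + 1 < N) ∨ ((j+1) % N = 0 ∧ j % N = N - 1) := by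
  have h1 := Int.emod_nonneg j hN.ne'
  have h2 := Int.emod_lt_of_pos j hN
  rw [← Int.emod_add_emod]
  rcases lt_or_ge (j % N + 1) N with h | h
  · left; exact ⟨Int.emod_eq_of_lt (by omega) h, h⟩
  · right
    have : j % N + 1 = N := by omega
    rw [this]; simp; omega

lemma gam_succ {N : ℕ} (hN : 4 ≤ N) (j : ℤ) : gam N j ≠ gam N (j+1) := by
  have h := emod_succ N j (by omega)
  have h1 := Int.emod_nonneg j (show (N:ℤ) ≠ 0 by omega)
  unfold gam
  simp only [Int.dvd_iff_emod_eq_zero, Nat.odd_iff]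
  generalize (j+1) % (N:ℤ) = r' at *
  generalize j % (N:ℤ) = r at *
  split_ifs <;> omega

lemma gam_one {N : ℕ} (hN : 4 ≤ N) : gam N 1 = 2 := by
  have : (1:ℤ) % N = 1 := Int.emod_eq_of_lt (by omega) (by omega)
  simp [gam, Int.dvd_iff_emod_eq_zero, this]

lemma gam_two {N : ℕ} (hN : 4 ≤ N) : gam N 2 = 1 := by
  have : (2:ℤ) % N = 2 := Int.emod_eq_of_lt (by omega) (by omega)
  simp [gam, Int.dvd_iff_emod_eq_zero, this]

lemma gam_zero {N : ℕ} (ho : Odd N) : gam N 0 = 3 := by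
  simp [gam, ho]

lemma gam_neg_one {N : ℕ} (hN : 4 ≤ N) (ho : Odd N) : gam N (-1) = 1 := by
  have h := emod_succ N (-1) (by omega)
  have h1 := Int.emod_nonneg (-1) (show (N:ℤ) ≠ 0 by omega)
  simp only [gam, Int.dvd_iff_emod_eq_zero, Nat.odd_iff] at *
  simp only [Int.reduceNeg, neg_add_cancel, Int.zero_emod] at h
  generalize (-1) % (N:ℤ) = r at *
  split_ifs <;> omega

lemma walk_lemma {E : Type*} (c : E → ℕ) (R : E → E → Prop)
    (hR : ∀ e f, R e f → c f = (c e + 1) % 4) (hlt : ∀ e f, R e f → c e < 4)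
    (no : ∀ e0 e1 e2 e3 e4 e5 e6 e7 e8, R e0 e1 → R e1 e2 → R e2 e3 → R e3 e4 → R e4 e5 →
      R e5 e6 → R e6 e7 → R e7 e8 → c e0 = 3 → False) :
    (∀ e, ¬ Relation.TransGen R e e) ∧
      ∀ l : List E, List.IsChain R l → (l.filter fun e => c e = 3).length ≤ 2 := by
  constructor
  · intro e he
    have step : ∀ f, Relation.TransGen R f e → ∃ g, R f g ∧ Relation.TransGen R g e := by
      intro f hf
      rcases Relation.TransGen.head'_iff.1 hf with ⟨g, hg, hge⟩
      refine ⟨g, hg, ?_⟩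
      exact Relation.TransGen.trans_right hge he
    have three : ∀ k f, Relation.TransGen R f e → c f + k = 3 → 
        ∃ g, Relation.TransGen R g e ∧ c g = 3 := by
      intro k
      induction k with
      | zero => intro f hf h; exact ⟨f, hf, h⟩
      | succ k ih =>
        intro f hf h
        obtain ⟨g, hg, hge⟩ := step f hf
        have := hR _ _ hg
        exact ih g hge (by omega)
    have : c e < 4 := by
      obtain ⟨g, hg, _⟩ := step e he
      exact hlt _ _ hg
    obtain ⟨e0, h0, hc⟩ := three (3 - c e) e he (by omega)
    obtain ⟨e1, r0, h1⟩ := step _ h0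
    obtain ⟨e2, r1, h2⟩ := step _ h1
    obtain ⟨e3, r2, h3⟩ := step _ h2
    obtain ⟨e4, r3, h4⟩ := step _ h3
    obtain ⟨e5, r4, h5⟩ := step _ h4
    obtain ⟨e6, r5, h6⟩ := step _ h5
    obtain ⟨e7, r6, h7⟩ := step _ h6
    obtain ⟨e8, r7, h8⟩ := step _ h7
    exact no _ _ _ _ _ _ _ _ _ r0 r1 r2 r3 r4 r5 r6 r7 hc
  · have small : ∀ e l, c e = 3 → List.IsChain R (e :: l) →
        ((l.filter fun e => c e = 3).length = 0) ∨ ∃ e1 e2 e3 e4 t, l = e1 :: e2 :: e3 :: e4 :: t ∧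
          c e1 = 0 ∧ c e2 = 1 ∧ c e3 = 2 ∧ c e4 = 3 := by
      intro e l he hl
      rcases l with _ | ⟨e1, _ | ⟨e2, _ | ⟨e3, _ | ⟨e4, t⟩⟩⟩⟩
      · simp
      all_goals
        simp only [List.isChain_cons_cons] at hl
        have h1 := hR _ _ hl.1
        rw [he] at h1
        norm_num at h1
      · left; simp [h1]
      all_goals
        have h2 := hR _ _ hl.2.1
        rw [h1] at h2
        norm_num at h2
      · left; simp [h1, h2]
      all_goals
        have h3 := hR _ _ hl.2.2.1
        rw [h2] at h3
        norm_num at h3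
      · left; simp [h1, h2, h3]
      have h4 := hR _ _ hl.2.2.2.1
      rw [h3] at h4
      norm_num at h4
      right; exact ⟨e1, e2, e3, e4, t, rfl, h1, h2, h3, h4⟩
    intro l
    induction l with
    | nil => simp
    | cons e l ih =>
      intro hl
      by_cases he : c e = 3
      · rcases small e l he hl with h | ⟨e1, e2, e3, e4, t, rfl, h1, h2, h3, h4⟩
        · rw [List.filter_cons_of_pos (by simpa using he), List.length_cons, h]
          omega
        · have hl' : List.IsChain R (e4 :: t) := by
            simp only [List.isChain_cons_cons] at hl; exact hl.2.2.2.2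
          rcases small e4 t h4 hl' with h | ⟨e5, e6, e7, e8, t', rfl, -⟩
          · simp only [List.filter_cons, he, h1, h2, h3, h4]
            norm_num
            simpa using h
          · exfalso
            simp only [List.isChain_cons_cons] at hl
            obtain ⟨r0, r1, r2, r3, r4, r5, r6, r7, -⟩ := hl
            exact no _ _ _ _ _ _ _ _ _ r0 r1 r2 r3 r4 r5 r6 r7 he
      · rw [List.filter_cons_of_neg (by simpa using he)]
        exact ih hl.tail

lemma stage2 {V ι : Type*} (G : SimpleGraph V) (n : ι → ℕ) (F : ι → ℤ → V) (m : V → V)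
    (h4 : ∀ K, 4 ≤ n K)
    (hF : ∀ K K' i j, F K i = F K' j ↔ K = K' ∧ (n K : ℤ) ∣ i - j)
    (surj : ∀ x, ∃ K i, x = F K i)
    (minv : ∀ x, m (m x) = x)
    (hG : ∀ e, e ∈ G.edgeSet ↔ (∃ x, e = s(x, m x)) ∨ ∃ K i, e = s(F K i, F K (i+1)))
    (hMne : ∀ K i x, s(x, m x) ≠ s(F K i, F K (i+1)))
    (hbad : ∀ K K' K'' : ι, ∀ a b a' b' : ℤ, Odd (n K) → Odd (n K') → Odd (n K'') →
      (a = 0 ∨ a = 1) → (b = 2 ∨ b = 3) → (a' = 0 ∨ a' = 1) → (b' = 2 ∨ b' = 3) →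
      m (F K a) = F K' b → m (F K'' a') = F K b' → False) :
    ∃ c : Sym2 V → ℕ, IsProper4EdgeColoring G c ∧
      (∀ e, ¬ Relation.TransGen (EdgeTightArc G c) e e) ∧
      ∀ l : List (Sym2 V), l.Chain' (EdgeTightArc G c) → l.Nodup →
        (l.filter fun e => c e = 3).length ≤ 2 := by
  classical
  have small : ∀ K (z : ℤ), (n K : ℤ) ∣ z → |z| < 4 → z = 0 := fun K z h hz =>
    Int.eq_zero_of_abs_lt_dvd h (lt_of_lt_of_le hz (by exact_mod_cast h4 K))
  obtain ⟨c, hcM, hcC⟩ : ∃ c : Sym2 V → ℕ, (∀ x, c s(x, m x) = 0) ∧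
      ∀ K i, c s(F K i, F K (i+1)) = gam (n K) i := by
    refine ⟨fun e => if h : ∃ p : ι × ℤ, e = s(F p.1 p.2, F p.1 (p.2+1)) then
      gam (n h.choose.1) h.choose.2 else 0, ?_, ?_⟩
    · intro x
      simp only
      rw [dif_neg]
      rintro ⟨p, hp⟩
      exact hMne _ _ _ hp
    · intro K i
      have h : ∃ p : ι × ℤ, s(F K i, F K (i+1)) = s(F p.1 p.2, F p.1 (p.2+1)) := ⟨(K, i), rfl⟩
      simp only
      rw [dif_pos h]
      have hs := h.choose_spec
      generalize h.choose = p at hs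
      obtain ⟨K', j⟩ := p
      simp only [Sym2.eq_iff] at hs ⊢
      rcases hs with ⟨h1, h2⟩ | ⟨h1, h2⟩
      · obtain ⟨rfl, hd⟩ := (hF _ _ _ _).1 h1
        exact (gam_congr hd).symm
      · obtain ⟨rfl, hd⟩ := (hF _ _ _ _).1 h1
        obtain ⟨-, hd'⟩ := (hF _ _ _ _).1 h2
        have := small _ _ (dvd_sub hd' hd) (by
          rw [show i + 1 - j - (i - (j+1)) = 2 by ring]; norm_num)
        omega
  have inc : ∀ K l e, e ∈ G.edgeSet → c e ≠ 0 → F K l ∈ e →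
      e = s(F K l, F K (l+1)) ∨ e = s(F K (l-1), F K (l-1+1)) := by
    intro K l e he hc hl
    rcases (hG e).1 he with ⟨x, rfl⟩ | ⟨K', i, rfl⟩
    · exact absurd (hcM x) hc
    · rcases Sym2.mem_iff.1 hl with h | h
      · left
        obtain ⟨rfl, hd⟩ := (hF _ _ _ _).1 h
        rw [h, (hF K K (l+1) (i+1)).2 ⟨rfl, by convert hd using 1; ring⟩]
      · right
        obtain ⟨rfl, hd⟩ := (hF _ _ _ _).1 h
        rw [sub_add_cancel, h, (hF K K (l-1) i).2 ⟨rfl, by convert hd using 1; ring⟩]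
  have incM : ∀ v e, e ∈ G.edgeSet → c e = 0 → v ∈ e → e = s(v, m v) := by
    intro v e he hc hv
    rcases (hG e).1 he with ⟨x, rfl⟩ | ⟨K', i, rfl⟩
    · rcases Sym2.mem_iff.1 hv with rfl | rfl
      · rfl
      · rw [minv]; exact Sym2.eq_swap
    · rw [hcC] at hc
      have := gam_pos (n K') i
      omega
  have e3 : ∀ e, e ∈ G.edgeSet → c e = 3 → ∃ K, Odd (n K) ∧ e = s(F K 0, F K 1) := by
    intro e he hc
    rcases (hG e).1 he with ⟨x, rfl⟩ | ⟨K', i, rfl⟩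
    · rw [hcM] at hc; omega
    · rw [hcC] at hc
      obtain ⟨ho, hd⟩ := gam_three hc
      refine ⟨K', ho, ?_⟩
      rw [(hF K' K' i 0).2 ⟨rfl, by simpa using hd⟩, (hF K' K' (i+1) 1).2 ⟨rfl, by simpa using hd⟩]
  have hlt : ∀ e ∈ G.edgeSet, c e < 4 := by
    intro e he
    rcases (hG e).1 he with ⟨x, rfl⟩ | ⟨K', i, rfl⟩
    · rw [hcM]; omega
    · rw [hcC]; exact (gam_pos _ _).2
  have prop : IsProper4EdgeColoring G c := by
    refine ⟨hlt, ?_⟩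
    rintro e f he hf hne ⟨v, hve, hvf⟩ hcc
    by_cases hc : c e = 0
    · exact hne ((incM v e he hc hve).trans (incM v f hf (hcc ▸ hc) hvf).symm)
    · obtain ⟨K, l, rfl⟩ := surj v
      have key := gam_succ (h4 K) (l-1)
      have hcf : c f ≠ 0 := hcc ▸ hc
      rcases inc K l e he hc hve with h | h <;> rcases inc K l f hf hcf hvf with h' | h'
      · exact hne (h.trans h'.symm)
      · rw [h, h', hcC, hcC] at hcc; rw [sub_add_cancel] at key; exact key hcc.symm
      · rw [h, h', hcC, hcC] at hcc; rw [sub_add_cancel] at key; exact key hcc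
      · exact hne (h.trans h'.symm)
  have five : ∀ e0 e1 e2 e3 e4, EdgeTightArc G c e0 e1 → EdgeTightArc G c e1 e2 →
      EdgeTightArc G c e2 e3 → EdgeTightArc G c e3 e4 → c e0 = 3 → c e4 = 3 ∧
      ∃ K K' a b, Odd (n K) ∧ Odd (n K') ∧ e0 = s(F K 0, F K 1) ∧ e4 = s(F K' 0, F K' 1) ∧
      (a = 0 ∨ a = 1) ∧ (b = 2 ∨ b = 3) ∧ m (F K a) = F K' b := by
    rintro x0 x1 x2 x3 x4 ⟨m0, m1, -, ⟨v0, i0, i0'⟩, c0⟩ ⟨-, m2, -, ⟨v1, i1, i1'⟩, c1⟩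
      ⟨-, m3, -, ⟨v2, i2, i2'⟩, c2⟩ ⟨-, m4, -, ⟨v3, i3, i3'⟩, c3⟩ hc
    rw [hc] at c0; norm_num at c0
    rw [c0] at c1; norm_num at c1
    rw [c1] at c2; norm_num at c2
    rw [c2] at c3; norm_num at c3
    refine ⟨c3, ?_⟩
    obtain ⟨K, ho, rfl⟩ := e3 _ m0 hc
    obtain ⟨K', ho', rfl⟩ := e3 _ m4 c3
    have col : ∀ i, c s(F K' i, F K' (i+1)) = gam (n K') i := hcC K'
    have g0 := gam_zero ho'
    have g1 := gam_one (h4 K')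
    have g2 := gam_two (h4 K')
    have g3 := gam_neg_one (h4 K') ho'
    have x3e : x3 = s(F K' 1, F K' 2) := by
      rcases Sym2.mem_iff.1 i3' with rfl | rfl
      · rcases inc _ _ _ m3 (by omega) i3 with h | h
        · rw [h, col, g0] at c2; omega
        · rw [h, col] at c2; norm_num [g3] at c2
      · rcases inc _ _ _ m3 (by omega) i3 with h | h
        · exact h
        · rw [h, col] at c2; norm_num [g0] at c2
    have x2e : x2 = s(F K' 2, F K' 3) := by
      rw [x3e] at i2'
      rcases Sym2.mem_iff.1 i2' with rfl | rfl
      · rcases inc _ _ _ m2 (by omega) i2 with h | h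
        · rw [h, col, g1] at c1; omega
        · rw [h, col] at c1; norm_num [g0] at c1
      · rcases inc _ _ _ m2 (by omega) i2 with h | h
        · exact h
        · rw [h, col] at c1; norm_num [g1] at c1
    obtain ⟨a, ha, rfl⟩ : ∃ a : ℤ, (a = 0 ∨ a = 1) ∧ v0 = F K a := by
      rcases Sym2.mem_iff.1 i0 with rfl | rfl
      · exact ⟨0, by simp, rfl⟩
      · exact ⟨1, by simp, rfl⟩
    obtain ⟨b, hb, rfl⟩ : ∃ b : ℤ, (b = 2 ∨ b = 3) ∧ v1 = F K' b := by
      rw [x2e] at i1'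
      rcases Sym2.mem_iff.1 i1' with rfl | rfl
      · exact ⟨2, by simp, rfl⟩
      · exact ⟨3, by simp, rfl⟩
    refine ⟨K, K', a, b, ho, ho', rfl, rfl, ha, hb, ?_⟩
    have x1e := incM _ _ m1 c0 i0'
    rw [x1e] at i1
    rcases Sym2.mem_iff.1 i1 with h | h
    · obtain ⟨rfl, hd⟩ := (hF _ _ _ _).1 h
      have := small _ _ hd (by rw [abs_lt]; omega)
      omega
    · exact h.symm
  have fin := walk_lemma c (EdgeTightArc G c) (fun e f h => h.2.2.2.2) (fun e f h => hlt _ h.1) (by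
    intro x0 x1 x2 x3 x4 x5 x6 x7 x8 r0 r1 r2 r3 r4 r5 r6 r7 hc
    obtain ⟨hc4, K'', K, a', b', o1, o2, -, E, ha', hb', hm⟩ := five _ _ _ _ _ r0 r1 r2 r3 hc
    obtain ⟨-, L, K', a, b, o3, o4, E', -, ha, hb, hm'⟩ := five _ _ _ _ _ r4 r5 r6 r7 hc4
    have hL : K = L := by
      rw [E, Sym2.eq_iff] at E'
      rcases E' with ⟨h, -⟩ | ⟨h, -⟩ <;> exact ((hF _ _ _ _).1 h).1
    subst hL
    exact hbad K K' K'' a b a' b' o2 o4 o1 ha hb ha' hb' hm' hm)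
  exact ⟨c, prop, fin.1, fun l hl _ => fin.2 l hl⟩

lemma param {V : Type*} [Fintype V] (H : SimpleGraph V) (h2 : ∀ v, (H.neighborSet v).ncard = 2)
    (K : H.ConnectedComponent) : ∃ (N : ℕ) (f : ℤ → V), 3 ≤ N ∧
      (∀ i j, f i = f j ↔ (N : ℤ) ∣ i - j) ∧ (∀ i, H.Adj (f i) (f (i+1))) ∧
      ∀ x, x ∈ K.supp ↔ ∃ i, x = f i := by
  obtain ⟨v, hv⟩ := K.nonempty_supp
  have hcyc : H.IsCycles := fun v _ => h2 v
  have hn : (H.neighborSet v).Nonempty := by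
    rw [← Set.ncard_pos (Set.toFinite _), h2]; omega
  obtain ⟨p, hp, hK⟩ := hcyc.exists_cycle_toSubgraph_verts_eq_connectedComponentSupp hv hn
  have h3 := hp.three_le_length
  have hpos : (0 : ℤ) < p.length := by omega
  have b1 : ∀ i : ℤ, 0 ≤ i % p.length := fun i => Int.emod_nonneg i hpos.ne'
  have b2 : ∀ i : ℤ, i % p.length < p.length := fun i => Int.emod_lt_of_pos i hpos
  refine ⟨p.length, fun i => p.getVert (i % p.length).toNat, h3, ?_, ?_, ?_⟩
  · intro i j
    constructor
    · intro h
      have := hp.getVert_injOn' (x₁ := (i % p.length).toNat) (x₂ := (j % p.length).toNat)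
        (by have := b2 i; simp only [Set.mem_ofPred_eq]; omega)
        (by have := b2 j; simp only [Set.mem_ofPred_eq]; omega) h
      have h' : i % p.length = j % p.length := by
        have := b1 i; have := b1 j; omega
      exact Int.dvd_of_emod_eq_zero (Int.emod_eq_emod_iff_emod_sub_eq_zero.1 h')
    · intro h
      have h' : i % p.length = j % p.length :=
        Int.emod_eq_emod_iff_emod_sub_eq_zero.2 (Int.emod_eq_zero_of_dvd h)
      simp only [h']
  · intro i
    have hb := b1 i
    have ha := p.adj_getVert_succ (i := (i % p.length).toNat) (by have := b2 i; omega)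
    rcases emod_succ p.length i hpos with ⟨h, h'⟩ | ⟨h, h'⟩
    · simp only [h]
      rwa [show (i % p.length + 1).toNat = (i % p.length).toNat + 1 by omega]
    · simp only [h]
      rw [show (i % p.length).toNat + 1 = p.length by omega, p.getVert_length] at ha
      simpa using ha
  · intro x
    rw [← hK, Walk.mem_verts_toSubgraph, Walk.mem_support_iff_exists_getVert]
    constructor
    · rintro ⟨k, rfl, hk⟩
      rcases hk.lt_or_eq with hk | rfl
      · refine ⟨k, ?_⟩
        simp only
        rw [Int.emod_eq_of_lt (by omega) (by omega)]
        simp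
      · refine ⟨0, ?_⟩
        simp
    · rintro ⟨i, rfl⟩
      exact ⟨_, rfl, by have := b2 i; omega⟩

lemma no_triangle_s9 {V : Type*} (G : SimpleGraph V) (hgirth : 4 ≤ G.egirth) (x y z : V)
    (h1 : G.Adj x y) (h2 : G.Adj y z) (h3 : G.Adj z x) : False := by
  have hc : (Walk.cons h1 (Walk.cons h2 (Walk.cons h3 Walk.nil))).IsCycle := by
    rw [Walk.cons_isCycle_iff]
    refine ⟨?_, ?_⟩
    · simp [h1.ne, h2.ne, h3.ne, h1.ne', h2.ne', h3.ne']
    · simp [h1.ne, h2.ne, h3.ne, h1.ne', h2.ne', h3.ne']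
  have := le_egirth.1 hgirth _ _ hc
  simp only [Walk.length_cons, Walk.length_nil] at this
  norm_num at this

/-- If `G` is a finite cubic simple graph of girth at least 4 with a perfect matching, then
there is a proper 4-edge-coloring `c` of `G` (colors `0,1,2,3`) whose tight-arc digraph
`D_c(L(G))` is acyclic and each of whose directed paths contains at most two edges of color
`3`. -/
theorem exists_four_edge_coloring_tightAcyclic_path_bound
    {V : Type*} [Fintype V] [DecidableEq V] (G : SimpleGraph V) [DecidableRel G.Adj]
    (hcubic : ∀ v, G.degree v = 3) (hgirth : 4 ≤ G.egirth)
    (hM : ∃ M : G.Subgraph, M.IsPerfectMatching) :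
    ∃ c : Sym2 V → ℕ, IsProper4EdgeColoring G c ∧
      (∀ e, ¬ Relation.TransGen (EdgeTightArc G c) e e) ∧
      ∀ l : List (Sym2 V), l.Chain' (EdgeTightArc G c) → l.Nodup →
        (l.filter fun e => c e = 3).length ≤ 2 := by
    classical
  obtain ⟨M, hM⟩ := hM
  rw [Subgraph.isPerfectMatching_iff] at hM
  choose m hm hmu using hM
  have hmu : ∀ x y, M.Adj x y → y = m x := hmu
  have minv : ∀ x, m (m x) = x := fun x => (hmu _ _ (hm x).symm).symm
  have hmG : ∀ x, G.Adj x (m x) := fun x => (hm x).adj_sub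
  let H : SimpleGraph V := MinusM G M
  have hH : ∀ x y, H.Adj x y ↔ G.Adj x y ∧ y ≠ m x := by
    intro x y
    simp only [H, MinusM, sdiff_adj, Subgraph.spanningCoe_adj]
    refine and_congr_right fun _ => not_congr ⟨hmu x y, ?_⟩
    rintro rfl; exact hm x
  have h2 : ∀ v, (H.neighborSet v).ncard = 2 := by
    intro v
    have e : H.neighborSet v = G.neighborSet v \ {m v} := by
      ext y; simp [hH]
    rw [e, Set.ncard_sdiff_singleton_of_mem (by simpa using hmG v), Set.ncard_eq_toFinset_card',
      ← neighborFinset_def, card_neighborFinset_eq_degree, hcubic]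
  choose n f hn3 hfi hfadj hfs using param H h2
  have tri := no_triangle_s9 G hgirth
  have hGadj : ∀ K i, G.Adj (f K i) (f K (i+1)) := fun K i => ((hH _ _).1 (hfadj K i)).1
  have h4 : ∀ K, 4 ≤ n K := by
    intro K
    by_contra h
    have h3 : n K = 3 := by have := hn3 K; omega
    have e : f K (2+1) = f K 0 := (hfi K _ _).2 (by rw [h3]; norm_num)
    exact tri _ _ _ (hGadj K 0) (hGadj K 1) (e ▸ hGadj K 2)
  have hf : ∀ K K' i j, f K i = f K' j ↔ K = K' ∧ (n K : ℤ) ∣ i - j := by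
    intro K K' i j
    constructor
    · intro h
      have m1 : f K i ∈ K.supp := (hfs K _).2 ⟨i, rfl⟩
      have m2 : f K i ∈ K'.supp := (hfs K' _).2 ⟨j, h⟩
      rw [ConnectedComponent.mem_supp_iff] at m1 m2
      have : K = K' := m1.symm.trans m2
      subst this
      exact ⟨rfl, (hfi K _ _).1 h⟩
    · rintro ⟨rfl, h⟩; exact (hfi K _ _).2 h
  have surj : ∀ x, ∃ K i, x = f K i := by
    intro x
    obtain ⟨i, hi⟩ := (hfs (H.connectedComponentMk x) x).1 rfl
    exact ⟨_, i, hi⟩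
  have h1 : ∀ K i, m (f K i) ≠ f K (i+1) := fun K i h =>
    ((hH _ _).1 (hfadj K i)).2 h.symm
  have h2' : ∀ K i, m (f K i) ≠ f K (i+2) := by
    intro K i h
    have a1 := hGadj K (i+1)
    rw [add_assoc] at a1
    exact tri _ _ _ (hGadj K i) a1 (by have := hmG (f K i); rw [h] at this; exact this.symm)
  have hG : ∀ e, e ∈ G.edgeSet ↔ (∃ x, e = s(x, m x)) ∨ ∃ K i, e = s(f K i, f K (i+1)) := by
    intro e
    constructor
    · induction e using Sym2.ind with
      | _ x y =>
        intro he
        rw [mem_edgeSet] at he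
        by_cases hy : y = m x
        · left; exact ⟨x, by rw [hy]⟩
        · right
          have hadj : H.Adj x y := (hH _ _).2 ⟨he, hy⟩
          obtain ⟨K, i, rfl⟩ := surj x
          have hb : H.Adj (f K i) (f K (i-1)) := by
            have := hfadj K (i-1); rw [sub_add_cancel] at this; exact this.symm
          have hne : f K (i+1) ≠ f K (i-1) := by
            intro h
            have := (hfi K _ _).1 h
            rw [show i + 1 - (i - 1) = 2 by ring] at this
            have := Int.le_of_dvd (by norm_num) this
            have := h4 K
            omega
          have hs : ({f K (i+1), f K (i-1)} : Set V) = H.neighborSet (f K i) := by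
            apply Set.eq_of_subset_of_ncard_le
            · rintro z (rfl | rfl)
              · exact hfadj K i
              · exact hb
            · rw [h2, Set.ncard_pair hne]
            · exact Set.toFinite _
          have : y ∈ ({f K (i+1), f K (i-1)} : Set V) := hs ▸ hadj
          rcases this with rfl | rfl
          · exact ⟨K, i, rfl⟩
          · exact ⟨K, i - 1, by rw [sub_add_cancel]; exact Sym2.eq_swap⟩
    · rintro (⟨x, rfl⟩ | ⟨K, i, rfl⟩)
      · exact hmG x
      · exact hGadj K i
  have hMne : ∀ K i x, s(x, m x) ≠ s(f K i, f K (i+1)) := by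
    intro K i x h
    rw [Sym2.eq_iff] at h
    rcases h with ⟨rfl, h⟩ | ⟨rfl, h⟩
    · exact h1 _ _ h
    · apply h1 K i; rw [← h, minv]
  let ι := {K : H.ConnectedComponent // Odd (n K)}
  obtain ⟨P, hP⟩ := stage1 (ι := ι) (fun K => n K.1) (fun K => f K.1) m (fun K => K.2)
    (fun K => h4 K.1) (fun K K' i j => by rw [hf, Subtype.ext_iff]) minv
    (fun K => h1 K.1) (fun K => h2' K.1)
  let Q : H.ConnectedComponent → ℤ × ℤˣ := fun K => if h : Odd (n K) then P ⟨K, h⟩ else (0, 1)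
  have hQ : ∀ K : ι, Q K.1 = P K := fun K => dif_pos K.2
  have sc : ∀ K i i' j j', i = i' → j = j' → s(f K i, f K j) = s(f K i', f K j') := by
    rintro K i _ j _ rfl rfl; rfl
  have edge : ∀ K i, ∃ j, s(f K ((Q K).1 + (Q K).2 * i), f K ((Q K).1 + (Q K).2 * (i+1)))
      = s(f K j, f K (j+1)) := by
    intro K i
    rcases Int.units_eq_one_or (Q K).2 with e | e
    · refine ⟨(Q K).1 + i, ?_⟩
      rw [e]; simp only [Units.val_one, one_mul, add_assoc]
    · refine ⟨(Q K).1 - i - 1, ?_⟩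
      rw [e, Sym2.eq_swap]; simp only [Units.val_one, Units.val_neg]
      exact sc _ _ _ _ _ (by ring) (by ring)
  have edge' : ∀ K j, ∃ i, s(f K ((Q K).1 + (Q K).2 * i), f K ((Q K).1 + (Q K).2 * (i+1)))
      = s(f K j, f K (j+1)) := by
    intro K j
    rcases Int.units_eq_one_or (Q K).2 with e | e
    · refine ⟨j - (Q K).1, ?_⟩
      rw [e]; simp only [Units.val_one]
      exact sc _ _ _ _ _ (by ring) (by ring)
    · refine ⟨(Q K).1 - j - 1, ?_⟩
      rw [e, Sym2.eq_swap]; simp only [Units.val_one, Units.val_neg]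
      exact sc _ _ _ _ _ (by ring) (by ring)
  refine stage2 G n (fun K i => f K ((Q K).1 + (Q K).2 * i)) m h4 ?_ ?_ minv ?_ ?_ ?_
  · intro K K' i j
    rw [hf]
    refine and_congr_right ?_
    rintro rfl
    rw [show (Q K).1 + (Q K).2 * i - ((Q K).1 + (Q K).2 * j) = (Q K).2 * (i - j) by ring]
    exact (Units.isUnit _).dvd_mul_left
  · intro x
    obtain ⟨K, j, rfl⟩ := surj x
    refine ⟨K, (Q K).2 * (j - (Q K).1), ?_⟩
    congr 1
    rw [← mul_assoc, ← Units.val_mul, Int.units_mul_self]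
    simp
  · intro e
    rw [hG]
    refine or_congr_right ⟨?_, ?_⟩
    · rintro ⟨K, j, rfl⟩
      obtain ⟨i, hi⟩ := edge' K j
      exact ⟨K, i, hi.symm⟩
    · rintro ⟨K, i, rfl⟩
      obtain ⟨j, hj⟩ := edge K i
      exact ⟨K, j, hj⟩
  · intro K i x
    obtain ⟨j, hj⟩ := edge K i
    rw [hj]
    exact hMne K j x
  · intro K K' K'' a b a' b' o o' o'' ha hb ha' hb' e e'
    have q := hQ ⟨K, o⟩
    have q' := hQ ⟨K', o'⟩
    have q'' := hQ ⟨K'', o''⟩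
    simp only at q q' q''
    refine hP ⟨K, o⟩ ⟨K', o'⟩ ⟨K'', o''⟩ a b a' b' ha hb ha' hb' ?_ ?_
    · rw [← q, ← q']; exact e
    · rw [← q, ← q'']; exact e'
end

section
/- Let k > 2 be an integer and let c be a proper k-coloring (with colors 0,1,...,k−1) of a finite simple graph G on n vertices such that the tight-arc digraph D_c(G) is acyclic. Then the circular chromatic number of G is strictly less than k; in particular, G admits a (k(n+1)−1, n+1)-coloring. -/
open SimpleGraph

/-- A proper `k`-coloring of `G` with colors `0, 1, ..., k-1`. -/
def IsProperColoring {V : Type*} (G : SimpleGraph V) (k : ℕ) (c : V → ℕ) : Prop :=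
  (∀ v, c v < k) ∧ ∀ x y, G.Adj x y → c x ≠ c y

/-- `(x, y)` is a tight arc with respect to the `k`-coloring `c`: `x` and `y` are adjacent and
`c y ≡ c x + 1 (mod k)`.  The digraph `D_c(G)` has the tight arcs as its arcs. -/
def TightArc {V : Type*} (G : SimpleGraph V) (k : ℕ) (c : V → ℕ) (x y : V) : Prop :=
  G.Adj x y ∧ c y = (c x + 1) % k

/-- The tight-arc digraph `D_c(G)` is acyclic: no vertex is reachable from itself by a
nontrivial directed walk of tight arcs. -/
def TightAcyclic {V : Type*} (G : SimpleGraph V) (k : ℕ) (c : V → ℕ) : Prop :=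
  ∀ x, ¬ Relation.TransGen (TightArc G k c) x x

theorem exists_rank_of_tightAcyclic
    {V : Type*} [Fintype V] (R : V → V → Prop) (hR : ∀ x, ¬ Relation.TransGen R x x) :
    ∃ r : V → ℕ, (∀ v, r v < Fintype.card V) ∧ ∀ x y, R x y → r x < r y := by
  classical
  refine ⟨fun v => (Finset.univ.filter fun u => Relation.TransGen R u v).card, ?_, ?_⟩
  · intro v
    refine Finset.card_lt_univ_of_notMem (x := v) ?_
    simpa using hR v
  · intro x y h
    apply Finset.card_lt_card
    rw [Finset.ssubset_iff_of_subset]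
    · exact ⟨x, by simpa using Relation.TransGen.single h, by simpa using hR x⟩
    · intro u hu
      simp only [Finset.mem_filter, Finset.mem_univ, true_and] at hu ⊢
      exact hu.tail h

/-- If `k > 2` and `c` is a proper `k`-coloring of a finite simple graph `G` on `n` vertices
whose tight-arc digraph `D_c(G)` is acyclic, then the circular chromatic number of `G` is
strictly less than `k`; in particular `G` admits a `(k(n+1)-1, n+1)`-coloring. -/
theorem pq_coloring_of_tightAcyclic
    {V : Type*} [Fintype V] (G : SimpleGraph V) (k : ℕ) (hk : 2 < k)
    (c : V → ℕ) (hc : IsProperColoring G k c)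
    (hacyclic : TightAcyclic G k c) :
    ∃ f, IsPQColoring G (k * (Fintype.card V + 1) - 1) (Fintype.card V + 1) f := by
  obtain ⟨r, hrn, hr⟩ := exists_rank_of_tightAcyclic _ hacyclic
  obtain ⟨hck, hcp⟩ := hc
  generalize Fintype.card V = n at *
  have hp : 1 ≤ k * (n + 1) := Nat.mul_pos (by omega) (by omega)
  have key : ∀ x y, G.Adj x y → c y < c x →
      ((n + 1 : ℕ) : ℤ) ≤ ((c x * (n + 1) + r x : ℕ) : ℤ) - ((c y * (n + 1) + r y : ℕ) : ℤ) ∧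
      ((c x * (n + 1) + r x : ℕ) : ℤ) - ((c y * (n + 1) + r y : ℕ) : ℤ)
        ≤ ((k * (n + 1) - 1 : ℕ) : ℤ) - ((n + 1 : ℕ) : ℤ) := by
    intro x y hxy hlt
    have hx := hrn x
    have hy := hrn y
    have hcx := hck x
    rw [Nat.cast_sub hp]
    constructor
    · by_cases h1 : c x = c y + 1
      · have := hr y x ⟨hxy.symm, by rw [Nat.mod_eq_of_lt (by omega)]; exact h1⟩
        rw [h1]
        push_cast
        zify at this
        linarith
      · have h2 : (c y + 2) * (n + 1) ≤ c x * (n + 1) := Nat.mul_le_mul_right _ (by omega)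
        zify at h2 hx hy
        push_cast
        linarith
    · by_cases h1 : c x + 1 = k ∧ c y = 0
      · have := hr x y ⟨hxy, by rw [h1.1, Nat.mod_self]; exact h1.2⟩
        rw [h1.2, ← h1.1]
        push_cast
        zify at this
        linarith
      · have h2 : (c x + 2) * (n + 1) ≤ (c y + k) * (n + 1) := Nat.mul_le_mul_right _ (by omega)
        zify at h2 hx hy
        push_cast
        linarith
  refine ⟨fun v => c v * (n + 1) + r v, ?_, ?_⟩
  · intro v
    have h1 : (c v + 1) * (n + 1) ≤ k * (n + 1) := Nat.mul_le_mul_right _ (hck v)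
    have h2 := hrn v
    have h3 : (c v + 1) * (n + 1) = c v * (n + 1) + (n + 1) := by ring
    show c v * (n + 1) + r v < k * (n + 1) - 1
    omega
  · intro x y hxy
    rcases lt_or_gt_of_ne (hcp x y hxy) with h | h
    · have := key y x hxy.symm h
      rw [abs_sub_comm, abs_of_nonneg (by linarith [this.1, Int.natCast_nonneg (n + 1)])]
      exact this
    · have := key x y hxy h
      rw [abs_of_nonneg (by linarith [this.1, Int.natCast_nonneg (n + 1)])]
      exact this
end

section
/- Let G be a finite cubic simple graph of girth at least 4 with a perfect matching M, and let C be an even cycle of G−M. Let c_C be the partial 4-edge-coloring of G that assigns color 0 to every edge of M and colors the edges of C alternately 1 and 2, leaving all other edges uncolored. Then for every M-edge e = xy incident to C and for every valid 4-edge-coloring c of G with respect to M extending c_C, the edge e is completely blocked with respect to c. -/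
open SimpleGraph

theorem edgeOnComp_of_ne_zero {V : Type*} (G : SimpleGraph V) (M : G.Subgraph)
    (K : (MinusM G M).ConnectedComponent) (c : Sym2 V → ℕ) (hc : IsValidColoring G M c)
    (f : Sym2 V) (hf : f ∈ G.edgeSet) (h0 : c f ≠ 0) (v : V) (hv : v ∈ f) (hvK : v ∈ K.supp) :
    EdgeOnComp G M K f := by
  have hfM : f ∉ M.edgeSet := fun h => h0 (hc.2.1 f h)
  obtain ⟨w, rfl⟩ := Sym2.mem_iff_exists.1 hv
  have hadj : (MinusM G M).Adj v w := by
    unfold MinusM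
    rw [SimpleGraph.sdiff_adj]
    exact ⟨hf, fun h => hfM h⟩
  refine ⟨hadj, ?_⟩
  intro u hu
  rcases Sym2.mem_iff.1 hu with rfl | rfl
  · exact hvK
  · rw [SimpleGraph.ConnectedComponent.mem_supp_iff] at hvK ⊢
    rw [← hvK]
    exact SimpleGraph.ConnectedComponent.sound hadj.reachable.symm

/-- Let `G` be a finite cubic simple graph of girth at least 4 with perfect matching `M`, and
let `K` be an even cycle of `G - M`.  For every valid 4-edge-coloring `c` of `G` with respect
to `M` (any such coloring assigns `0` to all `M`-edges and colors the edges of `K`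
alternately `1` and `2`, i.e. extends a partial coloring `c_K` as in the statement), every
`M`-edge incident to `K` is completely blocked with respect to `c`. -/
theorem completelyBlocked_of_even_cycle
    {V : Type*} [Fintype V] [DecidableEq V] (G : SimpleGraph V) [DecidableRel G.Adj]
    (hcubic : ∀ v, G.degree v = 3) (hgirth : 4 ≤ G.egirth)
    (M : G.Subgraph) (hM : M.IsPerfectMatching)
    (K : (MinusM G M).ConnectedComponent) (hK : Even K.supp.ncard)
    (c : Sym2 V → ℕ) (hc : IsValidColoring G M c)
    (e : Sym2 V) (he : e ∈ M.edgeSet) (hinc : ∃ v ∈ e, v ∈ K.supp) :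
    CompletelyBlocked G c e := by
  intro x y hxy hU
  subst hxy
  have key : ∀ f ∈ G.edgeSet, c f ≠ 0 → (∃ v, v ∈ f ∧ v ∈ K.supp) →
      (c f = 1 ∨ c f = 2) ∧ ∀ v ∈ f, v ∈ K.supp := by
    rintro f hf h0 ⟨v, hv, hvK⟩
    have h := edgeOnComp_of_ne_zero G M K c hc f hf h0 v hv hvK
    exact ⟨(hc.2.2 K).1 hK f h, h.2⟩
  have he0 := hc.2.1 _ he
  obtain ⟨l₁, l₂, h₁, h₂, hch, -, hlast, hx, hy⟩ := hU
  have hch : List.IsChain (EdgeTightArc G c) (l₁ ++ s(x, y) :: l₂) := hch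
  rw [List.isChain_append] at hch
  obtain ⟨-, hch2, hj⟩ := hch
  obtain ⟨v, hv, hvK⟩ := hinc
  rcases Sym2.mem_iff.1 hv with rfl | rfl
  · have ht := hj (l₁.getLast h₁) (by simp [List.getLast?_eq_getLast_of_ne_nil h₁]) s(v, y) (by simp)
    have hlt := hc.1.1 _ ht.1
    have hcol := ht.2.2.2.2
    have := (key _ ht.1 (by omega) ⟨v, hx, hvK⟩).1
    omega
  · match l₂, h₂, hch2, hlast, hy with
    | [a], _, hch2, hlast, hy =>
      simp only [List.isChain_cons_cons] at hch2
      have := hch2.1.2.2.2.2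
      simp only [List.getLast_singleton] at hlast
      omega
    | [a, b], _, hch2, hlast, hy =>
      simp only [List.isChain_cons_cons] at hch2
      have h1 := hch2.1.2.2.2.2
      have h2 := hch2.2.1.2.2.2.2
      simp at hlast
      omega
    | a :: b :: d :: l, _, hch2, hlast, hy =>
      simp only [List.isChain_cons_cons] at hch2
      obtain ⟨⟨-, ha, -, -, h1⟩, ⟨-, hb, -, ⟨p, hpa, hpb⟩, h2⟩,
        ⟨-, hd, -, ⟨q, hqb, hqd⟩, h3⟩, -⟩ := hch2
      have ka := key a ha (by omega) ⟨v, hy, hvK⟩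
      have kb := key b hb (by omega) ⟨p, hpb, ka.2 p hpa⟩
      have kd := key d hd (by omega) ⟨q, hqd, kb.2 q hqb⟩
      omega
end
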